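/- For every ε > 0 there exists n₀ such that for all n ≥ n₀ the semigroup S_n coincides with the numerical semigroup S_n^{3+ε} generated by the primes q with p_n ≤ q and (q : ℝ) < (3+ε)·p_n; in particular every atom of S_n lies in the interval [p_n, (3+ε)·p_n). -/

import Mathlib

open Filter Pointwise

/-- `nthPrime n` is the `n`-th prime number (1-indexed): `nthPrime 1 = 2`, etc. -/
noncomputable def nthPrime (n : ℕ) : ℕ := Nat.nth Nat.Prime (n - 1)

/-- `S n` is the additive submonoid of `ℕ` generated by the primes `q ≥ nthPrime n`. -/
def S (n : ℕ) : AddSubmonoid ℕ :=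
  AddSubmonoid.closure {q : ℕ | q.Prime ∧ nthPrime n ≤ q}

/-- `frob n` is the Frobenius number of `S n`: the largest natural number not in `S n`. -/
noncomputable def frob (n : ℕ) : ℕ := sSup {m : ℕ | m ∉ S n}

/-- `genus n` is the number of natural numbers not in `S n`. -/
noncomputable def genus (n : ℕ) : ℕ := {m : ℕ | m ∉ S n}.ncard

/-- `atoms n` is the minimal generating set `S n \ {0} \ ((S n \ {0}) + (S n \ {0}))`. -/
def atoms (n : ℕ) : Set ℕ :=
  ((S n : Set ℕ) \ {0}) \ (((S n : Set ℕ) \ {0}) + ((S n : Set ℕ) \ {0}))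

/-- `u n` is the largest atom of `S n`. -/
noncomputable def u (n : ℕ) : ℕ := sSup (atoms n)

/-- `e n` is the embedding dimension of `S n`: the number of atoms. -/
noncomputable def e (n : ℕ) : ℕ := (atoms n).ncard

/-- `Sx n x` is the additive submonoid of `ℕ` generated by the primes `q` with
`nthPrime n ≤ q` and `(q : ℝ) < x * nthPrime n`. -/
def Sx (n : ℕ) (x : ℝ) : AddSubmonoid ℕ :=
  AddSubmonoid.closure {q : ℕ | q.Prime ∧ nthPrime n ≤ q ∧ (q : ℝ) < x * (nthPrime n : ℝ)}

section

open Finset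

/-- The additive character `x ↦ exp (2 π i x)` of `ℝ`. -/
noncomputable def ee (x : ℝ) : ℂ := Complex.exp ((2 * Real.pi * x : ℝ) * Complex.I)

lemma norm_ee (x : ℝ) : ‖ee x‖ = 1 := Complex.norm_exp_ofReal_mul_I _

lemma ee_add (x y : ℝ) : ee (x + y) = ee x * ee y := by
  rw [ee, ee, ee, ← Complex.exp_add]; congr 1; push_cast; ring

lemma ee_zero : ee 0 = 1 := by simp [ee]

lemma ee_neg_mul (x : ℝ) : ee (-x) * ee x = 1 := by
  rw [← ee_add]; simp [ee_zero]

lemma ee_int (n : ℤ) : ee n = 1 := by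
  rw [ee, Complex.exp_eq_one_iff]; exact ⟨n, by push_cast; ring⟩

lemma ee_add_int (x : ℝ) (n : ℤ) : ee (x + n) = ee x := by rw [ee_add, ee_int, mul_one]

lemma ee_fract (x : ℝ) : ee (Int.fract x) = ee x := by
  conv_rhs => rw [← Int.fract_add_floor x, ee_add_int]

lemma ee_eq_one_iff (x : ℝ) : ee x = 1 ↔ ∃ n : ℤ, x = n := by
  constructor
  · intro h
    rw [ee, Complex.exp_eq_one_iff] at h
    obtain ⟨n, hn⟩ := h
    refine ⟨n, ?_⟩
    have h1 : ((2 * Real.pi * x : ℝ) : ℂ) = ((n * (2 * Real.pi) : ℝ) : ℂ) := by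
      apply mul_right_cancel₀ Complex.I_ne_zero
      rw [hn]; push_cast; ring
    have h2 := Complex.ofReal_injective h1
    have h3 : (2 * Real.pi) ≠ 0 := by positivity
    apply mul_left_cancel₀ h3
    rw [h2]; ring
  · rintro ⟨n, rfl⟩; exact ee_int n

lemma ee_nat_mul (x : ℝ) (n : ℕ) : ee (n * x) = ee x ^ n := by
  induction n with
  | zero => simp [ee_zero]
  | succ n ih => rw [pow_succ, ← ih, ← ee_add]; congr 1; push_cast; ring

lemma norm_ee_sub_le (x y : ℝ) : ‖ee x - ee y‖ ≤ 2 * Real.pi * |x - y| := by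
  have h : ee x - ee y = ee y * (ee (x - y) - 1) := by
    rw [mul_sub, ← ee_add, mul_one]; congr 2; ring
  rw [h, norm_mul, norm_ee, one_mul, ee, mul_comm _ Complex.I]
  refine (Real.norm_exp_I_mul_ofReal_sub_one_le).trans ?_
  rw [Real.norm_eq_abs, abs_mul, abs_of_pos (by positivity)]

lemma sum_ee_div (M : ℕ) (hM : 0 < M) (k : ℤ) :
    ∑ r ∈ range M, ee (r * k / M) = if (M : ℤ) ∣ k then (M : ℂ) else 0 := by
  have hM' : (M : ℝ) ≠ 0 := by positivity
  have h : ∀ r : ℕ, ee (r * k / M) = ee (k / M) ^ r := fun r => by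
    rw [← ee_nat_mul]; congr 1; ring
  simp_rw [h]
  split_ifs with hk
  · obtain ⟨j, rfl⟩ := hk
    have : ee (((M : ℤ) * j : ℤ) / M : ℝ) = 1 := by
      rw [← ee_int j]; congr 1; push_cast; field_simp
    simp only [this]
    simp
  · have h1 : ee (k / M) ≠ 1 := by
      intro h1
      obtain ⟨n, hn⟩ := (ee_eq_one_iff _).1 h1
      apply hk
      refine ⟨n, ?_⟩
      rw [div_eq_iff hM'] at hn
      have : (k : ℝ) = ((M * n : ℤ) : ℝ) := by push_cast; rw [hn]; ring
      exact_mod_cast this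
    rw [geom_sum_eq h1, ← ee_nat_mul]
    have : ee (M * (k / M)) = 1 := by rw [← ee_int k]; congr 1; field_simp
    rw [this]; simp

lemma ee_neg (x : ℝ) : ee (-x) = (starRingEnd ℂ) (ee x) := by
  rw [ee, ee, ← Complex.exp_conj]
  congr 1
  simp only [map_mul, Complex.conj_I, Complex.conj_ofReal]
  push_cast; ring

/-- Parseval's identity on `ℤ / M`, for a function living on representatives of distinct
classes. -/
lemma parseval_ee {M : ℕ} (hM : 0 < M) (A : Finset ℤ) (g : ℤ → ℂ)
    (hA : ∀ a ∈ A, ∀ b ∈ A, (M : ℤ) ∣ a - b → a = b) :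
    ∑ r ∈ range M, ‖∑ a ∈ A, g a * ee (a * (r / M))‖ ^ 2 = M * ∑ a ∈ A, ‖g a‖ ^ 2 := by
  have key : ∑ r ∈ range M, ((‖∑ a ∈ A, g a * ee (a * (r / M))‖ ^ 2 : ℝ) : ℂ) =
      M * ∑ a ∈ A, ((‖g a‖ ^ 2 : ℝ) : ℂ) := by
    have h1 : ∀ r : ℕ, ((‖∑ a ∈ A, g a * ee (a * (r / M))‖ ^ 2 : ℝ) : ℂ) =
        ∑ a ∈ A, ∑ b ∈ A, g a * (starRingEnd ℂ) (g b) * ee (r * ((a - b : ℤ) : ℝ) / M) := by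
      intro r
      rw [Complex.ofReal_pow, ← Complex.mul_conj', map_sum, sum_mul_sum]
      refine sum_congr rfl fun a _ => sum_congr rfl fun b _ => ?_
      rw [map_mul, ← ee_neg]
      have : ee (r * ((a - b : ℤ) : ℝ) / M) = ee (a * (r / M)) * ee (-(b * (r / M))) := by
        rw [← ee_add]; congr 1; push_cast; ring
      rw [this]; ring
    simp_rw [h1]
    rw [sum_comm, mul_sum]
    refine sum_congr rfl fun a ha => ?_
    rw [sum_comm, sum_eq_single a]
    · rw [← mul_sum, sum_ee_div M hM, sub_self, if_pos (dvd_zero _), Complex.mul_conj',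
        Complex.ofReal_pow]
      ring
    · intro b hb hba
      rw [← mul_sum, sum_ee_div M hM, if_neg, mul_zero]
      exact fun h => hba (hA a ha b hb h).symm
    · exact fun h => absurd ha h
  exact_mod_cast key

end

section

open Finset

lemma sum_Ico_ge_of_parity_average {F : ℤ → ℝ} {T : ℕ} {lo hi : ℤ} {η : ℝ}
    (h : ∀ a : ℤ, lo ≤ a → a ≤ hi → η * T ≤ ∑ t ∈ range T, F (a + 2 * t)) (k : ℕ) :
    ∀ a : ℤ, lo ≤ a → a + 2 * T * k ≤ hi + 2 * T - 1 →
      η * (2 * T * k) ≤ ∑ x ∈ Ico a (a + 2 * T * k), F x := by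
  have block : ∀ (T : ℕ) (a : ℤ), ∑ x ∈ Ico a (a + 2 * T), F x =
      ∑ t ∈ range T, F (a + 2 * t) + ∑ t ∈ range T, F (a + 1 + 2 * t) := by
    intro T a
    induction T with
    | zero => simp
    | succ n ih =>
      rw [sum_range_succ, sum_range_succ]
      have h1 : Ico a (a + 2 * ((n + 1 : ℕ) : ℤ)) =
          insert (a + 2 * n) (insert (a + 1 + 2 * n) (Ico a (a + 2 * n))) := by
        ext x; simp only [mem_Ico, mem_insert]; push_cast; omega
      rw [h1, sum_insert, sum_insert, ih]
      · ring
      · simp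
      · simp only [mem_Ico, mem_insert]; omega
  induction k with
  | zero => intro a _ _; simp
  | succ n ih =>
    intro a ha hb
    rcases Nat.eq_zero_or_pos T with hT | hT
    · subst hT; simp
    push_cast at hb ⊢
    have hpos : (0 : ℤ) ≤ 2 * T * n := by positivity
    have hT' : (1 : ℤ) ≤ T := by exact_mod_cast hT
    have e : Ico a (a + 2 * T * (n + 1)) = Ico a (a + 2 * T) ∪ Ico (a + 2 * T) (a + 2 * T + 2 * T * n) := by
      rw [Ico_union_Ico_eq_Ico (by omega) (by omega)]; congr 1; ring
    have hd : Disjoint (Ico a (a + 2 * (T : ℤ))) (Ico (a + 2 * T) (a + 2 * T + 2 * T * n)) :=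
      Ico_disjoint_Ico_consecutive _ _ _
    rw [e, sum_union hd, block]
    have e2 : (2 * T * (n + 1) : ℤ) = 2 * T * n + 2 * T := by ring
    have h1 := h a ha (by omega)
    have h2 := h (a + 1) (by omega) (by omega)
    have h3 := ih (a + 2 * T) (by omega) (by omega)
    linarith

lemma abs_add_sub_one_le {a b : ℝ} (ha : 0 ≤ a) (ha1 : a ≤ 1) (hb : 0 ≤ b) (hb1 : b ≤ 1) :
    |a + b - 1| ≤ 2 * (a * b) + 1 - a - b := by
  rw [abs_le]
  constructor <;> nlinarith [mul_nonneg ha hb, mul_nonneg (sub_nonneg.2 ha1) (sub_nonneg.2 hb1)]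

/-- In a ternary convolution of functions `ℤ → [0, 1]` having mean close to `1/2` on all short
progressions of difference `2`, the middle values are large. -/
theorem ternary_sum_ge_of_parity_average {f g h : ℤ → ℝ} {T : ℕ} (hT : 1 ≤ T)
    (hf0 : ∀ x, 0 ≤ f x) (hf1 : ∀ x, f x ≤ 1) (hg0 : ∀ x, 0 ≤ g x) (hg1 : ∀ x, g x ≤ 1)
    (hh0 : ∀ x, 0 ≤ h x) (hh1 : ∀ x, h x ≤ 1)
    (hf : ∀ a : ℤ, 2 * T ≤ a → a ≤ 62 * T → 499 / 1000 * T ≤ ∑ t ∈ range T, f (a + 2 * t))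
    (hg : ∀ a : ℤ, 2 * T ≤ a → a ≤ 62 * T → 499 / 1000 * T ≤ ∑ t ∈ range T, g (a + 2 * t))
    (hh : ∀ a : ℤ, 2 * T ≤ a → a ≤ 62 * T → 499 / 1000 * T ≤ ∑ t ∈ range T, h (a + 2 * t))
    {Y : ℤ} (hY1 : 95 * T ≤ Y) (hY2 : Y ≤ 97 * T) :
    (T : ℝ) ^ 2 / 100 ≤ ∑ x ∈ Ico (61 * T : ℤ) (67 * T), ∑ y ∈ Ico (24 * T : ℤ) (40 * T),
      f y * g (x - y) * h (Y - x) := by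
  by_contra! hlt
  have hT0 : (1 : ℝ) ≤ T := by exact_mod_cast hT
  have hTz : (1 : ℤ) ≤ T := by exact_mod_cast hT
  set Win := Ico (61 * T : ℤ) (67 * T) with hWin
  set J := Ico (24 * T : ℤ) (40 * T) with hJ
  set r : ℤ → ℝ := fun x => ∑ y ∈ J, f y * g (x - y) with hr
  have hr0 : ∀ x, 0 ≤ r x := fun x => sum_nonneg fun y _ => mul_nonneg (hf0 _) (hg0 _)
  have hlt' : ∑ x ∈ Win, r x * h (Y - x) < (T : ℝ) ^ 2 / 100 := by
    simpa only [hr, sum_mul] using hlt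
  set E := Win.filter fun x => r x ≤ T / 10 with hE
  -- the exceptional set is large
  have hWinh : 499 / 1000 * (6 * T) ≤ ∑ x ∈ Win, h (Y - x) := by
    have h1 := sum_Ico_ge_of_parity_average hh 3 (Y - 67 * T + 1) (by omega) (by push_cast; omega)
    have h2 : ∑ x ∈ Win, h (Y - x) =
        ∑ x ∈ Ico (Y - 67 * T + 1) (Y - 67 * T + 1 + 2 * T * (3 : ℕ)), h x := by
      refine sum_nbij' (fun x => Y - x) (fun x => Y - x) ?_ ?_ ?_ ?_ ?_ <;>
        simp only [hWin, mem_Ico] <;> intros <;> (try push_cast at *) <;> (try omega)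
    rw [h2]; push_cast at h1; push_cast; linarith
  have hnotE : ∑ x ∈ Win.filter (fun x => ¬ r x ≤ T / 10), h (Y - x) ≤ T / 10 := by
    have : T / 10 * ∑ x ∈ Win.filter (fun x => ¬ r x ≤ T / 10), h (Y - x) ≤ (T : ℝ) ^ 2 / 100 := by
      rw [mul_sum]
      refine le_trans (sum_le_sum (g := fun x => r x * h (Y - x)) ?_) (le_trans ?_ hlt'.le)
      · intro x hx
        rw [mem_filter] at hx
        exact mul_le_mul_of_nonneg_right (not_le.1 hx.2).le (hh0 _)
      · exact sum_le_sum_of_subset_of_nonneg (filter_subset _ _)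
          fun x _ _ => mul_nonneg (hr0 _) (hh0 _)
    by_contra hc
    have := mul_lt_mul_of_pos_left (not_le.1 hc) (by positivity : (0 : ℝ) < T / 10)
    nlinarith
  have hEcard : 2.8 * (T : ℝ) ≤ #E := by
    have h1 : ∑ x ∈ E, h (Y - x) ≤ #E := by
      simpa using sum_le_sum (s := E) fun x _ => hh1 (Y - x)
    have h2 := sum_filter_add_sum_filter_not Win (fun x => r x ≤ T / 10) (fun x => h (Y - x))
    rw [← hE] at h2
    nlinarith
  have hfJ : 499 / 1000 * (16 * T) ≤ ∑ y ∈ J, f y := by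
    have h1 := sum_Ico_ge_of_parity_average hf 8 (24 * T) (by omega) (by push_cast; omega)
    have : (24 * T + 2 * T * (8 : ℕ) : ℤ) = 40 * T := by push_cast; ring
    rw [this] at h1; push_cast at h1; linarith
  have hgJ : ∀ x ∈ Win, 499 / 1000 * (16 * T) ≤ ∑ y ∈ J, g (x - y) := by
    intro x hx
    rw [hWin, mem_Ico] at hx
    have h1 := sum_Ico_ge_of_parity_average hg 8 (x - 40 * T + 1) (by omega) (by push_cast; omega)
    have h2 : ∑ y ∈ J, g (x - y) =
        ∑ y ∈ Ico (x - 40 * T + 1) (x - 40 * T + 1 + 2 * T * (8 : ℕ)), g y := by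
      refine sum_nbij' (fun y => x - y) (fun y => x - y) ?_ ?_ ?_ ?_ ?_ <;>
        simp only [hJ, mem_Ico] <;> intros <;> (try push_cast at *) <;> (try omega)
    rw [h2]; push_cast at h1; push_cast; linarith
  have hEsub : ∀ x ∈ E, x ∈ Win ∧ r x ≤ T / 10 := fun x hx => mem_filter.1 hx
  have hcardJ : (#J : ℝ) = 16 * T := by
    have : #J = 16 * T := by rw [hJ, Int.card_Ico]; omega
    rw [this]; push_cast; ring
  have hcompl : ∀ x ∈ E, ∑ y ∈ J, |f y + g (x - y) - 1| ≤ 0.232 * T := by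
    intro x hx
    have ⟨hxW, hxr⟩ := hEsub x hx
    have h1 : ∑ y ∈ J, |f y + g (x - y) - 1| ≤
        ∑ y ∈ J, (2 * (f y * g (x - y)) + 1 - f y - g (x - y)) :=
      sum_le_sum fun y _ => abs_add_sub_one_le (hf0 _) (hf1 _) (hg0 _) (hg1 _)
    rw [sum_sub_distrib, sum_sub_distrib, sum_add_distrib, ← mul_sum] at h1
    simp only [sum_const, nsmul_eq_mul, mul_one, hcardJ] at h1
    have h2 := hgJ x hxW
    change _ ≤ 2 * r x + _ - _ - _ at h1
    linarith
  have hpair : ∀ x ∈ E, ∀ x' ∈ E, ∑ y ∈ J, |g (x - y) - g (x' - y)| ≤ 0.464 * T := by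
    intro x hx x' hx'
    have h1 : ∑ y ∈ J, |g (x - y) - g (x' - y)| ≤
        ∑ y ∈ J, (|f y + g (x - y) - 1| + |f y + g (x' - y) - 1|) := by
      refine sum_le_sum fun y _ => ?_
      have h0 : g (x - y) - g (x' - y) = (f y + g (x - y) - 1) - (f y + g (x' - y) - 1) := by ring
      rw [h0]
      simpa only [Real.norm_eq_abs] using norm_sub_le (f y + g (x - y) - 1) (f y + g (x' - y) - 1)
    rw [sum_add_distrib] at h1
    linarith [hcompl x hx, hcompl x' hx']
  set K := Ico (27 * T : ℤ) (35 * T) with hK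
  have hKg : ∀ x ∈ E, ∀ x' ∈ E, ∀ v : ℤ, 0 ≤ v → v < T →
      ∑ u ∈ K, |g (u + v) - g (u + v + (x' - x))| ≤ 0.464 * T := by
    intro x hx x' hx' v hv hv'
    refine le_trans ?_ (hpair x hx x' hx')
    have hxW := (hEsub x hx).1
    rw [hWin, mem_Ico] at hxW
    have h1 : ∑ u ∈ K, |g (u + v) - g (u + v + (x' - x))| =
        ∑ y ∈ K.image (fun u => x - u - v), |g (x - y) - g (x' - y)| := by
      rw [sum_image]
      · refine sum_congr rfl fun u _ => ?_
        congr 3 <;> ring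
      · intro a _ b _ hab; simp only at hab; omega
    rw [h1]
    refine sum_le_sum_of_subset_of_nonneg ?_ fun _ _ _ => abs_nonneg _
    intro y hy
    simp only [mem_image, hK, hJ, mem_Ico] at hy ⊢
    obtain ⟨u, hu, rfl⟩ := hy
    omega
  -- every small even number is an almost period of `g`
  have hperiod : ∀ s ∈ range T, ∑ u ∈ K, |g u - g (u + 2 * s)| ≤ 0.928 * T := by
    intro s hs
    rw [mem_range] at hs
    have hs' : (s : ℤ) < T := by exact_mod_cast hs
    have htri : ∃ x ∈ E, ∃ x' ∈ E, x' - x = s ∨ x' - x = 2 * s := by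
      by_contra! hno
      have hd1 : Disjoint E (E.image (· + (s : ℤ))) := by
        rw [disjoint_left]
        intro x hx hx2
        obtain ⟨x', hx', rfl⟩ := mem_image.1 hx2
        exact (hno _ hx' _ hx).1 (by ring)
      have hd2 : Disjoint (E ∪ E.image (· + (s : ℤ))) (E.image (· + 2 * (s : ℤ))) := by
        rw [disjoint_left]
        intro x hx hx2
        obtain ⟨x', hx', rfl⟩ := mem_image.1 hx2
        rcases mem_union.1 hx with hx | hx
        · exact (hno _ hx' _ hx).2 (by ring)
        · obtain ⟨x'', hx'', he⟩ := mem_image.1 hx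
          exact (hno _ hx' _ hx'').1 (by omega)
      have hsub : (E ∪ E.image (· + (s : ℤ))) ∪ E.image (· + 2 * (s : ℤ)) ⊆
          Ico (61 * T : ℤ) (69 * T) := by
        intro x hx
        simp only [mem_union, mem_image] at hx
        rw [mem_Ico]
        rcases hx with (hx | ⟨x', hx, rfl⟩) | ⟨x', hx, rfl⟩ <;>
        · have := (hEsub _ hx).1
          rw [hWin, mem_Ico] at this
          omega
      have hc := card_le_card hsub
      rw [card_union_of_disjoint hd2, card_union_of_disjoint hd1,
        card_image_of_injective _ (add_left_injective _),
        card_image_of_injective _ (add_left_injective _), Int.card_Ico] at hc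
      have hc' : 3 * #E ≤ 8 * T := by omega
      have : (3 * #E : ℝ) ≤ 8 * T := by exact_mod_cast hc'
      nlinarith
    obtain ⟨x, hx, x', hx', he | he⟩ := htri
    · have h1 := hKg x hx x' hx' 0 le_rfl (by omega)
      have h2 := hKg x hx x' hx' s (by omega) hs'
      have h3 : ∑ u ∈ K, |g u - g (u + 2 * s)| ≤ ∑ u ∈ K, (|g (u + 0) - g (u + 0 + (x' - x))| +
          |g (u + s) - g (u + s + (x' - x))|) := by
        refine sum_le_sum fun u _ => ?_
        have := abs_sub_le (g u) (g (u + s)) (g (u + 2 * s))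
        rw [he, add_zero, show u + s + (s : ℤ) = u + 2 * s by ring]
        exact this
      rw [sum_add_distrib] at h3
      linarith
    · have h1 := hKg x hx x' hx' 0 le_rfl (by omega)
      rw [he] at h1
      simp only [add_zero] at h1
      linarith
  have havg : ∑ u ∈ K, |T * g u - ∑ s ∈ range T, g (u + 2 * s)| ≤ 0.928 * T * T := by
    calc ∑ u ∈ K, |T * g u - ∑ s ∈ range T, g (u + 2 * s)|
        ≤ ∑ u ∈ K, ∑ s ∈ range T, |g u - g (u + 2 * s)| := by
          refine sum_le_sum fun u _ => ?_
          have : T * g u - ∑ s ∈ range T, g (u + 2 * s) =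
              ∑ s ∈ range T, (g u - g (u + 2 * s)) := by
            rw [sum_sub_distrib]; simp
          rw [this]
          exact abs_sum_le_sum_abs _ _
      _ = ∑ s ∈ range T, ∑ u ∈ K, |g u - g (u + 2 * s)| := sum_comm
      _ ≤ ∑ s ∈ range T, 0.928 * (T : ℝ) := sum_le_sum hperiod
      _ = 0.928 * T * T := by simp; ring
  obtain ⟨x, hx⟩ : E.Nonempty := by
    rw [← card_pos]
    have : (0 : ℝ) < #E := by linarith
    exact_mod_cast this
  have ⟨hxW, hxr⟩ := hEsub x hx
  rw [hWin, mem_Ico] at hxW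
  have hfK : 499 / 1000 * (8 * T) ≤ ∑ u ∈ K, f (x - u) := by
    have h1 := sum_Ico_ge_of_parity_average hf 4 (x - 35 * T + 1) (by omega) (by push_cast; omega)
    have h2 : ∑ u ∈ K, f (x - u) =
        ∑ y ∈ Ico (x - 35 * T + 1) (x - 35 * T + 1 + 2 * T * (4 : ℕ)), f y := by
      refine sum_nbij' (fun y => x - y) (fun y => x - y) ?_ ?_ ?_ ?_ ?_ <;>
        simp only [hK, mem_Ico] <;> intros <;> (try push_cast at *) <;> (try omega)
    rw [h2]; push_cast at h1; push_cast; linarith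
  have hrK : ∑ u ∈ K, f (x - u) * g u ≤ r x := by
    have h1 : ∑ u ∈ K, f (x - u) * g u = ∑ y ∈ K.image (fun u => x - u), f y * g (x - y) := by
      rw [sum_image]
      · refine sum_congr rfl fun u _ => ?_
        congr 2; ring
      · intro a _ b _ hab; simp only at hab; omega
    rw [h1]
    refine sum_le_sum_of_subset_of_nonneg ?_ fun _ _ _ => mul_nonneg (hf0 _) (hg0 _)
    intro y hy
    simp only [mem_image, hK, hJ, mem_Ico] at hy ⊢
    obtain ⟨u, hu, rfl⟩ := hy
    omega
  have hfinal : 499 / 1000 * T * ∑ u ∈ K, f (x - u) - 0.928 * T * T ≤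
      T * ∑ u ∈ K, f (x - u) * g u := by
    have : ∑ u ∈ K, (499 / 1000 * T * f (x - u) - |T * g u - ∑ s ∈ range T, g (u + 2 * s)|) ≤
        ∑ u ∈ K, T * (f (x - u) * g u) := by
      refine sum_le_sum fun u hu => ?_
      rw [hK, mem_Ico] at hu
      have h1 := hg u (by omega) (by omega)
      have h2 := neg_abs_le (T * g u - ∑ s ∈ range T, g (u + 2 * s))
      have h3 := abs_nonneg (T * g u - ∑ s ∈ range T, g (u + 2 * s))
      have h4 : 499 / 1000 * T - |T * g u - ∑ s ∈ range T, g (u + 2 * s)| ≤ T * g u := by linarith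
      have h5 := mul_le_mul_of_nonneg_left h4 (hf0 (x - u))
      have h6 := mul_le_mul_of_nonneg_right (hf1 (x - u)) h3
      nlinarith
    rw [sum_sub_distrib, ← mul_sum, ← mul_sum] at this
    linarith
  nlinarith

end

section

open Finset

/-- The Fourier transform of `f` restricted to `[0, N)`. -/
noncomputable def ftZ (f : ℤ → ℝ) (N : ℕ) (α : ℝ) : ℂ :=
  ∑ x ∈ Ico (0 : ℤ) N, (f x : ℂ) * ee (x * α)

lemma ftZ_shift {f : ℤ → ℝ} {L N : ℕ} (hf : ∀ x, f x ≠ 0 → 0 ≤ x ∧ x < L) {c : ℤ} (hc : 0 ≤ c)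
    (hcN : L + c ≤ N) (α : ℝ) :
    ftZ (fun x => f (x - c)) N α = ee (c * α) * ftZ f L α := by
  rw [ftZ, ftZ, mul_sum]
  symm
  calc ∑ x ∈ Ico (0 : ℤ) L, ee (c * α) * ((f x : ℂ) * ee (x * α))
      = ∑ x ∈ (Ico (0 : ℤ) L).image (· + c), (f (x - c) : ℂ) * ee (x * α) := by
        rw [sum_image fun a _ b _ h => by simpa using h]
        refine sum_congr rfl fun x _ => ?_
        rw [add_sub_cancel_right]
        have : ((x + c : ℤ) : ℝ) * α = c * α + x * α := by push_cast; ring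
        rw [this, ee_add]; ring
    _ = _ := by
        refine sum_subset ?_ ?_
        · intro x hx
          obtain ⟨y, hy, rfl⟩ := mem_image.1 hx
          rw [mem_Ico] at hy ⊢; omega
        · intro x _ hx
          have : f (x - c) = 0 := by
            by_contra h
            have := hf _ h
            exact hx (mem_image.2 ⟨x - c, by rw [mem_Ico]; omega, by ring⟩)
          simp [this]

/-- The smoothing of `f` by two independent uniform elements of `B`. -/
noncomputable def smoothing (B : Finset ℤ) (f : ℤ → ℝ) (x : ℤ) : ℝ :=
  (∑ b ∈ B, ∑ b' ∈ B, f (x - (b + b'))) / (#B : ℝ) ^ 2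

/-- The Fourier transform of the uniform measure on `B`. -/
noncomputable def meanEE (B : Finset ℤ) (α : ℝ) : ℂ := (∑ b ∈ B, ee (b * α)) / (#B : ℂ)

lemma ftZ_smoothing {f : ℤ → ℝ} {L N T : ℕ} (hf : ∀ x, f x ≠ 0 → 0 ≤ x ∧ x < L) {B : Finset ℤ}
    (hB : ∀ b ∈ B, 0 ≤ b ∧ 2 * b ≤ T) (hN : L + T ≤ N) (α : ℝ) :
    ftZ (smoothing B f) N α = ftZ f L α * meanEE B α ^ 2 := by
  have h1 : ftZ (smoothing B f) N α =
      (∑ b ∈ B, ∑ b' ∈ B, ftZ (fun x => f (x - (b + b'))) N α) / (#B : ℂ) ^ 2 := by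
    simp only [ftZ, smoothing]
    simp_rw [Complex.ofReal_div, Complex.ofReal_sum, div_mul_eq_mul_div, sum_mul]
    rw [← sum_div, sum_comm]
    congr 1
    · exact sum_congr rfl fun b _ => by rw [sum_comm]
    · push_cast; rfl
  have h2 : ∀ b ∈ B, ∀ b' ∈ B, ftZ (fun x => f (x - (b + b'))) N α =
      ftZ f L α * (ee (b * α) * ee (b' * α)) := by
    intro b hb b' hb'
    have := hB b hb
    have := hB b' hb'
    rw [ftZ_shift hf (by omega) (by omega), ← ee_add, mul_comm]
    congr 2
    push_cast; ring
  rw [h1, sum_congr rfl fun b hb => sum_congr rfl fun b' hb' => h2 b hb b' hb']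
  simp_rw [← mul_sum]
  rw [← sum_mul, meanEE, div_pow, sq (∑ b ∈ B, _)]
  ring

lemma norm_meanEE_le (B : Finset ℤ) (α : ℝ) : ‖meanEE B α‖ ≤ 1 := by
  rw [meanEE, norm_div, Complex.norm_natCast]
  refine div_le_one_of_le₀ ?_ (by positivity)
  exact (norm_sum_le _ _).trans (by simp [norm_ee])

lemma sum_norm_meanEE_sq {M : ℕ} (hM : 0 < M) {B : Finset ℤ} (hB : ∀ b ∈ B, 0 ≤ b ∧ b < M) :
    ∑ r ∈ range M, ‖meanEE B (r / M)‖ ^ 2 = M / #B := by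
  have h := parseval_ee hM B (fun _ => 1) (by
    intro a ha b hb hab
    have := hB a ha
    have := hB b hb
    have := Int.eq_zero_of_abs_lt_dvd hab (by rw [abs_lt]; omega)
    omega)
  simp only [one_mul, norm_one, one_pow, sum_const, nsmul_eq_mul, mul_one] at h
  simp_rw [meanEE, norm_div, Complex.norm_natCast, div_pow]
  rw [← sum_div, h]
  rcases eq_or_ne (#B : ℝ) 0 with h0 | h0
  · simp [h0]
  · field_simp

lemma ftZ_inversion (g : ℤ → ℝ) {N M : ℕ} (hM : 0 < M) (hN : N ≤ M) {x : ℤ} (hx : 0 ≤ x)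
    (hxN : x < N) :
    (g x : ℂ) = (∑ r ∈ range M, ftZ g N (r / M) * ee (-(x * (r / M)))) / M := by
  have hM' : (M : ℂ) ≠ 0 := by exact_mod_cast hM.ne'
  rw [eq_div_iff hM']
  have h1 : ∀ r : ℕ, ftZ g N (r / M) * ee (-(x * (r / M))) =
      ∑ y ∈ Ico (0 : ℤ) N, (g y : ℂ) * ee (r * ((y - x : ℤ) : ℝ) / M) := by
    intro r
    rw [ftZ, sum_mul]
    refine sum_congr rfl fun y _ => ?_
    rw [mul_assoc, ← ee_add]
    congr 2
    push_cast; ring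
  simp_rw [h1]
  rw [sum_comm, sum_eq_single x]
  · rw [← mul_sum, sum_ee_div M hM, if_pos (by simp)]
  · intro y hy hyx
    rw [← mul_sum, sum_ee_div M hM, if_neg, mul_zero]
    intro h
    rw [mem_Ico] at hy
    have := Int.eq_zero_of_abs_lt_dvd h (by rw [abs_lt]; omega)
    omega
  · intro h
    exact absurd (mem_Ico.2 ⟨hx, hxN⟩) h

lemma ternary_sum_eq_ftZ (f g h : ℤ → ℝ) {N M : ℕ} (hM : 0 < M) {Y : ℤ} (hY : Y < M)
    (hN : 3 * (N : ℤ) ≤ M + Y) :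
    ∑ x ∈ Ico (0 : ℤ) N, ∑ y ∈ Ico (0 : ℤ) N, ∑ z ∈ Ico (0 : ℤ) N,
      (if x + y + z = Y then (f x : ℂ) * g y * h z else 0) =
    (∑ r ∈ range M, ftZ f N (r / M) * ftZ g N (r / M) * ftZ h N (r / M) *
      ee (-(Y * (r / M)))) / M := by
  have hM' : (M : ℂ) ≠ 0 := by exact_mod_cast hM.ne'
  rw [eq_div_iff hM']
  have h1 : ∀ r : ℕ, ftZ f N (r / M) * ftZ g N (r / M) * ftZ h N (r / M) * ee (-(Y * (r / M))) =
      ∑ x ∈ Ico (0 : ℤ) N, ∑ y ∈ Ico (0 : ℤ) N, ∑ z ∈ Ico (0 : ℤ) N,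
        (f x : ℂ) * g y * h z * ee (r * ((x + y + z - Y : ℤ) : ℝ) / M) := by
    intro r
    rw [ftZ, ftZ, ftZ, sum_mul_sum, sum_mul, sum_mul]
    refine sum_congr rfl fun x _ => ?_
    rw [sum_mul, sum_mul]
    refine sum_congr rfl fun y _ => ?_
    rw [mul_sum, sum_mul]
    refine sum_congr rfl fun z _ => ?_
    have : ee (r * ((x + y + z - Y : ℤ) : ℝ) / M) =
        ee (x * (r / M)) * ee (y * (r / M)) * ee (z * (r / M)) * ee (-(Y * (r / M))) := by
      rw [← ee_add, ← ee_add, ← ee_add]; congr 1; push_cast; ring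
    rw [this]; ring
  simp_rw [h1]
  rw [sum_mul, sum_comm (s := range M)]
  refine sum_congr rfl fun x hx => ?_
  rw [sum_mul, sum_comm (s := range M)]
  refine sum_congr rfl fun y hy => ?_
  rw [sum_mul, sum_comm (s := range M)]
  refine sum_congr rfl fun z hz => ?_
  rw [← mul_sum, sum_ee_div M hM]
  rw [mem_Ico] at hx hy hz
  have : (M : ℤ) ∣ x + y + z - Y ↔ x + y + z = Y := by
    constructor
    · intro h
      have := Int.eq_zero_of_abs_lt_dvd h (by rw [abs_lt]; omega)
      omega
    · intro h; simp [h]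
  simp only [this]
  split_ifs <;> simp

lemma exists_bohr_set (Spec : Finset ℕ) (M : ℕ) {H K : ℕ} (hK : 0 < K) (hH : 0 < H) :
    ∃ B : Finset ℤ, B.Nonempty ∧ H ≤ K ^ #Spec * #B ∧ (∀ b ∈ B, 0 ≤ b ∧ b < H) ∧
      ∀ b ∈ B, ∀ r ∈ Spec, ‖ee (b * (r / M)) - 1‖ ≤ 2 * Real.pi / K := by
  classical
  have hK' : (0 : ℝ) < K := by exact_mod_cast hK
  let φ : ℕ → (Spec → Fin K) := fun b r =>
    ⟨⌊K * Int.fract (b * ((r : ℕ) / M) : ℝ)⌋₊, by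
      rw [Nat.floor_lt (by positivity)]
      nlinarith [Int.fract_lt_one (b * ((r : ℕ) / M) : ℝ)]⟩
  obtain ⟨c, -, hc⟩ : ∃ c ∈ (univ : Finset (Spec → Fin K)),
      (H : ℝ) / K ^ #Spec ≤ #{b ∈ range H | φ b = c} := by
    have := exists_le_card_fiber_of_nsmul_le_card_of_maps_to (s := range H)
      (t := (univ : Finset (Spec → Fin K))) (f := φ) (b := (H : ℝ) / K ^ #Spec)
      (fun _ _ => mem_univ _) ⟨fun _ => ⟨0, hK⟩, mem_univ _⟩ ?_
    · exact this
    · simp only [card_univ, Fintype.card_pi, Fintype.card_fin, prod_const, Fintype.card_coe,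
        nsmul_eq_mul, card_range]
      push_cast
      rw [mul_div_cancel₀]
      positivity
  set A := {b ∈ range H | φ b = c} with hA
  have hAne : A.Nonempty := by
    rw [← card_pos]
    have h1 : (0 : ℝ) < H / K ^ #Spec := by
      have : (0 : ℝ) < H := by exact_mod_cast hH
      positivity
    exact_mod_cast h1.trans_le hc
  obtain ⟨b0, hb0, hmin⟩ := exists_min_image A id hAne
  have hb0' := mem_filter.1 hb0
  refine ⟨A.image fun b : ℕ => (b : ℤ) - b0, hAne.image _, ?_, ?_, ?_⟩
  · rw [card_image_of_injective _ (fun a b h => by simpa using h)]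
    rw [div_le_iff₀ (by positivity), mul_comm] at hc
    exact_mod_cast hc
  · intro b hb
    obtain ⟨a, ha, rfl⟩ := mem_image.1 hb
    have h1 := hmin a ha
    have h2 := mem_range.1 (mem_filter.1 ha).1
    simp only [id] at h1
    omega
  · intro b hb r hr
    obtain ⟨a, ha, rfl⟩ := mem_image.1 hb
    have h2 : φ a ⟨r, hr⟩ = φ b0 ⟨r, hr⟩ := by rw [(mem_filter.1 ha).2, hb0'.2]
    have h3 : ⌊K * Int.fract (a * (r / M) : ℝ)⌋₊ = ⌊K * Int.fract (b0 * (r / M) : ℝ)⌋₊ :=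
      congrArg Fin.val h2
    have h4 : ee (((a - b0 : ℤ) : ℝ) * (r / M)) - 1 =
        ee (-(b0 * (r / M))) * (ee (Int.fract (a * (r / M) : ℝ)) - ee (Int.fract (b0 * (r / M) : ℝ))) := by
      rw [ee_fract, ee_fract, mul_sub, ee_neg_mul, ← ee_add]
      congr 2
      push_cast; ring
    rw [h4, norm_mul, norm_ee, one_mul]
    refine (norm_ee_sub_le _ _).trans ?_
    rw [div_eq_mul_inv (2 * Real.pi)]
    refine mul_le_mul_of_nonneg_left ?_ (by positivity)
    have hs : ∀ x y : ℝ, 0 ≤ x → 0 ≤ y → ⌊K * x⌋₊ = ⌊K * y⌋₊ → x - y ≤ (K : ℝ)⁻¹ := by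
      intro x y hx hy h
      have h1 := Nat.lt_floor_add_one (K * x)
      have h2 := Nat.floor_le (mul_nonneg hK'.le hy)
      rw [h] at h1
      have : K * (x - y) ≤ 1 := by linarith
      rw [← one_div, le_div_iff₀ hK']; linarith
    rw [abs_le]
    constructor
    · linarith [hs _ _ (Int.fract_nonneg _) (Int.fract_nonneg _) h3.symm]
    · exact hs _ _ (Int.fract_nonneg _) (Int.fract_nonneg _) h3

end

section

open Finset

lemma sum_cube_le_of_level_sets {R : Finset ℕ} {a : ℕ → ℝ} (ha : ∀ r, 0 ≤ a r) {C : ℝ}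
    (h : ∀ s : ℝ, 0 < s → s ≤ 2 → #{r ∈ R | s ^ 2 ≤ a r} * s ^ 5 ≤ C) {s : ℝ} (hs : 0 < s)
    (hs2 : s ≤ 2) : ∑ r ∈ R with a r < s ^ 2, a r ^ 3 ≤ 64 * C * s := by
  have step : ∀ s : ℝ, 0 < s → s ≤ 2 → ∑ r ∈ R with a r < s ^ 2, a r ^ 3 ≤
      32 * C * s + ∑ r ∈ R with a r < (s / 2) ^ 2, a r ^ 3 := by
    intro s hs hs2
    have h1 := sum_filter_add_sum_filter_not (R.filter fun r => a r < s ^ 2)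
      (fun r => a r < (s / 2) ^ 2) (fun r => a r ^ 3)
    have h2 : ∑ r ∈ (R.filter fun r => a r < s ^ 2) with a r < (s / 2) ^ 2, a r ^ 3 =
        ∑ r ∈ R with a r < (s / 2) ^ 2, a r ^ 3 := by
      rw [filter_filter]
      congr 1
      refine filter_congr fun r _ => ⟨fun h => h.2, fun h => ⟨?_, h⟩⟩
      nlinarith
    have h3 : ∑ r ∈ (R.filter fun r => a r < s ^ 2) with ¬ a r < (s / 2) ^ 2, a r ^ 3 ≤
        32 * C * s := by
      calc _ ≤ ∑ r ∈ (R.filter fun r => a r < s ^ 2) with ¬ a r < (s / 2) ^ 2, (s ^ 2) ^ 3 := by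
            refine sum_le_sum fun r hr => ?_
            rw [mem_filter, mem_filter] at hr
            exact pow_le_pow_left₀ (ha r) hr.1.2.le 3
        _ ≤ ∑ r ∈ R with (s / 2) ^ 2 ≤ a r, (s ^ 2) ^ 3 := by
            refine sum_le_sum_of_subset_of_nonneg ?_ fun _ _ _ => by positivity
            intro r hr
            rw [mem_filter, mem_filter] at hr
            exact mem_filter.2 ⟨hr.1.1, not_lt.1 hr.2⟩
        _ = (#{r ∈ R | (s / 2) ^ 2 ≤ a r} * (s / 2) ^ 5) * (32 * s) := by
            rw [sum_const, nsmul_eq_mul]; ring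
        _ ≤ C * (32 * s) := by
            refine mul_le_mul_of_nonneg_right (h _ (by linarith) (by linarith)) (by linarith)
        _ = _ := by ring
    linarith
  have hC : 0 ≤ C := le_trans (by positivity) (h 1 one_pos (by norm_num))
  have iter : ∀ n : ℕ, ∀ s : ℝ, 0 < s → s ≤ 2 → ∑ r ∈ R with a r < s ^ 2, a r ^ 3 ≤
      64 * C * s + #R * ((s / 2 ^ n) ^ 6) := by
    intro n
    induction n with
    | zero =>
      intro s hs hs2
      have : ∑ r ∈ R with a r < s ^ 2, a r ^ 3 ≤ ∑ r ∈ R, (s ^ 2) ^ 3 := by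
        refine (sum_le_sum (g := fun _ => (s ^ 2) ^ 3) fun r hr => ?_).trans
          (sum_le_sum_of_subset_of_nonneg (filter_subset _ _) fun _ _ _ => by positivity)
        exact pow_le_pow_left₀ (ha r) (mem_filter.1 hr).2.le 3
      rw [sum_const, nsmul_eq_mul] at this
      have h0 : 0 ≤ 64 * C * s := by positivity
      calc _ ≤ _ := this
        _ = #R * (s / 2 ^ 0) ^ 6 := by ring
        _ ≤ _ := by linarith
    | succ n ih =>
      intro s hs hs2
      have h1 := step s hs hs2
      have h2 := ih (s / 2) (by linarith) (by linarith)
      have : s / 2 / 2 ^ n = s / 2 ^ (n + 1) := by rw [div_div, pow_succ']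
      rw [this] at h2
      linarith
  have hlim : Filter.Tendsto (fun n : ℕ => 64 * C * s + #R * ((s / 2 ^ n) ^ 6)) Filter.atTop
      (nhds (64 * C * s + #R * 0 ^ 6)) := by
    refine Filter.Tendsto.const_add _ (Filter.Tendsto.const_mul _ (Filter.Tendsto.pow ?_ 6))
    exact tendsto_const_nhds.div_atTop (tendsto_pow_atTop_atTop_of_one_lt (by norm_num))
  have := ge_of_tendsto' hlim fun n => iter n s hs hs2
  simpa using this

lemma mul_mul_le_sum_cubes {a b c : ℝ} (ha : 0 ≤ a) (hb : 0 ≤ b) (hc : 0 ≤ c) :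
    a * b * c ≤ a ^ 3 + b ^ 3 + c ^ 3 := by
  rcases le_total a b with h1 | h1 <;> rcases le_total b c with h2 | h2 <;>
    rcases le_total a c with h3 | h3 <;>
    nlinarith [mul_nonneg ha hb, mul_nonneg hb hc, mul_nonneg ha hc,
      mul_nonneg (add_nonneg (add_nonneg ha hb) hc) (sq_nonneg (a - b)),
      mul_nonneg (add_nonneg (add_nonneg ha hb) hc) (sq_nonneg (a - c)),
      mul_nonneg (add_nonneg (add_nonneg ha hb) hc) (sq_nonneg (b - c)),
      pow_nonneg ha 3, pow_nonneg hb 3, pow_nonneg hc 3]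

/-- The Fourier-analytic majorant property: a nonnegative function with a pseudorandom majorant
is at most `1 + small` after smoothing. -/
lemma smoothing_le {f ν : ℤ → ℝ} {L T M : ℕ} (hL : 0 < L) (hM : L + T ≤ M)
    (hf : ∀ x, f x ≠ 0 → 0 ≤ x ∧ x < L)
    (hfν : ∀ x : ℤ, 0 ≤ x → x < L → f x ≤ ν x) {θ : ℝ}
    (hν : ∀ r ∈ range M, ‖ftZ (fun x => ν x - 1) L (r / M)‖ ≤ θ * L) {B : Finset ℤ}
    (hBne : B.Nonempty) (hB : ∀ b ∈ B, 0 ≤ b ∧ 2 * b ≤ T) {x : ℤ} (hx : 0 ≤ x)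
    (hxN : x < (L + T : ℕ)) :
    smoothing B f x ≤ 1 + θ * L / #B := by
  have hBpos : (0 : ℝ) < #B := by exact_mod_cast hBne.card_pos
  have hMpos : 0 < M := by omega
  set μ : ℤ → ℝ := fun x => if 0 ≤ x ∧ x < L then ν x - 1 else 0 with hμ
  have h1 : smoothing B f x ≤ 1 + smoothing B μ x := by
    have : ∀ y, f y ≤ 1 + μ y := by
      intro y
      by_cases h : 0 ≤ y ∧ y < L
      · simp only [hμ, if_pos h]; linarith [hfν y h.1 h.2]
      · have : f y = 0 := by by_contra h0; exact h (hf y h0)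
        simp only [hμ, if_neg h, this]; norm_num
    have h2 : ∑ b ∈ B, ∑ b' ∈ B, f (x - (b + b')) ≤
        (#B : ℝ) ^ 2 + ∑ b ∈ B, ∑ b' ∈ B, μ (x - (b + b')) := by
      refine (sum_le_sum fun b _ => sum_le_sum fun b' _ => this (x - (b + b'))).trans_eq ?_
      simp only [sum_add_distrib, sum_const, nsmul_eq_mul, mul_one]
      ring
    rw [smoothing, smoothing, div_le_iff₀ (by positivity), add_mul, div_mul_cancel₀ _ (by positivity)]
    linarith
  have hμsupp : ∀ x, μ x ≠ 0 → 0 ≤ x ∧ x < L := by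
    intro x hx
    by_contra h
    exact hx (by simp only [hμ, if_neg h])
  have hμft : ∀ α, ftZ μ L α = ftZ (fun x => ν x - 1) L α := by
    intro α
    refine sum_congr rfl fun y hy => ?_
    rw [mem_Ico] at hy
    simp only [hμ, if_pos hy]
  have h2 : |smoothing B μ x| ≤ θ * L / #B := by
    have h3 := ftZ_inversion (smoothing B μ) hMpos hM hx hxN
    rw [← Real.norm_eq_abs, ← Complex.norm_real, h3, norm_div, Complex.norm_natCast]
    have hM0 : (0 : ℝ) < M := by exact_mod_cast hMpos
    rw [div_le_iff₀ hM0]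
    calc _ ≤ ∑ r ∈ range M, ‖ftZ (smoothing B μ) (L + T) (r / M) * ee (-(x * (r / M)))‖ :=
          norm_sum_le _ _
      _ ≤ ∑ r ∈ range M, θ * L * ‖meanEE B (r / M)‖ ^ 2 := by
          refine sum_le_sum fun r hr => ?_
          rw [norm_mul, norm_ee, mul_one, ftZ_smoothing hμsupp hB le_rfl, norm_mul, norm_pow, hμft]
          exact mul_le_mul_of_nonneg_right (hν r hr) (by positivity)
      _ = _ := by
          rw [← mul_sum, sum_norm_meanEE_sq hMpos]
          · ring
          · intro b hb
            have := hB b hb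
            omega
  linarith [(abs_le.1 h2).2]

end

section

open Finset

/-- The hypotheses of the transference principle, for a function `f` on `[0, 64 T)` with a
majorant `ν`. -/
structure IsDenseModulo (T : ℕ) (θ C : ℝ) (f ν : ℤ → ℝ) : Prop where
  nonneg : ∀ x, 0 ≤ f x
  supp : ∀ x, f x ≠ 0 → 0 ≤ x ∧ x < (64 * T : ℕ)
  le : ∀ x : ℤ, 0 ≤ x → x < (64 * T : ℕ) → f x ≤ ν x
  fourier : ∀ r ∈ range (256 * T), ‖ftZ (fun x => ν x - 1) (64 * T) (r / (256 * T : ℕ))‖ ≤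
    θ * (64 * T : ℕ)
  level : ∀ s : ℝ, 0 < s → s ≤ 2 →
    #{r ∈ range (256 * T) | s ^ 2 ≤ ‖ftZ f (64 * T) ((r : ℕ) / (256 * T : ℕ))‖ / (64 * T : ℕ)} *
      s ^ 5 ≤ C
  avg : ∀ a : ℤ, 0 ≤ a → a ≤ 62 * T → 4995 / 10000 * T ≤ ∑ t ∈ range T, f (a + 2 * t)

lemma norm_ftZ_div_lt {T : ℕ} (hT : 0 < T) {θ C : ℝ} (hθ : θ ≤ 1) {f ν : ℤ → ℝ}
    (h : IsDenseModulo T θ C f ν) (α : ℝ) : ‖ftZ f (64 * T) α‖ / (64 * T : ℕ) < 2 ^ 2 := by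
  have hL : (0 : ℝ) < (64 * T : ℕ) := by positivity
  rw [div_lt_iff₀ hL]
  have h1 : ‖ftZ f (64 * T) α‖ ≤ ∑ x ∈ Ico (0 : ℤ) (64 * T : ℕ), ν x := by
    refine (norm_sum_le _ _).trans (sum_le_sum fun x hx => ?_)
    rw [mem_Ico] at hx
    rw [norm_mul, norm_ee, mul_one, Complex.norm_real, Real.norm_eq_abs, abs_of_nonneg (h.nonneg x)]
    exact h.le x hx.1 hx.2
  have h2 := h.fourier 0 (mem_range.2 (by omega))
  have h3 : ftZ (fun x => ν x - 1) (64 * T) ((0 : ℕ) / (256 * T : ℕ)) =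
      ((∑ x ∈ Ico (0 : ℤ) (64 * T : ℕ), ν x - (64 * T : ℕ) : ℝ) : ℂ) := by
    have : (64 * (T : ℤ)).toNat = 64 * T := by omega
    simp [ftZ, ee_zero, sum_sub_distrib, this]
  rw [h3, Complex.norm_real, Real.norm_eq_abs] at h2
  have h4 := (abs_le.1 h2).2
  nlinarith

lemma norm_pow_six_sub_one_le {z : ℂ} (hz : ‖z‖ ≤ 1) : ‖z ^ 6 - 1‖ ≤ 6 * ‖z - 1‖ := by
  have h : z ^ 6 - 1 = (∑ i ∈ range 6, z ^ i) * (z - 1) := (geom_sum_mul z 6).symm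
  rw [h, norm_mul]
  refine mul_le_mul_of_nonneg_right ?_ (norm_nonneg _)
  refine (norm_sum_le _ _).trans ((sum_le_sum (g := fun _ => (1 : ℝ)) fun i _ => ?_).trans (by simp))
  rw [norm_pow]
  exact pow_le_one₀ (norm_nonneg _) hz

lemma norm_meanEE_sub_one_le {B : Finset ℤ} (hB : B.Nonempty) {α δ : ℝ}
    (h : ∀ b ∈ B, ‖ee (b * α) - 1‖ ≤ δ) : ‖meanEE B α - 1‖ ≤ δ := by
  have hBpos : (0 : ℝ) < #B := by exact_mod_cast hB.card_pos
  have : meanEE B α - 1 = (∑ b ∈ B, (ee (b * α) - 1)) / (#B : ℂ) := by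
    have h0 : (#B : ℂ) ≠ 0 := by exact_mod_cast hBpos.ne'
    rw [meanEE, sum_sub_distrib, sub_div]
    simp [h0]
  rw [this, norm_div, Complex.norm_natCast, div_le_iff₀ hBpos]
  refine (norm_sum_le _ _).trans ((sum_le_sum h).trans ?_)
  simp [mul_comm]

lemma ternary_sum_ge_shifted {f g h : ℤ → ℝ} (hf0 : ∀ x, 0 ≤ f x) (hg0 : ∀ x, 0 ≤ g x)
    (hh0 : ∀ x, 0 ≤ h x) {T N : ℕ} (hN : N = 65 * T) {Y : ℤ} (hY1 : 95 * T ≤ Y)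
    (hY2 : Y ≤ 97 * T) :
    ∑ x ∈ Ico (61 * T : ℤ) (67 * T), ∑ y ∈ Ico (24 * T : ℤ) (40 * T),
      f y * g (x - y) * h (Y - x) ≤
    ∑ x ∈ Ico (0 : ℤ) N, ∑ y ∈ Ico (0 : ℤ) N, ∑ z ∈ Ico (0 : ℤ) N,
      (if x + y + z = Y then f x * g y * h z else 0) := by
  have hnn : ∀ x y z, 0 ≤ (if x + y + z = Y then f x * g y * h z else 0) := by
    intro x y z
    split_ifs
    · exact mul_nonneg (mul_nonneg (hf0 _) (hg0 _)) (hh0 _)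
    · exact le_rfl
  rw [sum_comm]
  calc _ ≤ ∑ x ∈ Ico (24 * T : ℤ) (40 * T), ∑ y ∈ Ico (0 : ℤ) N, ∑ z ∈ Ico (0 : ℤ) N,
      (if x + y + z = Y then f x * g y * h z else 0) := ?_
    _ ≤ _ := by
      refine sum_le_sum_of_subset_of_nonneg ?_
        fun _ _ _ => sum_nonneg fun _ _ => sum_nonneg fun _ _ => hnn _ _ _
      intro x hx
      rw [mem_Ico] at hx ⊢
      omega
  refine sum_le_sum fun x hx => ?_
  rw [mem_Ico] at hx
  calc _ = ∑ y ∈ (Ico (61 * T : ℤ) (67 * T)).image (· - x), f x * g y * h (Y - x - y) := by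
        rw [sum_image fun a _ b _ hab => by simpa using hab]
        refine sum_congr rfl fun y _ => ?_
        congr 2; ring
    _ ≤ ∑ y ∈ (Ico (61 * T : ℤ) (67 * T)).image (· - x), ∑ z ∈ Ico (0 : ℤ) N,
          (if x + y + z = Y then f x * g y * h z else 0) := by
        refine sum_le_sum fun y hy => ?_
        obtain ⟨y, hy', rfl⟩ := mem_image.1 hy
        rw [mem_Ico] at hy'
        refine le_trans ?_ (single_le_sum (fun z _ => hnn x (y - x) z)
          (a := Y - x - (y - x)) (by rw [mem_Ico]; omega))
        rw [if_pos (by ring)]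
    _ ≤ _ := by
        refine sum_le_sum_of_subset_of_nonneg ?_ fun _ _ _ => sum_nonneg fun _ _ => hnn _ _ _
        intro y hy
        obtain ⟨y, hy', rfl⟩ := mem_image.1 hy
        rw [mem_Ico] at hy' ⊢
        omega

lemma smoothing_nonneg {f : ℤ → ℝ} (hf : ∀ x, 0 ≤ f x) (B : Finset ℤ) (x : ℤ) :
    0 ≤ smoothing B f x :=
  div_nonneg (sum_nonneg fun _ _ => sum_nonneg fun _ _ => hf _) (by positivity)

lemma IsDenseModulo.smoothing_le {T : ℕ} (hT : 0 < T) {θ C : ℝ} {f ν : ℤ → ℝ}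
    (h : IsDenseModulo T θ C f ν) {B : Finset ℤ} (hBne : B.Nonempty)
    (hB : ∀ b ∈ B, 0 ≤ b ∧ 2 * b ≤ T) (hθ : 0 ≤ θ) (x : ℤ) :
    smoothing B f x ≤ 1 + θ * (64 * T : ℕ) / #B := by
  by_cases hx : 0 ≤ x ∧ x < (64 * T + T : ℕ)
  · exact _root_.smoothing_le (M := 256 * T) (by omega) (by omega) h.supp h.le h.fourier hBne hB
      hx.1 hx.2
  · have : smoothing B f x = 0 := by
      rw [smoothing, sum_eq_zero, zero_div]
      intro b hb
      refine sum_eq_zero fun b' hb' => ?_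
      by_contra h0
      have h1 := h.supp _ h0
      have := hB b hb
      have := hB b' hb'
      push_cast at *
      omega
    rw [this]
    positivity

lemma IsDenseModulo.smoothing_avg {T : ℕ} {θ C : ℝ} {f ν : ℤ → ℝ}
    (h : IsDenseModulo T θ C f ν) {B : Finset ℤ} (hBne : B.Nonempty)
    (hB : ∀ b ∈ B, 0 ≤ b ∧ 2 * b ≤ T) (a : ℤ) (ha : 2 * T ≤ a) (ha' : a ≤ 62 * T) :
    4995 / 10000 * T ≤ ∑ t ∈ range T, smoothing B f (a + 2 * t) := by
  have hBpos : (0 : ℝ) < #B := by exact_mod_cast hBne.card_pos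
  simp only [smoothing]
  rw [← sum_div, le_div_iff₀ (by positivity), sum_comm]
  calc _ = ∑ b ∈ B, ∑ b' ∈ B, 4995 / 10000 * (T : ℝ) := by
        simp only [sum_const, nsmul_eq_mul]; ring
    _ ≤ _ := by
        refine sum_le_sum fun b hb => ?_
        rw [sum_comm]
        refine sum_le_sum fun b' hb' => ?_
        have := hB b hb
        have := hB b' hb'
        refine (h.avg (a - (b + b')) (by omega) (by omega)).trans_eq ?_
        refine sum_congr rfl fun t _ => ?_
        congr 1; ring

end

section

open Finset

lemma IsDenseModulo.smoothing_ternary {T : ℕ} (hT : 0 < T) {θ C : ℝ} (hθ : 0 ≤ θ)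
    {f g h ν₁ ν₂ ν₃ : ℤ → ℝ} (hf : IsDenseModulo T θ C f ν₁) (hg : IsDenseModulo T θ C g ν₂)
    (hh : IsDenseModulo T θ C h ν₃) {B : Finset ℤ} (hBne : B.Nonempty)
    (hB : ∀ b ∈ B, 0 ≤ b ∧ 2 * b ≤ T) (hθB : θ * (64 * T : ℕ) / #B ≤ 1 / 5000)
    {Y : ℤ} (hY1 : 95 * T ≤ Y) (hY2 : Y ≤ 97 * T) :
    (T : ℝ) ^ 2 / 100 ≤ ∑ x ∈ Ico (0 : ℤ) (65 * T : ℕ), ∑ y ∈ Ico (0 : ℤ) (65 * T : ℕ),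
      ∑ z ∈ Ico (0 : ℤ) (65 * T : ℕ), (if x + y + z = Y then
        smoothing B f x * smoothing B g y * smoothing B h z else 0) := by
  set c : ℝ := 5000 / 5001 with hc
  have hc0 : 0 < c := by norm_num [hc]
  have nn : ∀ {f : ℤ → ℝ}, (∀ x, 0 ≤ f x) → ∀ x, 0 ≤ c * smoothing B f x := fun hf x =>
    mul_nonneg hc0.le (smoothing_nonneg hf B x)
  have le1 : ∀ {f ν : ℤ → ℝ}, IsDenseModulo T θ C f ν → ∀ x, c * smoothing B f x ≤ 1 := by
    intro f ν hf x
    have := hf.smoothing_le hT hBne hB hθ x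
    rw [hc]; linarith
  have avg : ∀ {f ν : ℤ → ℝ}, IsDenseModulo T θ C f ν → ∀ a : ℤ, 2 * T ≤ a → a ≤ 62 * T →
      499 / 1000 * T ≤ ∑ t ∈ range T, c * smoothing B f (a + 2 * t) := by
    intro f ν hf a ha ha'
    rw [← mul_sum]
    have h1 := hf.smoothing_avg hBne hB a ha ha'
    have hT0 : (0 : ℝ) ≤ T := by positivity
    rw [hc]; linarith
  have h1 := ternary_sum_ge_of_parity_average (f := fun x => c * smoothing B f x)
    (g := fun x => c * smoothing B g x) (h := fun x => c * smoothing B h x) (T := T) hT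
    (nn hf.nonneg) (le1 hf) (nn hg.nonneg) (le1 hg) (nn hh.nonneg) (le1 hh) (avg hf) (avg hg)
    (avg hh) hY1 hY2
  have h2 := ternary_sum_ge_shifted (smoothing_nonneg hf.nonneg B) (smoothing_nonneg hg.nonneg B)
    (smoothing_nonneg hh.nonneg B) rfl hY1 hY2
  refine le_trans ?_ h2
  refine h1.trans ?_
  refine sum_le_sum fun x _ => sum_le_sum fun y _ => ?_
  have h3 : 0 ≤ smoothing B f y * smoothing B g (x - y) * smoothing B h (Y - x) :=
    mul_nonneg (mul_nonneg (smoothing_nonneg hf.nonneg B _) (smoothing_nonneg hg.nonneg B _))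
      (smoothing_nonneg hh.nonneg B _)
  have h4 : c ^ 3 ≤ 1 := by norm_num [hc]
  calc _ = c ^ 3 * (smoothing B f y * smoothing B g (x - y) * smoothing B h (Y - x)) := by ring
    _ ≤ _ := mul_le_of_le_one_left h3 h4

/-- The transference principle for ternary sums of functions of density close to `1 / 2` with
pseudorandom majorants. -/
theorem exists_add_eq_of_isDenseModulo {C : ℝ} (hC : 1 ≤ C) :
    ∃ θ : ℝ, 0 < θ ∧ θ ≤ 1 ∧ ∀ T : ℕ, 2 ≤ T → ∀ f g h ν₁ ν₂ ν₃ : ℤ → ℝ,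
      IsDenseModulo T θ C f ν₁ → IsDenseModulo T θ C g ν₂ → IsDenseModulo T θ C h ν₃ →
      ∀ Y : ℤ, 95 * T ≤ Y → Y ≤ 97 * T →
      ∃ x y z : ℤ, x + y + z = Y ∧ 0 < f x ∧ 0 < g y ∧ 0 < h z := by
  set s : ℝ := 1 / (10 ^ 9 * C) with hs
  have hs0 : 0 < s := by positivity
  have hs2 : s ≤ 2 := by
    rw [hs, div_le_iff₀ (by positivity)]; nlinarith
  have hsC : C * s = 1 / 10 ^ 9 := by rw [hs]; field_simp
  obtain ⟨K, hK⟩ := exists_nat_gt (10 ^ 12 * C)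
  have hK0 : (0 : ℝ) < K := by nlinarith
  have hKpos : 0 < K := by exact_mod_cast hK0
  obtain ⟨n, hn⟩ := exists_nat_gt (3 * C / s ^ 5)
  refine ⟨1 / (10 ^ 7 * K ^ n), by positivity, ?_, ?_⟩
  · rw [div_le_one (by positivity)]
    have : (1 : ℝ) ≤ K ^ n := by exact_mod_cast Nat.one_le_pow _ _ hKpos
    linarith
  intro T hT f g h ν₁ ν₂ ν₃ hf hg hh Y hY1 hY2
  set θ : ℝ := 1 / (10 ^ 7 * K ^ n) with hθ
  have hθ0 : 0 < θ := by positivity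
  have hθ1 : θ ≤ 1 := by
    rw [hθ, div_le_one (by positivity)]
    have : (1 : ℝ) ≤ K ^ n := by exact_mod_cast Nat.one_le_pow _ _ hKpos
    linarith
  by_contra! hno
  have hTpos : 0 < T := by omega
  have hT0 : (0 : ℝ) < T := by exact_mod_cast hTpos
  set L : ℕ := 64 * T with hL
  set M : ℕ := 256 * T with hM
  have hMpos : 0 < M := by omega
  have hL0 : (0 : ℝ) < L := by exact_mod_cast (by omega : 0 < L)
  let a : (ℤ → ℝ) → ℕ → ℝ := fun f r => ‖ftZ f L (r / M)‖ / L
  have ha0 : ∀ f r, 0 ≤ a f r := fun f r => by positivity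
  set Spec := (range M).filter fun r => s ^ 2 ≤ a f r ∨ s ^ 2 ≤ a g r ∨ s ^ 2 ≤ a h r with hSpec
  have hspec1 : ∀ {f ν : ℤ → ℝ}, IsDenseModulo T θ C f ν →
      (#{r ∈ range M | s ^ 2 ≤ a f r} : ℝ) ≤ C / s ^ 5 := by
    intro f ν hf
    rw [le_div_iff₀ (by positivity)]
    exact hf.level s hs0 hs2
  have hSpecn : #Spec ≤ n := by
    have h1 : #Spec ≤ #{r ∈ range M | s ^ 2 ≤ a f r} + (#{r ∈ range M | s ^ 2 ≤ a g r} +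
        #{r ∈ range M | s ^ 2 ≤ a h r}) := by
      rw [hSpec, filter_or, filter_or]
      exact (card_union_le _ _).trans (Nat.add_le_add_left (card_union_le _ _) _)
    have h2 : (#Spec : ℝ) ≤ 3 * C / s ^ 5 := by
      calc (#Spec : ℝ) ≤ C / s ^ 5 + (C / s ^ 5 + C / s ^ 5) := by
            refine le_trans (Nat.cast_le.2 h1) ?_
            push_cast
            exact add_le_add (hspec1 hf) (add_le_add (hspec1 hg) (hspec1 hh))
        _ = _ := by ring
    exact_mod_cast (h2.trans_lt hn).le
  obtain ⟨B, hBne, hBcard, hBH, hBS⟩ := exists_bohr_set Spec M hKpos (by omega : 0 < T / 2)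
  have hB : ∀ b ∈ B, 0 ≤ b ∧ 2 * b ≤ T := by
    intro b hb
    have := hBH b hb
    omega
  have hB0 : (0 : ℝ) < #B := by exact_mod_cast hBne.card_pos
  have hBcard' : (T : ℝ) ≤ 4 * K ^ n * #B := by
    have h1 : K ^ #Spec * #B ≤ K ^ n * #B :=
      Nat.mul_le_mul_right _ (Nat.pow_le_pow_right hKpos hSpecn)
    have h2 : T ≤ 4 * (K ^ n * #B) := by omega
    have h3 : (T : ℝ) ≤ 4 * (K ^ n * #B) := by exact_mod_cast h2
    linarith
  have hθB : θ * (64 * T : ℕ) / #B ≤ 1 / 5000 := by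
    rw [div_le_iff₀ hB0, hθ]
    push_cast
    rw [div_mul_eq_mul_div, div_le_iff₀ (by positivity)]
    nlinarith
  have hlow := hf.smoothing_ternary hTpos hθ0.le hg hh hBne hB hθB hY1 hY2
  -- Fourier expansions of the two ternary sums
  have hzero : ∑ r ∈ range M, ftZ f L (r / M) * ftZ g L (r / M) * ftZ h L (r / M) *
      ee (-(Y * (r / M))) = 0 := by
    have h1 := ternary_sum_eq_ftZ f g h (N := L) hMpos (Y := Y) (by omega) (by omega)
    have h2 : ∑ x ∈ Ico (0 : ℤ) L, ∑ y ∈ Ico (0 : ℤ) L, ∑ z ∈ Ico (0 : ℤ) L,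
        (if x + y + z = Y then (f x : ℂ) * g y * h z else 0) = 0 := by
      refine sum_eq_zero fun x _ => sum_eq_zero fun y _ => sum_eq_zero fun z _ => ?_
      split_ifs with hxyz
      · have := hno x y z hxyz
        rcases (hf.nonneg x).eq_or_lt with h0 | h0
        · simp [← h0]
        rcases (hg.nonneg y).eq_or_lt with h1 | h1
        · simp [← h1]
        have h2 := le_antisymm (this h0 h1) (hh.nonneg z)
        simp [h2]
      · rfl
    rw [h2, eq_comm, div_eq_zero_iff] at h1
    exact h1.resolve_right (by exact_mod_cast hMpos.ne')
  have hup : (M : ℝ) * (T ^ 2 / 100) ≤ ∑ r ∈ range M,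
      L ^ 3 * (a f r * a g r * a h r) * ‖meanEE B (r / M) ^ 6 - 1‖ := by
    have h1 := ternary_sum_eq_ftZ (smoothing B f) (smoothing B g) (smoothing B h) (N := 65 * T)
      hMpos (Y := Y) (by omega) (by omega)
    rw [eq_div_iff (by exact_mod_cast hMpos.ne')] at h1
    have h2 : ∀ r : ℕ, ftZ (smoothing B f) (65 * T) (r / M) * ftZ (smoothing B g) (65 * T) (r / M) *
        ftZ (smoothing B h) (65 * T) (r / M) * ee (-(Y * (r / M))) =
        ftZ f L (r / M) * ftZ g L (r / M) * ftZ h L (r / M) * ee (-(Y * (r / M))) +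
        ftZ f L (r / M) * ftZ g L (r / M) * ftZ h L (r / M) * ee (-(Y * (r / M))) *
          (meanEE B (r / M) ^ 6 - 1) := by
      intro r
      rw [ftZ_smoothing hf.supp hB (by omega), ftZ_smoothing hg.supp hB (by omega),
        ftZ_smoothing hh.supp hB (by omega)]
      ring
    rw [sum_congr rfl fun r _ => h2 r, sum_add_distrib, hzero, zero_add] at h1
    have h3 : (M : ℝ) * (T ^ 2 / 100) ≤ ‖(∑ x ∈ Ico (0 : ℤ) (65 * T : ℕ),
        ∑ y ∈ Ico (0 : ℤ) (65 * T : ℕ), ∑ z ∈ Ico (0 : ℤ) (65 * T : ℕ), (if x + y + z = Y then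
        (smoothing B f x : ℂ) * smoothing B g y * smoothing B h z else 0)) * (M : ℂ)‖ := by
      rw [norm_mul, Complex.norm_natCast, mul_comm]
      refine mul_le_mul_of_nonneg_right ?_ (by positivity)
      refine (hlow.trans (le_abs_self _)).trans_eq ?_
      rw [← Real.norm_eq_abs, ← Complex.norm_real]
      push_cast
      congr 1
      refine sum_congr rfl fun x _ => sum_congr rfl fun y _ => sum_congr rfl fun z _ => ?_
      split_ifs <;> simp
    rw [h1] at h3
    refine h3.trans ((norm_sum_le _ _).trans_eq (sum_congr rfl fun r _ => ?_))
    simp only [norm_mul, norm_ee, mul_one, a]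
    field_simp
  -- bounding the contribution of all frequencies
  have hcube : ∀ {f ν : ℤ → ℝ}, IsDenseModulo T θ C f ν →
      ∑ r ∈ range M, a f r ^ 3 ≤ 128 * C := by
    intro f ν hf
    have h1 := sum_cube_le_of_level_sets (R := range M) (ha0 f) hf.level (by norm_num) le_rfl
    have h2 : (range M).filter (fun r => a f r < 2 ^ 2) = range M :=
      filter_true_of_mem fun r _ => norm_ftZ_div_lt hTpos hθ1 hf _
    rw [h2] at h1
    linarith
  have htail : ∀ {f ν : ℤ → ℝ}, IsDenseModulo T θ C f ν → ∀ R ⊆ range M, (∀ r ∈ R, a f r < s ^ 2) →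
      ∑ r ∈ R, a f r ^ 3 ≤ 64 * C * s := by
    intro f ν hf R hR hRs
    refine le_trans ?_ (sum_cube_le_of_level_sets (R := range M) (ha0 f) hf.level hs0 hs2)
    refine sum_le_sum_of_subset_of_nonneg ?_ fun r _ _ => pow_nonneg (ha0 f r) 3
    exact fun r hr => mem_filter.2 ⟨hR hr, hRs r hr⟩
  have hpi : Real.pi ≤ 4 := Real.pi_le_four
  have hmain : ∑ r ∈ range M, (a f r * a g r * a h r) * ‖meanEE B (r / M) ^ 6 - 1‖ ≤
      48 / K * (384 * C) + 2 * (192 * C * s) := by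
    rw [← sum_filter_add_sum_filter_not (range M)
      fun r => s ^ 2 ≤ a f r ∨ s ^ 2 ≤ a g r ∨ s ^ 2 ≤ a h r]
    refine add_le_add ?_ ?_
    · calc _ ≤ ∑ r ∈ Spec, 48 / K * (a f r ^ 3 + a g r ^ 3 + a h r ^ 3) := by
            refine sum_le_sum fun r hr => ?_
            rw [mul_comm]
            refine mul_le_mul ?_ (mul_mul_le_sum_cubes (ha0 _ _) (ha0 _ _) (ha0 _ _))
              (mul_nonneg (mul_nonneg (ha0 _ _) (ha0 _ _)) (ha0 _ _)) (by positivity)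
            have h1 := norm_pow_six_sub_one_le (norm_meanEE_le B (r / M))
            have h2 := norm_meanEE_sub_one_le hBne (α := r / M) fun b hb => hBS b hb r hr
            calc _ ≤ 6 * (2 * Real.pi / K) := by linarith
              _ = 12 * Real.pi / K := by ring
              _ ≤ _ := by gcongr; linarith
        _ ≤ ∑ r ∈ range M, 48 / K * (a f r ^ 3 + a g r ^ 3 + a h r ^ 3) := by
            refine sum_le_sum_of_subset_of_nonneg (filter_subset _ _) fun r _ _ => ?_
            have := pow_nonneg (ha0 f r) 3
            have := pow_nonneg (ha0 g r) 3
            have := pow_nonneg (ha0 h r) 3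
            positivity
        _ ≤ _ := by
            rw [← mul_sum, sum_add_distrib, sum_add_distrib]
            gcongr
            linarith [hcube hf, hcube hg, hcube hh]
    · set R := (range M).filter fun r => ¬ (s ^ 2 ≤ a f r ∨ s ^ 2 ≤ a g r ∨ s ^ 2 ≤ a h r) with hR
      have hRs : ∀ r ∈ R, a f r < s ^ 2 ∧ a g r < s ^ 2 ∧ a h r < s ^ 2 := by
        intro r hr
        have := (mem_filter.1 hr).2
        push Not at this
        exact this
      calc _ ≤ ∑ r ∈ R, 2 * (a f r ^ 3 + a g r ^ 3 + a h r ^ 3) := by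
            refine sum_le_sum fun r hr => ?_
            rw [mul_comm]
            refine mul_le_mul ?_ (mul_mul_le_sum_cubes (ha0 _ _) (ha0 _ _) (ha0 _ _))
              (mul_nonneg (mul_nonneg (ha0 _ _) (ha0 _ _)) (ha0 _ _)) (by positivity)
            refine (norm_sub_le _ _).trans ?_
            rw [norm_pow, norm_one]
            linarith [pow_le_one₀ (n := 6) (norm_nonneg _) (norm_meanEE_le B (r / M))]
        _ ≤ _ := by
            rw [← mul_sum, sum_add_distrib, sum_add_distrib]
            linarith [htail hf R (filter_subset _ _) fun r hr => (hRs r hr).1,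
              htail hg R (filter_subset _ _) fun r hr => (hRs r hr).2.1,
              htail hh R (filter_subset _ _) fun r hr => (hRs r hr).2.2]
  have h1 : 48 / K * (384 * C) ≤ 1 / 10 ^ 7 := by
    rw [div_mul_eq_mul_div, div_le_iff₀ hK0]; linarith
  simp_rw [mul_assoc ((L : ℝ) ^ 3)] at hup
  rw [← mul_sum] at hup
  have h2 := mul_le_mul_of_nonneg_left hmain (by positivity : 0 ≤ (L : ℝ) ^ 3)
  have h3 : 48 / K * (384 * C) + 2 * (192 * C * s) ≤ 1 / 10 ^ 6 := by
    have : 2 * (192 * C * s) = 384 * (C * s) := by ring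
    rw [this, hsC]; linarith
  have h4 := mul_le_mul_of_nonneg_left h3 (by positivity : 0 ≤ (L : ℝ) ^ 3)
  have h5 : (L : ℝ) = 64 * T := by rw [hL]; push_cast; ring
  have h6 : (M : ℝ) = 256 * T := by rw [hM]; push_cast; ring
  generalize ∑ r ∈ range M, a f r * a g r * a h r * ‖meanEE B (r / M) ^ 6 - 1‖ = Q at hup h2
  rw [h6] at hup
  rw [h5] at hup h2 h4
  have h7 : (0 : ℝ) < T ^ 3 := by positivity
  nlinarith

end

section

open MeasureTheory intervalIntegral

/-- The Fejér kernel `2 (1 - cos (T v)) / (T v ^ 2)`, in integral form. -/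
noncomputable def fejer (T v : ℝ) : ℝ := ∫ t in (0 : ℝ)..T, 2 * (1 - t / T) * Real.cos (t * v)

lemma fejer_eq {T v : ℝ} (hT : 0 < T) (hv : v ≠ 0) :
    fejer T v = 2 * (1 - Real.cos (T * v)) / (T * v ^ 2) := by
  have h : ∀ t ∈ Set.uIcc 0 T, HasDerivAt
      (fun t => 2 * (1 - t / T) * (Real.sin (t * v) / v) - 2 / T * (Real.cos (t * v) / v ^ 2))
      (2 * (1 - t / T) * Real.cos (t * v)) t := by
    intro t _
    have h1 : HasDerivAt (fun t : ℝ => t * v) v t := by simpa using (hasDerivAt_id t).mul_const v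
    have h2 := ((Real.hasDerivAt_sin (t * v)).comp t h1).div_const v
    have h3 := ((Real.hasDerivAt_cos (t * v)).comp t h1).div_const (v ^ 2)
    have h4 : HasDerivAt (fun t : ℝ => 2 * (1 - t / T)) (2 * (-(1 / T))) t :=
      (((hasDerivAt_id t).div_const T).const_sub 1).const_mul 2
    refine ((h4.mul h2).sub (h3.const_mul (2 / T))).congr_deriv ?_
    simp only [Function.comp]
    field_simp
    ring
  rw [fejer, integral_eq_sub_of_hasDerivAt h (Continuous.intervalIntegrable (by fun_prop) _ _)]
  have : T / T = 1 := div_self hT.ne'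
  simp [this]
  field_simp
  ring

lemma fejer_zero {T : ℝ} (hT : 0 < T) : fejer T 0 = T := by
  have h : ∀ t ∈ Set.uIcc 0 T, HasDerivAt (fun t => 2 * t - t ^ 2 / T)
      (2 * (1 - t / T) * Real.cos (t * 0)) t := by
    intro t _
    refine (((hasDerivAt_id t).const_mul 2).sub ((hasDerivAt_pow 2 t).div_const T)).congr_deriv ?_
    simp
    ring
  rw [fejer, integral_eq_sub_of_hasDerivAt h (Continuous.intervalIntegrable (by fun_prop) _ _)]
  field_simp
  ring

lemma fejer_nonneg {T : ℝ} (hT : 0 < T) (v : ℝ) : 0 ≤ fejer T v := by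
  rcases eq_or_ne v 0 with rfl | hv
  · rw [fejer_zero hT]; exact hT.le
  · rw [fejer_eq hT hv]
    have := Real.cos_le_one (T * v)
    exact div_nonneg (by linarith) (by positivity)

lemma fejer_le {T v : ℝ} (hT : 0 < T) (hv : v ≠ 0) : fejer T v ≤ 4 / (T * v ^ 2) := by
  rw [fejer_eq hT hv]
  have := Real.neg_one_le_cos (T * v)
  gcongr
  linarith

lemma fejer_le_self {T : ℝ} (hT : 0 < T) (v : ℝ) : fejer T v ≤ T := by
  refine le_of_le_of_eq ?_ (fejer_zero hT)
  refine integral_mono_on hT.le (Continuous.intervalIntegrable (by fun_prop) _ _)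
    (Continuous.intervalIntegrable (by fun_prop) _ _) fun t ht => ?_
  have h1 : t / T ≤ 1 := div_le_one_of_le₀ ht.2 hT.le
  have h2 := Real.cos_le_one (t * v)
  rw [mul_zero, Real.cos_zero]
  exact mul_le_mul_of_nonneg_left h2 (by linarith)

lemma fejer_scale {T : ℝ} (hT : 0 < T) (v : ℝ) : fejer T v = T * fejer 1 (T * v) := by
  rcases eq_or_ne v 0 with rfl | hv
  · rw [fejer_zero hT, mul_zero, fejer_zero one_pos, mul_one]
  · rw [fejer_eq hT hv, fejer_eq one_pos (mul_ne_zero hT.ne' hv), one_mul, one_mul]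
    field_simp

lemma continuous_fejer (T : ℝ) : Continuous (fejer T) := by
  unfold fejer
  exact continuous_parametric_intervalIntegral_of_continuous' (by fun_prop) _ _

lemma integrable_fejer {T : ℝ} (hT : 0 < T) : Integrable (fejer T) := by
  have h1 : Integrable (fejer 1) := by
    refine (integrable_inv_one_add_sq.const_mul 5).mono' (continuous_fejer 1).aestronglyMeasurable
      (.of_forall fun v => ?_)
    rw [Real.norm_eq_abs, abs_of_nonneg (fejer_nonneg one_pos v), ← div_eq_mul_inv,
      le_div_iff₀ (by positivity)]
    have h2 := fejer_le_self one_pos v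
    have h3 : fejer 1 v * v ^ 2 ≤ 4 := by
      rcases eq_or_ne v 0 with rfl | hv
      · norm_num
      · have := fejer_le one_pos hv
        rwa [one_mul, le_div_iff₀ (by positivity)] at this
    linarith
  have : fejer T = fun v => T * fejer 1 (T * v) := funext fun v => fejer_scale hT v
  rw [this]
  exact (h1.comp_mul_left' hT.ne').const_mul T

lemma integral_fejer {T : ℝ} (hT : 0 < T) : ∫ v, fejer T v = ∫ v, fejer 1 v := by
  have : fejer T = fun v => T * fejer 1 (T * v) := funext fun v => fejer_scale hT v
  rw [this, MeasureTheory.integral_const_mul, Measure.integral_comp_mul_left (fejer 1) T, abs_of_pos (by positivity),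
    smul_eq_mul, ← mul_assoc, mul_inv_cancel₀ hT.ne', one_mul]

lemma integral_fejer_pos : 0 < ∫ v, fejer 1 v := by
  refine integral_pos_of_integrable_nonneg_nonzero (continuous_fejer 1) (integrable_fejer one_pos)
    (fejer_nonneg one_pos) (x := 0) ?_
  rw [fejer_zero one_pos]; norm_num

lemma fejer_eq_integral_exp {T : ℝ} (hT : 0 < T) (v : ℝ) :
    (fejer T v : ℂ) = ∫ t in (-T)..T, ((1 - |t| / T : ℝ) : ℂ) * Complex.exp (Complex.I * (t * v)) := by
  have hi : ∀ a b, IntervalIntegrable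
      (fun t : ℝ => ((1 - |t| / T : ℝ) : ℂ) * Complex.exp (Complex.I * (t * v))) volume a b := fun a b =>
    Continuous.intervalIntegrable (by fun_prop) _ _
  rw [← integral_add_adjacent_intervals (hi (-T) 0) (hi 0 T)]
  have h1 := integral_comp_neg (a := 0) (b := T)
    (fun t : ℝ => ((1 - |t| / T : ℝ) : ℂ) * Complex.exp (Complex.I * (t * v)))
  rw [neg_zero] at h1
  rw [← h1, ← intervalIntegral.integral_add, fejer, ← intervalIntegral.integral_ofReal]
  · refine integral_congr fun t ht => ?_
    rw [Set.uIcc_of_le hT.le] at ht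
    simp only [abs_neg, abs_of_nonneg ht.1]
    push_cast
    rw [← mul_add, Complex.cos]
    have e1 : Complex.I * (-(t : ℂ) * v) = -(t * v) * Complex.I := by ring
    have e2 : Complex.I * ((t : ℂ) * v) = t * v * Complex.I := by ring
    rw [e1, e2]
    ring
  · exact Continuous.intervalIntegrable (by fun_prop) _ _
  · exact hi _ _

end

section

open MeasureTheory intervalIntegral Filter Topology

lemma hasSum_mul_fejer {a : ℕ → ℝ} (h0 : a 0 = 0) {σ : ℝ}
    (hs : LSeriesSummable (fun n => (a n : ℂ)) σ) {T : ℝ} (hT : 0 < T) (y : ℝ) :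
    HasSum (fun n : ℕ => ((a n * (n : ℝ) ^ (-σ) * fejer T (y - Real.log n) : ℝ) : ℂ))
      (∫ t in (-T)..T, ((1 - |t| / T : ℝ) : ℂ) * Complex.exp (Complex.I * (t * y)) *
        LSeries (fun n => (a n : ℂ)) (σ + Complex.I * t)) := by
  set f : ℕ → ℂ := fun n => (a n : ℂ) with hf
  have hcont : ∀ n, Continuous fun t : ℝ => LSeries.term f (σ + Complex.I * t) n := by
    intro n
    rcases eq_or_ne n 0 with rfl | hn
    · simpa using continuous_const
    · simp only [LSeries.term_of_ne_zero hn]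
      refine continuous_const.div ?_ fun t => ?_
      · exact Continuous.const_cpow (by fun_prop) (Or.inl (by exact_mod_cast hn))
      · simp [Complex.cpow_eq_zero_iff, hn]
  have hnorm : ∀ n (t : ℝ), ‖LSeries.term f (σ + Complex.I * t) n‖ = ‖LSeries.term f σ n‖ := by
    intro n t
    simp [LSeries.norm_term_eq]
  have hw : ∀ t ∈ Set.uIoc (-T) T, ‖((1 - |t| / T : ℝ) : ℂ) * Complex.exp (Complex.I * (t * y))‖ ≤ 1 := by
    intro t ht
    rw [Set.uIoc_of_le (by linarith)] at ht
    have : Complex.I * (t * y) = ((t * y : ℝ) : ℂ) * Complex.I := by push_cast; ring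
    rw [norm_mul, this, Complex.norm_exp_ofReal_mul_I, mul_one, Complex.norm_real, Real.norm_eq_abs]
    have h1 : |t| / T ≤ 1 := div_le_one_of_le₀ (abs_le.2 ⟨ht.1.le, ht.2⟩) hT.le
    have h2 : 0 ≤ |t| / T := by positivity
    rw [abs_le]; constructor <;> linarith
  have key := hasSum_integral_of_dominated_convergence (μ := volume) (a := -T) (b := T)
    (F := fun n t => ((1 - |t| / T : ℝ) : ℂ) * Complex.exp (Complex.I * (t * y)) *
      LSeries.term f (σ + Complex.I * t) n)
    (f := fun t : ℝ => ((1 - |t| / T : ℝ) : ℂ) * Complex.exp (Complex.I * (t * y)) *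
      LSeries f (σ + Complex.I * t))
    (fun n _ => ‖LSeries.term f σ n‖)
    (fun n => (Continuous.mul (by fun_prop) (hcont n)).aestronglyMeasurable)
    (fun n => .of_forall fun t ht => by
      rw [norm_mul, hnorm]
      exact mul_le_of_le_one_left (norm_nonneg _) (hw t ht))
    (.of_forall fun t _ => hs.norm)
    intervalIntegrable_const
    (.of_forall fun t _ => by
      refine HasSum.mul_left _ (Summable.hasSum ?_)
      exact Summable.of_norm (by simpa only [hnorm] using hs.norm))
  refine key.congr_fun ?_
  intro n
  rcases eq_or_ne n 0 with rfl | hn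
  · simp [h0]
  have hn' : (n : ℂ) ≠ 0 := by exact_mod_cast hn
  rw [Complex.ofReal_mul, fejer_eq_integral_exp hT, ← intervalIntegral.integral_const_mul]
  refine integral_congr fun t _ => ?_
  simp only [LSeries.term_of_ne_zero hn]
  have e1 : Complex.exp (Complex.I * (t * (y - Real.log n : ℝ))) =
      Complex.exp (Complex.I * (t * y)) * Complex.exp (-(Complex.I * t * Complex.log n)) := by
    rw [← Complex.exp_add, ← Complex.natCast_log]; push_cast; ring_nf
  rw [e1, Complex.cpow_def_of_ne_zero hn', mul_add, Complex.exp_add, Complex.ofReal_mul,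
    Complex.ofReal_cpow (Nat.cast_nonneg n), Complex.ofReal_natCast, Complex.cpow_def_of_ne_zero hn',
    div_mul_eq_div_div, div_eq_mul_inv (_ / _), div_eq_mul_inv (f n), ← Complex.exp_neg,
    ← Complex.exp_neg]
  simp only [hf]
  push_cast
  ring_nf

end

section

open MeasureTheory intervalIntegral Filter Topology

lemma integral_fejer_pole {T δ : ℝ} (hT : 0 < T) (hδ : 0 < δ) (y : ℝ) :
    ∫ t in (-T)..T, ((1 - |t| / T : ℝ) : ℂ) * Complex.exp (Complex.I * (t * y)) *
      (1 / (δ + Complex.I * t)) =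
    ((∫ u in Set.Ioi (0 : ℝ), Real.exp (-δ * u) * fejer T (y - u) : ℝ) : ℂ) := by
  have hlap : ∀ t : ℝ, (1 / (δ + Complex.I * t) : ℂ) =
      ∫ u in Set.Ioi (0 : ℝ), Complex.exp (-(δ + Complex.I * t) * u) := by
    intro t
    rw [integral_exp_mul_complex_Ioi (by simpa using hδ)]
    simp only [Complex.ofReal_zero, mul_zero, Complex.exp_zero]
    rw [neg_div_neg_eq]
  have hInt : Integrable (Function.uncurry fun (t u : ℝ) => ((1 - |t| / T : ℝ) : ℂ) *
      Complex.exp (Complex.I * (t * y)) * Complex.exp (-(δ + Complex.I * t) * u))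
      ((volume.restrict (Set.uIoc (-T) T)).prod (volume.restrict (Set.Ioi (0 : ℝ)))) := by
    have h1 : Integrable (fun t : ℝ => |1 - |t| / T|) (volume.restrict (Set.uIoc (-T) T)) := by
      have : IntervalIntegrable (fun t : ℝ => |1 - |t| / T|) volume (-T) T :=
        Continuous.intervalIntegrable (by fun_prop) _ _
      exact intervalIntegrable_iff.1 this
    have h2 : Integrable (fun u : ℝ => Real.exp (-δ * u)) (volume.restrict (Set.Ioi (0 : ℝ))) :=
      integrableOn_exp_mul_Ioi (by linarith) 0
    refine (h1.mul_prod h2).mono' (Continuous.aestronglyMeasurable (by fun_prop)) (.of_forall ?_)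
    rintro ⟨t, u⟩
    have e1 : Complex.I * (t * y) = ((t * y : ℝ) : ℂ) * Complex.I := by push_cast; ring
    simp only [Function.uncurry]
    rw [norm_mul, norm_mul, e1, Complex.norm_exp_ofReal_mul_I, mul_one, Complex.norm_real,
      Real.norm_eq_abs, Complex.norm_exp]
    simp
  calc _ = ∫ t in (-T)..T, ∫ u in Set.Ioi (0 : ℝ), ((1 - |t| / T : ℝ) : ℂ) *
      Complex.exp (Complex.I * (t * y)) * Complex.exp (-(δ + Complex.I * t) * u) := by
        refine integral_congr fun t _ => ?_
        simp only [hlap]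
        rw [MeasureTheory.integral_const_mul]
    _ = ∫ u in Set.Ioi (0 : ℝ), ((Real.exp (-δ * u) * fejer T (y - u) : ℝ) : ℂ) := by
        rw [intervalIntegral_integral_swap hInt]
        refine integral_congr_ae (.of_forall fun u => ?_)
        simp only
        rw [Complex.ofReal_mul, fejer_eq_integral_exp hT, ← intervalIntegral.integral_const_mul]
        refine integral_congr fun t _ => ?_
        rw [mul_assoc, ← Complex.exp_add, Complex.ofReal_exp,
          mul_left_comm (Complex.exp ((-δ * u : ℝ) : ℂ)), ← Complex.exp_add]
        push_cast
        ring_nf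
    _ = _ := integral_ofReal

lemma integral_exp_mul_fejer_ge {T δ : ℝ} (hT : 0 < T) (hδ : 0 < δ) {y : ℝ} (hy : 0 < y) :
    Real.exp (-δ * (2 * y)) * ∫ v in (-y)..y, fejer T v ≤
      ∫ u in Set.Ioi (0 : ℝ), Real.exp (-δ * u) * fejer T (y - u) := by
  have hi : IntegrableOn (fun u => Real.exp (-δ * u) * fejer T (y - u)) (Set.Ioi (0 : ℝ)) := by
    refine Integrable.mono' ((integrableOn_exp_mul_Ioi (a := -δ) (by linarith) 0).mul_const T)
      (Continuous.aestronglyMeasurable ?_) (.of_forall fun u => ?_)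
    · have := continuous_fejer T
      fun_prop
    · rw [norm_mul, Real.norm_eq_abs, Real.norm_eq_abs, abs_of_pos (Real.exp_pos _),
        abs_of_nonneg (fejer_nonneg hT _)]
      exact mul_le_mul_of_nonneg_left (fejer_le_self hT _) (Real.exp_pos _).le
  calc Real.exp (-δ * (2 * y)) * ∫ v in (-y)..y, fejer T v
      = ∫ u in (0 : ℝ)..(2 * y), Real.exp (-δ * (2 * y)) * fejer T (y - u) := by
        rw [intervalIntegral.integral_const_mul, intervalIntegral.integral_comp_sub_left (fejer T) y]
        congr 2 <;> ring
    _ ≤ ∫ u in (0 : ℝ)..(2 * y), Real.exp (-δ * u) * fejer T (y - u) := by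
        have hc := continuous_fejer T
        refine integral_mono_on (by linarith) (Continuous.intervalIntegrable (by fun_prop) _ _)
          (Continuous.intervalIntegrable (by fun_prop) _ _) fun u hu => ?_
        refine mul_le_mul_of_nonneg_right (Real.exp_le_exp.2 ?_) (fejer_nonneg hT _)
        nlinarith [hu.2]
    _ ≤ _ := by
        rw [intervalIntegral.integral_of_le (by linarith)]
        refine setIntegral_mono_set hi (.of_forall fun u => ?_)
          (LE.le.eventuallyLE Set.Ioc_subset_Ioi_self)
        exact mul_nonneg (Real.exp_pos _).le (fejer_nonneg hT _)

section
variable {a : ℕ → ℝ} {c : ℝ} {G : ℂ → ℂ}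

lemma fejer_sum_ge (ha : ∀ n, 0 ≤ a n) (h0 : a 0 = 0) (hc : 0 ≤ c) {σ : ℝ} (hσ : 1 < σ)
    (hs : LSeriesSummable (fun n => (a n : ℂ)) σ) (hG : ContinuousOn G {s | 1 ≤ s.re})
    (hL : ∀ s : ℂ, 1 < s.re → LSeries (fun n => (a n : ℂ)) s = G s + c / (s - 1))
    {T : ℝ} (hT : 0 < T) {y : ℝ} (hy : 0 < y) {F : Finset ℕ} {D : ℝ}
    (hD : ∀ E : Finset ℕ, Disjoint E F → ∑ n ∈ E, a n / n * fejer T (y - Real.log n) ≤ D) :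
    (∫ t in (-T)..T, ((1 - |t| / T : ℝ) : ℂ) * Complex.exp (Complex.I * (t * y)) *
        G (σ + Complex.I * t)).re +
      c * (Real.exp (-(σ - 1) * (2 * y)) * ∫ v in (-y)..y, fejer T v) ≤
    ∑ n ∈ F, a n / n * fejer T (y - Real.log n) + D := by
  have hle : ∀ n, a n * (n : ℝ) ^ (-σ) * fejer T (y - Real.log n) ≤
      a n / n * fejer T (y - Real.log n) := by
    intro n
    refine mul_le_mul_of_nonneg_right ?_ (fejer_nonneg hT _)
    rcases eq_or_ne n 0 with rfl | hn
    · simp [h0]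
    · rw [div_eq_mul_inv, ← Real.rpow_neg_one]
      refine mul_le_mul_of_nonneg_left (Real.rpow_le_rpow_of_exponent_le ?_ (by linarith)) (ha n)
      exact_mod_cast Nat.one_le_iff_ne_zero.2 hn
  have hnn : ∀ n, 0 ≤ a n * (n : ℝ) ^ (-σ) * fejer T (y - Real.log n) := fun n =>
    mul_nonneg (mul_nonneg (ha n) (by positivity)) (fejer_nonneg hT _)
  have hsum := hasSum_mul_fejer h0 hs hT y
  obtain ⟨r, hr, hr'⟩ : ∃ r : ℝ, HasSum (fun n : ℕ => a n * (n : ℝ) ^ (-σ) * fejer T (y - Real.log n)) r ∧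
      (r : ℂ) = ∫ t in (-T)..T, ((1 - |t| / T : ℝ) : ℂ) * Complex.exp (Complex.I * (t * y)) *
        LSeries (fun n => (a n : ℂ)) (σ + Complex.I * t) := by
    have h1 := (Complex.summable_ofReal.1 hsum.summable).hasSum
    exact ⟨_, h1, (Complex.hasSum_ofReal.2 h1).unique hsum⟩
  have hub : r ≤ ∑ n ∈ F, a n / n * fejer T (y - Real.log n) + D := by
    rw [← hr.tsum_eq]
    refine hr.summable.tsum_le_of_sum_le fun E => ?_
    calc ∑ n ∈ E, a n * (n : ℝ) ^ (-σ) * fejer T (y - Real.log n)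
        ≤ ∑ n ∈ F ∪ (E \ F), a n * (n : ℝ) ^ (-σ) * fejer T (y - Real.log n) := by
          refine Finset.sum_le_sum_of_subset_of_nonneg ?_ fun n _ _ => hnn n
          intro n hn
          by_cases h : n ∈ F <;> simp [h, hn]
      _ = ∑ n ∈ F, _ + ∑ n ∈ E \ F, _ := Finset.sum_union Finset.disjoint_sdiff
      _ ≤ _ := add_le_add (Finset.sum_le_sum fun n _ => hle n)
          ((Finset.sum_le_sum fun n _ => hle n).trans (hD _ Finset.sdiff_disjoint))
  refine le_trans ?_ hub
  have hGi : IntervalIntegrable (fun t : ℝ => ((1 - |t| / T : ℝ) : ℂ) *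
      Complex.exp (Complex.I * (t * y)) * G (σ + Complex.I * t)) volume (-T) T := by
    refine Continuous.intervalIntegrable (Continuous.mul (by fun_prop) ?_) _ _
    refine hG.comp_continuous (by fun_prop) fun t => ?_
    simp [hσ.le]
  have hPi : IntervalIntegrable (fun t : ℝ => ((1 - |t| / T : ℝ) : ℂ) *
      Complex.exp (Complex.I * (t * y)) * (1 / (((σ - 1 : ℝ) : ℂ) + Complex.I * t))) volume (-T) T := by
    refine Continuous.intervalIntegrable (Continuous.mul (by fun_prop) ?_) _ _
    refine continuous_const.div (by fun_prop) fun t h => ?_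
    have := congrArg Complex.re h
    simp at this
    linarith
  have hdec : (r : ℂ) = (∫ t in (-T)..T, ((1 - |t| / T : ℝ) : ℂ) *
      Complex.exp (Complex.I * (t * y)) * G (σ + Complex.I * t)) +
      c * ((∫ u in Set.Ioi (0 : ℝ), Real.exp (-(σ - 1) * u) * fejer T (y - u) : ℝ) : ℂ) := by
    rw [← integral_fejer_pole hT (by linarith : 0 < σ - 1), hr',
      ← intervalIntegral.integral_const_mul, ← intervalIntegral.integral_add hGi (hPi.const_mul _)]
    refine integral_congr fun t _ => ?_
    rw [hL _ (by simp [hσ])]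
    have : (σ : ℂ) + Complex.I * t - 1 = ((σ - 1 : ℝ) : ℂ) + Complex.I * t := by push_cast; ring
    rw [this]
    ring
  have hre := congrArg Complex.re hdec
  rw [Complex.add_re, Complex.ofReal_re, ← Complex.ofReal_mul, Complex.ofReal_re] at hre
  rw [hre]
  gcongr
  exact integral_exp_mul_fejer_ge hT (by linarith) hy

lemma fejer_sum_ge_one (ha : ∀ n, 0 ≤ a n) (h0 : a 0 = 0) (hc : 0 ≤ c)
    (hs : ∀ σ : ℝ, 1 < σ → LSeriesSummable (fun n => (a n : ℂ)) σ)
    (hG : ContinuousOn G {s | 1 ≤ s.re})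
    (hL : ∀ s : ℂ, 1 < s.re → LSeries (fun n => (a n : ℂ)) s = G s + c / (s - 1))
    {T : ℝ} (hT : 0 < T) {y : ℝ} (hy : 0 < y) {F : Finset ℕ} {D : ℝ}
    (hD : ∀ E : Finset ℕ, Disjoint E F → ∑ n ∈ E, a n / n * fejer T (y - Real.log n) ≤ D) :
    (∫ t in (-T)..T, ((1 - |t| / T : ℝ) : ℂ) * Complex.exp (Complex.I * (t * y)) *
        G (1 + Complex.I * t)).re + c * ∫ v in (-y)..y, fejer T v ≤
    ∑ n ∈ F, a n / n * fejer T (y - Real.log n) + D := by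
  -- a compact box on which `G` is bounded
  have hK : IsCompact ((fun p : ℝ × ℝ => (p.1 : ℂ) + Complex.I * p.2) ''
      (Set.Icc 1 2 ×ˢ Set.Icc (-T) T)) :=
    (isCompact_Icc.prod isCompact_Icc).image (by fun_prop)
  have hKs : (fun p : ℝ × ℝ => (p.1 : ℂ) + Complex.I * p.2) '' (Set.Icc 1 2 ×ˢ Set.Icc (-T) T) ⊆
      {s | 1 ≤ s.re} := by
    rintro _ ⟨p, hp, rfl⟩
    simpa using hp.1.1
  obtain ⟨B, hB⟩ := hK.exists_bound_of_continuousOn (hG.mono hKs)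
  have hlim : Tendsto (fun σ : ℝ => (∫ t in (-T)..T, ((1 - |t| / T : ℝ) : ℂ) *
      Complex.exp (Complex.I * (t * y)) * G (σ + Complex.I * t)).re +
      c * (Real.exp (-(σ - 1) * (2 * y)) * ∫ v in (-y)..y, fejer T v)) (𝓝[>] 1)
      (𝓝 ((∫ t in (-T)..T, ((1 - |t| / T : ℝ) : ℂ) * Complex.exp (Complex.I * (t * y)) *
        G (1 + Complex.I * t)).re + c * ∫ v in (-y)..y, fejer T v)) := by
    refine Tendsto.add ?_ (Tendsto.const_mul c ?_)
    · refine (Complex.continuous_re.tendsto _).comp ?_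
      refine intervalIntegral.tendsto_integral_filter_of_dominated_convergence
        (fun t => |1 - |t| / T| * B) ?_ ?_ ?_ ?_
      · filter_upwards [self_mem_nhdsWithin] with σ hσ
        refine Continuous.aestronglyMeasurable (Continuous.mul (by fun_prop) ?_)
        refine hG.comp_continuous (by fun_prop) fun t => ?_
        simpa using le_of_lt hσ
      · filter_upwards [Ioc_mem_nhdsGT (show (1 : ℝ) < 2 by norm_num)] with σ hσ
        refine .of_forall fun t ht => ?_
        rw [Set.uIoc_of_le (by linarith)] at ht
        have e1 : Complex.I * (t * y) = ((t * y : ℝ) : ℂ) * Complex.I := by push_cast; ring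
        rw [norm_mul, norm_mul, e1, Complex.norm_exp_ofReal_mul_I, mul_one, Complex.norm_real,
          Real.norm_eq_abs]
        refine mul_le_mul_of_nonneg_left (hB _ ⟨(σ, t), ⟨⟨hσ.1.le, hσ.2⟩, ht.1.le, ht.2⟩, rfl⟩)
          (abs_nonneg _)
      · exact Continuous.intervalIntegrable (by fun_prop) _ _
      · refine .of_forall fun t _ => Tendsto.const_mul _ ?_
        have h1 : Tendsto G (𝓝[{s | 1 ≤ s.re}] (1 + Complex.I * t)) (𝓝 (G (1 + Complex.I * t))) :=
          hG _ (by simp)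
        refine h1.comp (tendsto_nhdsWithin_iff.2 ⟨?_, ?_⟩)
        · refine Tendsto.mono_left ?_ nhdsWithin_le_nhds
          have : Continuous fun σ : ℝ => (σ : ℂ) + Complex.I * t := by fun_prop
          simpa using this.tendsto 1
        · filter_upwards [self_mem_nhdsWithin] with σ hσ
          simpa using le_of_lt hσ
    · refine Tendsto.mono_left ?_ nhdsWithin_le_nhds
      have : Continuous fun σ : ℝ => Real.exp (-(σ - 1) * (2 * y)) * ∫ v in (-y)..y, fejer T v := by
        fun_prop
      simpa using this.tendsto 1
  refine le_of_tendsto hlim ?_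
  filter_upwards [self_mem_nhdsWithin] with σ hσ
  exact fejer_sum_ge ha h0 hc hσ (hs σ hσ) hG hL hT hy hD

lemma fejer_sum_eventually_ge (ha : ∀ n, 0 ≤ a n) (h0 : a 0 = 0) (hc : 0 ≤ c)
    (hs : ∀ σ : ℝ, 1 < σ → LSeriesSummable (fun n => (a n : ℂ)) σ)
    (hG : ContinuousOn G {s | 1 ≤ s.re})
    (hL : ∀ s : ℂ, 1 < s.re → LSeries (fun n => (a n : ℂ)) s = G s + c / (s - 1))
    {T : ℝ} (hT : 0 < T) {η : ℝ} (hη : 0 < η) :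
    ∃ y₀ : ℝ, ∀ y ≥ y₀, ∀ (F : Finset ℕ) (D : ℝ),
      (∀ E : Finset ℕ, Disjoint E F → ∑ n ∈ E, a n / n * fejer T (y - Real.log n) ≤ D) →
      c * (∫ v, fejer 1 v) - D - η ≤ ∑ n ∈ F, a n / n * fejer T (y - Real.log n) := by
  have h1 : Tendsto (fun y : ℝ => ∫ v in (-y)..y, fejer T v) atTop (𝓝 (∫ v, fejer T v)) :=
    intervalIntegral_tendsto_integral (integrable_fejer hT) tendsto_neg_atTop_atBot tendsto_id
  have h2 : Tendsto (fun y : ℝ => (∫ t in (-T)..T, ((1 - |t| / T : ℝ) : ℂ) *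
      Complex.exp (Complex.I * (t * y)) * G (1 + Complex.I * t)).re) atTop (𝓝 0) := by
    have h3 := Real.tendsto_integral_exp_smul_cocompact ((Set.Ioc (-T) T).indicator
      fun t : ℝ => ((1 - |t| / T : ℝ) : ℂ) * G (1 + Complex.I * t))
    have h4 : Tendsto (fun y : ℝ => -(y / (2 * Real.pi))) atTop (cocompact ℝ) := by
      refine Tendsto.mono_right (tendsto_neg_atTop_atBot.comp
        (tendsto_id.atTop_div_const (by positivity))) atBot_le_cocompact
    have h5 := (Complex.continuous_re.tendsto _).comp (h3.comp h4)
    rw [Complex.zero_re] at h5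
    refine h5.congr fun y => ?_
    simp only [Function.comp]
    congr 1
    rw [intervalIntegral.integral_of_le (by linarith),
      ← MeasureTheory.integral_indicator measurableSet_Ioc]
    refine integral_congr_ae (.of_forall fun t => ?_)
    simp only
    by_cases ht : t ∈ Set.Ioc (-T) T
    · rw [Set.indicator_of_mem ht, Set.indicator_of_mem ht, Circle.smul_def, smul_eq_mul,
        Real.fourierChar_apply]
      have : (2 * Real.pi * -(t * -(y / (2 * Real.pi))) : ℝ) = t * y := by field_simp
      rw [this, Complex.ofReal_mul]
      ring_nf
    · simp [ht]
  have h6 := (h2.add (h1.const_mul c)).eventually (lt_mem_nhds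
    (show 0 + c * (∫ v, fejer T v) - η < 0 + c * ∫ v, fejer T v by linarith))
  obtain ⟨y₀, hy₀⟩ := eventually_atTop.1 (h6.and (eventually_gt_atTop 0))
  refine ⟨y₀, fun y hy F D hD => ?_⟩
  obtain ⟨h7, h8⟩ := hy₀ y hy
  have h9 := fejer_sum_ge_one ha h0 hc hs hG hL hT h8 hD
  rw [integral_fejer hT] at h7
  linarith
end

end

section

open MeasureTheory intervalIntegral Filter Topology

lemma summable_one_div_one_add_int_sq : Summable fun j : ℤ => 1 / (1 + (j : ℝ) ^ 2) := by
  refine ((Real.summable_one_div_int_pow (p := 2)).2 one_lt_two).of_norm_bounded_eventually ?_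
  filter_upwards [(Set.finite_singleton (0 : ℤ)).compl_mem_cofinite] with j hj
  have hj' : (j : ℝ) ≠ 0 := by exact_mod_cast hj
  rw [Real.norm_of_nonneg (by positivity)]
  have : 0 < (j : ℝ) ^ 2 := by positivity
  gcongr
  linarith

lemma fejer_tail_le {a : ℕ → ℝ} (ha : ∀ n, 0 ≤ a n) {C : ℝ}
    (hC : ∀ (u : ℝ) (F : Finset ℕ), (∀ n ∈ F, u ≤ Real.log n ∧ Real.log n ≤ u + 1) →
      ∑ n ∈ F, a n / n ≤ C) {T δ : ℝ} (hT : 0 < T) (hδ : 0 < δ) (hδ1 : δ ≤ 1) {y : ℝ}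
    {E : Finset ℕ} (hE : ∀ n ∈ E, δ ≤ |y - Real.log n|) :
    ∑ n ∈ E, a n / n * fejer T (y - Real.log n) ≤
      20 * C * (∑' j : ℤ, 1 / (1 + (j : ℝ) ^ 2)) / (T * δ ^ 2) := by
  have hC0 : 0 ≤ C := by simpa using hC 0 ∅ (by simp)
  have hpt : ∀ n ∈ E, fejer T (y - Real.log n) ≤
      20 / (T * δ ^ 2) * (1 / (1 + (⌊Real.log n - y⌋ : ℝ) ^ 2)) := by
    intro n hn
    have h1 := hE n hn
    set v := y - Real.log n with hv
    have hv2 : Real.log n - y = -v := by rw [hv]; ring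
    rw [hv2]
    set j := ⌊-v⌋ with hj
    have hj1 : (j : ℝ) ≤ -v := Int.floor_le _
    have hj2 : -v < j + 1 := Int.lt_floor_add_one _
    have hv0 : v ≠ 0 := fun h => by rw [h, abs_zero] at h1; linarith
    have hsq : δ ^ 2 ≤ v ^ 2 := by rw [← sq_abs v]; gcongr
    refine (fejer_le hT hv0).trans ?_
    rw [div_mul_div_comm, mul_one, div_le_div_iff₀ (by positivity) (by positivity)]
    have key : δ ^ 2 * (1 + (j : ℝ) ^ 2) ≤ 5 * v ^ 2 := by
      have hδ2 : δ ^ 2 ≤ 1 := pow_le_one₀ hδ.le hδ1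
      have hj0 : (0 : ℝ) ≤ 1 + (j : ℝ) ^ 2 := by positivity
      rcases lt_trichotomy j 0 with h | h | h
      · rcases eq_or_lt_of_le (show j ≤ -1 by omega) with h' | h'
        · rw [h']; push_cast; nlinarith
        · have h3 : (j : ℝ) ≤ -2 := by exact_mod_cast (show j ≤ -2 by omega)
          have : δ ^ 2 * (1 + (j : ℝ) ^ 2) ≤ 1 + (j : ℝ) ^ 2 := mul_le_of_le_one_left hj0 hδ2
          nlinarith
      · rw [h]; push_cast; nlinarith
      · have h3 : (1 : ℝ) ≤ j := by exact_mod_cast h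
        have : δ ^ 2 * (1 + (j : ℝ) ^ 2) ≤ 1 + (j : ℝ) ^ 2 := mul_le_of_le_one_left hj0 hδ2
        nlinarith
    nlinarith
  have hterm : ∀ j ∈ E.image (fun n : ℕ => ⌊Real.log n - y⌋),
      ∑ n ∈ E with ⌊Real.log (n : ℕ) - y⌋ = j, a n / n * fejer T (y - Real.log n) ≤
      C * (20 / (T * δ ^ 2) * (1 / (1 + (j : ℝ) ^ 2))) := by
    intro j _
    calc _ ≤ ∑ n ∈ E with ⌊Real.log (n : ℕ) - y⌋ = j, a n / n * (20 / (T * δ ^ 2) * (1 / (1 + (j : ℝ) ^ 2))) := by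
          refine Finset.sum_le_sum fun n hn => ?_
          rw [Finset.mem_filter] at hn
          have h1 := hpt n hn.1
          rw [hn.2] at h1
          exact mul_le_mul_of_nonneg_left h1 (div_nonneg (ha n) (Nat.cast_nonneg n))
      _ ≤ _ := by
          rw [← Finset.sum_mul]
          refine mul_le_mul_of_nonneg_right (hC (y + j) _ fun n hn => ?_) (by positivity)
          rw [Finset.mem_filter, Int.floor_eq_iff] at hn
          constructor <;> linarith [hn.2.1, hn.2.2]
  rw [← Finset.sum_fiberwise_of_maps_to (g := fun n : ℕ => ⌊Real.log n - y⌋)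
    (t := E.image (fun n : ℕ => ⌊Real.log n - y⌋)) fun n hn => Finset.mem_image_of_mem _ hn]
  refine (Finset.sum_le_sum hterm).trans ?_
  rw [← Finset.mul_sum, ← Finset.mul_sum]
  have := summable_one_div_one_add_int_sq.sum_le_tsum (E.image (fun n : ℕ => ⌊Real.log n - y⌋))
    (fun j _ => by positivity)
  calc C * (20 / (T * δ ^ 2) * _) ≤ C * (20 / (T * δ ^ 2) * (∑' j : ℤ, 1 / (1 + (j : ℝ) ^ 2))) := by gcongr
    _ = _ := by ring

/-- A Tauberian theorem of Wiener–Ikehara type: a lower bound in short logarithmic intervals. -/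
theorem sum_div_ge_of_LSeries {a : ℕ → ℝ} {c : ℝ} {G : ℂ → ℂ} (ha : ∀ n, 0 ≤ a n) (h0 : a 0 = 0)
    (hc : 0 ≤ c) (hs : ∀ σ : ℝ, 1 < σ → LSeriesSummable (fun n => (a n : ℂ)) σ)
    (hG : ContinuousOn G {s | 1 ≤ s.re})
    (hL : ∀ s : ℂ, 1 < s.re → LSeries (fun n => (a n : ℂ)) s = G s + c / (s - 1)) {C : ℝ}
    (hC : ∀ (u : ℝ) (F : Finset ℕ), (∀ n ∈ F, u ≤ Real.log n ∧ Real.log n ≤ u + 1) →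
      ∑ n ∈ F, a n / n ≤ C) {η : ℝ} (hη : 0 < η) :
    ∃ y₀ : ℝ, ∀ y ≥ y₀, ∀ h : ℝ, 0 ≤ h → h ≤ 1 → ∀ F : Finset ℕ,
      (∀ n : ℕ, n ≠ 0 → y < Real.log n → Real.log n ≤ y + h → n ∈ F) →
      c * h - η ≤ ∑ n ∈ F, a n / n := by
  have hC0 : 0 ≤ C := by simpa using hC 0 ∅ (by simp)
  set κ := ∫ v, fejer 1 v with hκ
  have hκ0 : 0 < κ := integral_fejer_pos
  set Z := ∑' j : ℤ, 1 / (1 + (j : ℝ) ^ 2)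
  have hZ : 0 ≤ Z := tsum_nonneg fun j => by positivity
  obtain ⟨δ, hδ, hδ1, hδc⟩ : ∃ δ : ℝ, 0 < δ ∧ δ ≤ 1 ∧ 2 * δ * c ≤ η / 2 := by
    refine ⟨min 1 (η / (4 * (c + 1))), by positivity, min_le_left _ _, ?_⟩
    have : min 1 (η / (4 * (c + 1))) ≤ η / (4 * (c + 1)) := min_le_right _ _
    calc 2 * min 1 (η / (4 * (c + 1))) * c ≤ 2 * (η / (4 * (c + 1))) * (c + 1) := by gcongr; linarith
      _ = η / 2 := by field_simp; ring
  set T := (20 * C * Z + 1) / (δ ^ 2 * (κ * η / 4)) with hTdef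
  have hT : 0 < T := by positivity
  set D := 20 * C * Z / (T * δ ^ 2) with hD
  have hDle : D ≤ κ * η / 4 := by
    rw [hD, div_le_iff₀ (by positivity), hTdef]
    field_simp
    linarith
  obtain ⟨y₀, hy₀⟩ := fejer_sum_eventually_ge ha h0 hc hs hG hL hT
    (show 0 < κ * η / 4 by positivity)
  refine ⟨y₀, fun y hy h hh0 hh1 F hF => ?_⟩
  have han : ∀ n : ℕ, 0 ≤ a n / n := fun n => div_nonneg (ha n) (Nat.cast_nonneg n)
  rcases lt_or_ge h (2 * δ) with hh | hh
  · have : c * h ≤ c * (2 * δ) := by gcongr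
    have := Finset.sum_nonneg fun n (_ : n ∈ F) => han n
    linarith
  have hwin : ∀ y' ∈ Set.Icc (y + δ) (y + h - δ),
      c * κ - κ * η / 2 ≤ ∑ n ∈ F, a n / n * fejer T (y' - Real.log n) := by
    intro y' hy'
    have h1 := hy₀ y' (by linarith [hy'.1]) F D fun E hEF => by
      have h2 : ∑ n ∈ E, a n / n * fejer T (y' - Real.log n) =
          ∑ n ∈ E with n ≠ 0, a n / n * fejer T (y' - Real.log n) := by
        refine (Finset.sum_filter_of_ne (p := fun n : ℕ => n ≠ 0) fun n _ hn hn0 => hn ?_).symm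
        rw [hn0, h0]; simp
      rw [h2]
      refine fejer_tail_le ha hC hT hδ hδ1 fun n hn => ?_
      rw [Finset.mem_filter] at hn
      by_contra! hlt
      rw [abs_lt] at hlt
      exact (Finset.disjoint_left.1 hEF hn.1)
        (hF n hn.2 (by linarith [hy'.1]) (by linarith [hy'.2]))
    linarith
  have hcont : ∀ n : ℕ, Continuous fun y' => a n / n * fejer T (y' - Real.log n) := fun n => by
    have := continuous_fejer T
    fun_prop
  have hInt : (h - 2 * δ) * (c * κ - κ * η / 2) ≤ (∑ n ∈ F, a n / n) * κ := by
    calc (h - 2 * δ) * (c * κ - κ * η / 2)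
        = ∫ _ in (y + δ)..(y + h - δ), (c * κ - κ * η / 2) := by
          rw [intervalIntegral.integral_const, smul_eq_mul]; ring
      _ ≤ ∫ y' in (y + δ)..(y + h - δ), ∑ n ∈ F, a n / n * fejer T (y' - Real.log n) :=
          integral_mono_on (by linarith) intervalIntegrable_const
            ((continuous_finsetSum _ fun n _ => hcont n).intervalIntegrable _ _) hwin
      _ = ∑ n ∈ F, ∫ y' in (y + δ)..(y + h - δ), a n / n * fejer T (y' - Real.log n) :=
          intervalIntegral.integral_finsetSum fun n _ => (hcont n).intervalIntegrable _ _
      _ ≤ ∑ n ∈ F, a n / n * κ := by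
          refine Finset.sum_le_sum fun n _ => ?_
          rw [intervalIntegral.integral_const_mul, intervalIntegral.integral_comp_sub_right (fejer T),
            intervalIntegral.integral_of_le (by linarith), hκ, ← integral_fejer hT]
          refine mul_le_mul_of_nonneg_left ?_ (han n)
          exact setIntegral_le_integral (integrable_fejer hT) (.of_forall fun v => fejer_nonneg hT v)
      _ = _ := by rw [Finset.sum_mul]
  have h3 : (h - 2 * δ) * (c - η / 2) ≤ ∑ n ∈ F, a n / n := by
    refine le_of_mul_le_mul_right ?_ hκ0
    linarith
  nlinarith

end

section

open Filter Topology ArithmeticFunction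

lemma sum_residueClass_div_le {q : ℕ} (b : ZMod q) (u : ℝ) (F : Finset ℕ)
    (hF : ∀ n ∈ F, u ≤ Real.log n ∧ Real.log n ≤ u + 1) :
    ∑ n ∈ F, vonMangoldt.residueClass b n / n ≤ (Real.log 4 + 4) * Real.exp 1 := by
  have hpt : ∀ n ∈ F, vonMangoldt.residueClass b n / n ≤ (if n = 0 then 0 else Λ n) / Real.exp u := by
    intro n hn
    rcases eq_or_ne n 0 with rfl | hn0
    · simp
    · rw [if_neg hn0]
      have hn0' : (0 : ℝ) < n := by positivity
      have := (Real.le_log_iff_exp_le hn0').1 (hF n hn).1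
      have h1 := vonMangoldt.residueClass_le b n
      have h2 : (0 : ℝ) ≤ Λ n := vonMangoldt_nonneg
      gcongr
  refine (Finset.sum_le_sum hpt).trans ?_
  rw [← Finset.sum_div, div_le_iff₀ (Real.exp_pos u)]
  calc ∑ n ∈ F, (if n = 0 then 0 else Λ n) = ∑ n ∈ F with n ≠ 0, Λ n := by
        rw [Finset.sum_filter]
        exact Finset.sum_congr rfl fun n _ => by by_cases h : n = 0 <;> simp [h]
    _ ≤ Chebyshev.psi (Real.exp (u + 1)) := by
        refine Finset.sum_le_sum_of_subset_of_nonneg (fun n hn => ?_) fun n _ _ => vonMangoldt_nonneg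
        rw [Finset.mem_filter] at hn
        have hn0' : (0 : ℝ) < n := by have := hn.2; positivity
        rw [Finset.mem_Ioc]
        exact ⟨Nat.pos_of_ne_zero hn.2, Nat.le_floor
          ((Real.log_le_iff_le_exp hn0').1 (hF n hn.1).2)⟩
    _ ≤ (Real.log 4 + 4) * Real.exp (u + 1) := Chebyshev.psi_le_const_mul_self (Real.exp_pos _).le
    _ = _ := by rw [Real.exp_add]; ring

/-- Lower bound in the prime number theorem for arithmetic progressions, in intervals of
multiplicative length at most `e`. -/
theorem card_primes_modEq_ge {q b : ℕ} (hq : q ≠ 0) (hb : b.Coprime q) {η : ℝ} (hη : 0 < η) :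
    ∃ X₀ : ℝ, ∀ X ≥ X₀, ∀ Y : ℝ, X ≤ Y → Y ≤ Real.exp 1 * X →
      (Real.log (Y / X) / q.totient - η) * X ≤
        ((Finset.Ioc ⌊X⌋₊ ⌊Y⌋₊).filter fun p => p.Prime ∧ p ≡ b [MOD q]).card * Real.log X := by
  have : NeZero q := ⟨hq⟩
  have hu : IsUnit (b : ZMod q) := (ZMod.isUnit_iff_coprime b q).2 hb
  set a := vonMangoldt.residueClass (b : ZMod q) with ha
  have hs : ∀ σ : ℝ, 1 < σ → LSeriesSummable (fun n => (a n : ℂ)) σ := fun σ hσ =>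
    LSeriesSummable_of_abscissaOfAbsConv_lt_re <|
      (vonMangoldt.abscissaOfAbsConv_residueClass_le_one _).trans_lt <| by
        rw [Complex.ofReal_re]; exact_mod_cast hσ
  have hL : ∀ s : ℂ, 1 < s.re → LSeries (fun n => (a n : ℂ)) s =
      vonMangoldt.LFunctionResidueClassAux (b : ZMod q) s + ((q.totient : ℝ)⁻¹ : ℝ) / (s - 1) := by
    intro s hs
    have := vonMangoldt.eqOn_LFunctionResidueClassAux hu hs
    rw [this]
    simp [ha]
  obtain ⟨y₀, hy₀⟩ := sum_div_ge_of_LSeries (vonMangoldt.residueClass_nonneg _)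
    (vonMangoldt.residueClass_apply_zero _) (by positivity) hs
    (vonMangoldt.continuousOn_LFunctionResidueClassAux _) hL (sum_residueClass_div_le _)
    (half_pos hη)
  obtain ⟨s, hs⟩ := summable_iff_vanishing_norm.1
    (vonMangoldt.summable_residueClass_non_primes_div (b : ZMod q)) (η / 2) (half_pos hη)
  refine ⟨max (Real.exp y₀) (max (Real.exp 1) (s.sup id + 1)), fun X hX Y hXY hYX => ?_⟩
  have hX1 : Real.exp y₀ ≤ X := (le_max_left _ _).trans hX
  have hX2 : Real.exp 1 ≤ X := ((le_max_left _ _).trans (le_max_right _ _)).trans hX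
  have hX3 : (s.sup id : ℕ) + 1 ≤ X := ((le_max_right _ _).trans (le_max_right _ _)).trans hX
  have hX0 : 0 < X := (Real.exp_pos 1).trans_le hX2
  have hY0 : 0 < Y := hX0.trans_le hXY
  set F := Finset.Ioc ⌊X⌋₊ ⌊Y⌋₊ with hF
  have hmem : ∀ n ∈ F, X < n := fun n hn => (Nat.floor_lt hX0.le).1 (Finset.mem_Ioc.1 hn).1
  have h1 := hy₀ (Real.log X) ((Real.le_log_iff_exp_le hX0).2 hX1) (Real.log (Y / X))
    (Real.log_nonneg ((one_le_div hX0).2 hXY))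
    ((Real.log_le_iff_le_exp (by positivity)).2 ((div_le_iff₀ hX0).2 hYX)) F fun n hn hn1 hn2 => by
      have hn0' : (0 : ℝ) < n := by positivity
      rw [Real.log_div hY0.ne' hX0.ne', add_sub_cancel] at hn2
      rw [hF, Finset.mem_Ioc]
      exact ⟨(Nat.floor_lt hX0.le).2 ((Real.log_lt_log_iff hX0 hn0').1 hn1),
        Nat.le_floor ((Real.log_le_log_iff hn0' hY0).1 hn2)⟩
  have h2 : ∑ n ∈ F, (if n.Prime then 0 else a n) / n < η / 2 := by
    refine (le_abs_self _).trans_lt (hs F ?_)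
    rw [Finset.disjoint_left]
    intro n hn hns
    have h3 : n ≤ s.sup id := Finset.le_sup (f := id) hns
    have h4 := hmem n hn
    have : (n : ℝ) ≤ (s.sup id : ℕ) := by exact_mod_cast h3
    linarith
  have h3 : ∑ n ∈ F, (if n.Prime then a n else 0) / n ≤
      (F.filter fun p => p.Prime ∧ p ≡ b [MOD q]).card * (Real.log X / X) := by
    rw [← nsmul_eq_mul, ← Finset.sum_const, Finset.sum_filter]
    refine Finset.sum_le_sum fun n hn => ?_
    by_cases hp : n.Prime
    · by_cases hm : n ≡ b [MOD q]
      · have hm' : (n : ZMod q) = b := (ZMod.natCast_eq_natCast_iff _ _ _).2 hm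
        rw [if_pos hp, if_pos ⟨hp, hm⟩, ha, vonMangoldt.residueClass,
          Set.indicator_of_mem (by exact hm'), vonMangoldt_apply_prime hp]
        exact Real.log_div_self_antitoneOn hX2 (hX2.trans (hmem n hn).le) (hmem n hn).le
      · have hm' : ¬ (n : ZMod q) = b := fun h => hm ((ZMod.natCast_eq_natCast_iff _ _ _).1 h)
        rw [if_pos hp, if_neg (fun h => hm h.2), ha, vonMangoldt.residueClass,
          Set.indicator_of_notMem (by exact hm'), zero_div]
    · rw [if_neg hp, if_neg (fun h => hp h.1), zero_div]
  have h4 : ∑ n ∈ F, a n / n = ∑ n ∈ F, (if n.Prime then 0 else a n) / n +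
      ∑ n ∈ F, (if n.Prime then a n else 0) / n := by
    rw [← Finset.sum_add_distrib]
    refine Finset.sum_congr rfl fun n _ => ?_
    by_cases hp : n.Prime <;> simp [hp]
  have h5 : Real.log (Y / X) / q.totient - η ≤
      (F.filter fun p => p.Prime ∧ p ≡ b [MOD q]).card * (Real.log X / X) := by
    rw [div_eq_inv_mul]; linarith
  calc _ ≤ (F.filter fun p => p.Prime ∧ p ≡ b [MOD q]).card * (Real.log X / X) * X := by gcongr
    _ = _ := by field_simp

end

section

open Finset ArithmeticFunction
open scoped ArithmeticFunction.Moebius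

/-- The coefficients of a Selberg sieve, in terms of the dual variables `x`. -/
noncomputable def lam (R : Finset ℕ) (x : ℕ → ℝ) (d : ℕ) : ℝ :=
  d * ∑ r ∈ R with d ∣ r, x r * μ (r / d)

/-- The value at `n` of the sieve with dual variables `x`. -/
noncomputable def lamSum (R : Finset ℕ) (x : ℕ → ℝ) (n : ℕ) : ℝ :=
  ∑ d ∈ R with d ∣ n, lam R x d

/-- A finite set of positive integers closed under divisors. -/
def IsDivClosed (R : Finset ℕ) : Prop := ∀ r ∈ R, 0 < r ∧ ∀ d, d ∣ r → d ∈ R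

lemma sum_moebius_div_eq {l r : ℕ} (hr : 0 < r) (hl : l ∣ r) :
    ∑ d ∈ r.divisors with l ∣ d, (μ (r / d) : ℝ) = if r = l then 1 else 0 := by
  have hl0 : 0 < l := Nat.pos_of_dvd_of_pos hl hr
  have h1 : ∑ d ∈ r.divisors with l ∣ d, (μ (r / d) : ℝ) =
      ∑ d ∈ r.divisors, (fun e => if l ∣ r / e then (μ e : ℝ) else 0) (r / d) := by
    rw [sum_filter]
    refine sum_congr rfl fun d hd => ?_
    simp only
    rw [Nat.div_div_self (Nat.dvd_of_mem_divisors hd) hr.ne']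
  rw [h1, Nat.sum_div_divisors r fun e => if l ∣ r / e then (μ e : ℝ) else 0, ← sum_filter]
  have h2 : {e ∈ r.divisors | l ∣ r / e} = (r / l).divisors := by
    ext e
    simp only [mem_filter, Nat.mem_divisors]
    have hrl : r / l ≠ 0 := (Nat.div_pos (Nat.le_of_dvd hr hl) hl0).ne'
    constructor
    · rintro ⟨⟨he, -⟩, h⟩
      refine ⟨?_, hrl⟩
      rw [Nat.dvd_div_iff_mul_dvd hl]
      rwa [Nat.dvd_div_iff_mul_dvd he, mul_comm] at h
    · rintro ⟨he, -⟩
      have he' : e ∣ r := he.trans (Nat.div_dvd_of_dvd hl)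
      refine ⟨⟨he', hr.ne'⟩, ?_⟩
      rw [Nat.dvd_div_iff_mul_dvd he', mul_comm]
      rwa [Nat.dvd_div_iff_mul_dvd hl] at he
  rw [h2]
  have h3 := congrArg (fun f => f (r / l)) moebius_mul_coe_zeta
  simp only [coe_mul_zeta_apply, one_apply] at h3
  rw [← Int.cast_sum, h3]
  have : r / l = 1 ↔ r = l := by rw [Nat.div_eq_iff_eq_mul_left hl0 hl, one_mul]
  simp only [this]
  split_ifs <;> simp

lemma sum_lam_div {R : Finset ℕ} (hR : IsDivClosed R) (x : ℕ → ℝ) {l : ℕ} (hl : l ∈ R) :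
    ∑ d ∈ R with l ∣ d, lam R x d / d = x l := by
  calc ∑ d ∈ R with l ∣ d, lam R x d / d
      = ∑ d ∈ R with l ∣ d, ∑ r ∈ R with d ∣ r, x r * μ (r / d) := by
        refine sum_congr rfl fun d hd => ?_
        have : (d : ℝ) ≠ 0 := by exact_mod_cast (hR d (mem_filter.1 hd).1).1.ne'
        rw [lam, mul_div_cancel_left₀ _ this]
    _ = ∑ r ∈ R, ∑ d ∈ r.divisors with l ∣ d, x r * μ (r / d) := by
        refine sum_comm' fun d r => ?_
        simp only [mem_filter, Nat.mem_divisors]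
        constructor
        · rintro ⟨⟨h1, h2⟩, h3, h4⟩
          exact ⟨⟨⟨h4, (hR r h3).1.ne'⟩, h2⟩, h3⟩
        · rintro ⟨⟨⟨h4, -⟩, h2⟩, h3⟩
          exact ⟨⟨(hR r h3).2 d h4, h2⟩, h3, h4⟩
    _ = ∑ r ∈ R, if r = l then x r else 0 := by
        refine sum_congr rfl fun r hr => ?_
        rw [← mul_sum]
        by_cases h : l ∣ r
        · rw [sum_moebius_div_eq (hR r hr).1 h, mul_ite, mul_one, mul_zero]
        · have hne : r ≠ l := fun h' => h (h' ▸ dvd_rfl)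
          rw [if_neg hne, filter_false_of_mem, sum_empty, mul_zero]
          exact fun d hd hld => h (hld.trans (Nat.dvd_of_mem_divisors hd))
    _ = x l := by rw [sum_ite_eq' R l, if_pos hl]

lemma sum_lam_mul_lam_div_lcm {R : Finset ℕ} (hR : IsDivClosed R) (x : ℕ → ℝ) :
    ∑ d ∈ R, ∑ e ∈ R, lam R x d * lam R x e / (d.lcm e) = ∑ l ∈ R, l.totient * x l ^ 2 := by
  have h1 : ∀ d ∈ R, ∀ e ∈ R, lam R x d * lam R x e / (d.lcm e) =
      ∑ l ∈ R with l ∣ d ∧ l ∣ e, l.totient * (lam R x d / d * (lam R x e / e)) := by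
    intro d hd e he
    have hd0 : (d : ℝ) ≠ 0 := by exact_mod_cast (hR d hd).1.ne'
    have he0 : (e : ℝ) ≠ 0 := by exact_mod_cast (hR e he).1.ne'
    have hg : 0 < d.gcd e := Nat.gcd_pos_of_pos_left _ (hR d hd).1
    have h2 : {l ∈ R | l ∣ d ∧ l ∣ e} = (d.gcd e).divisors := by
      ext l
      simp only [mem_filter, Nat.mem_divisors, Nat.dvd_gcd_iff]
      exact ⟨fun h => ⟨h.2, hg.ne'⟩, fun h => ⟨(hR d hd).2 l h.1.1, h.1⟩⟩
    rw [← sum_mul, h2, ← Nat.cast_sum, Nat.sum_totient]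
    have h3 : ((d.gcd e : ℕ) : ℝ) * (d.lcm e : ℕ) = d * e := by
      exact_mod_cast Nat.gcd_mul_lcm d e
    have h4 : ((d.lcm e : ℕ) : ℝ) ≠ 0 := by
      exact_mod_cast (Nat.lcm_pos (hR d hd).1 (hR e he).1).ne'
    field_simp
    linear_combination (-(lam R x d * lam R x e)) * h3
  rw [sum_congr rfl fun d hd => sum_congr rfl fun e he => h1 d hd e he]
  calc ∑ d ∈ R, ∑ e ∈ R, ∑ l ∈ R with l ∣ d ∧ l ∣ e, (l.totient : ℝ) * (lam R x d / d * (lam R x e / e))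
      = ∑ d ∈ R, ∑ l ∈ R, ∑ e ∈ R, if l ∣ d ∧ l ∣ e then (l.totient : ℝ) * (lam R x d / d * (lam R x e / e)) else 0 := by
        refine sum_congr rfl fun d _ => ?_
        rw [sum_comm]
        exact sum_congr rfl fun e _ => by rw [sum_filter]
    _ = ∑ l ∈ R, ∑ d ∈ R, ∑ e ∈ R, if l ∣ d ∧ l ∣ e then (l.totient : ℝ) * (lam R x d / d * (lam R x e / e)) else 0 := sum_comm
    _ = ∑ l ∈ R, l.totient * x l ^ 2 := by
        refine sum_congr rfl fun l hl => ?_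
        conv_rhs => rw [sq, ← sum_lam_div hR x hl, sum_mul_sum, sum_filter, mul_sum]
        refine sum_congr rfl fun d _ => ?_
        by_cases h : l ∣ d
        · simp only [h, true_and, if_true, sum_filter, mul_sum, mul_ite, mul_zero]
        · simp [h]

lemma sum_range_ee_of_dvd {Q D q : ℕ} (hQ : 0 < Q) (hq : 0 < q) (hD : D ∣ Q) (hqQ : q ∣ Q) :
    ∑ n ∈ range Q with D ∣ n, ee (n / q) = if q ∣ D then ((Q / D : ℝ) : ℂ) else 0 := by
  obtain ⟨N, rfl⟩ := hD
  have hD0 : 0 < D := Nat.pos_of_mul_pos_right hQ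
  have h1 : ∑ n ∈ range (D * N) with D ∣ n, ee (n / q) = ∑ m ∈ range N, ee (D / q) ^ m := by
    symm
    refine sum_bij (fun m _ => D * m) ?_ ?_ ?_ ?_
    · intro m hm
      rw [mem_range] at hm
      simp only [mem_filter, mem_range]
      exact ⟨Nat.mul_lt_mul_of_pos_left hm hD0, dvd_mul_right _ _⟩
    · intro a _ b _ h
      exact Nat.eq_of_mul_eq_mul_left hD0 h
    · intro n hn
      simp only [mem_filter, mem_range] at hn
      obtain ⟨m, rfl⟩ := hn.2
      exact ⟨m, mem_range.2 (Nat.lt_of_mul_lt_mul_left hn.1), rfl⟩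
    · intro m _
      rw [← ee_nat_mul]
      congr 1
      push_cast; ring
  have hq0 : (q : ℝ) ≠ 0 := by exact_mod_cast hq.ne'
  rw [h1]
  split_ifs with h
  · obtain ⟨k, rfl⟩ := h
    have : ee (((q * k : ℕ) : ℝ) / q) = 1 := by
      rw [ee_eq_one_iff]
      exact ⟨k, by push_cast; field_simp⟩
    rw [this]
    have hD0' : ((q * k : ℕ) : ℝ) ≠ 0 := by exact_mod_cast hD0.ne'
    have : (((q * k * N : ℕ) : ℝ) / ((q * k : ℕ) : ℝ)) = N := by
      rw [Nat.cast_mul (q * k) N, mul_div_cancel_left₀ _ hD0']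
    rw [this]; simp
  · have hne : ee ((D : ℝ) / q) ≠ 1 := by
      rw [Ne, ee_eq_one_iff]
      rintro ⟨k, hk⟩
      rw [div_eq_iff hq0] at hk
      have hk' : (D : ℤ) = k * q := by exact_mod_cast hk
      exact h (Int.natCast_dvd_natCast.1 ⟨k, by rw [hk', mul_comm]⟩)
    have h2 := mul_neg_geom_sum (ee ((D : ℝ) / q)) N
    have h3 : ee ((D : ℝ) / q) ^ N = 1 := by
      rw [← ee_nat_mul, ee_eq_one_iff]
      obtain ⟨k, hk⟩ := hqQ
      refine ⟨k, ?_⟩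
      have : ((D : ℝ) * N) = q * k := by exact_mod_cast hk
      rw [mul_div_assoc', mul_comm, this]
      push_cast; field_simp
    rw [h3, sub_self] at h2
    exact (mul_eq_zero.1 h2).resolve_left (sub_ne_zero.2 hne.symm)

lemma lamSum_sq (R : Finset ℕ) (x : ℕ → ℝ) (n : ℕ) :
    lamSum R x n ^ 2 = ∑ d ∈ R, ∑ e ∈ R, if d.lcm e ∣ n then lam R x d * lam R x e else 0 := by
  rw [sq, lamSum, sum_mul_sum, sum_filter]
  refine sum_congr rfl fun d _ => ?_
  by_cases h : d ∣ n
  · simp [h, sum_filter, Nat.lcm_dvd_iff]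
  · simp [h, Nat.lcm_dvd_iff]

lemma sum_ee_mul_lamSum_sq {R : Finset ℕ} (x : ℕ → ℝ) {Q q : ℕ} (hQ : 0 < Q)
    (hq : 0 < q) (hRQ : ∀ r ∈ R, r ∣ Q) (hqQ : q ∣ Q) :
    ∑ n ∈ range Q, ee (n / q) * (lamSum R x n ^ 2 : ℝ) =
      ((Q * ∑ d ∈ R, ∑ e ∈ R, if q ∣ d.lcm e then lam R x d * lam R x e / d.lcm e else 0 : ℝ) : ℂ) := by
  simp only [lamSum_sq, Complex.ofReal_sum, mul_sum]
  rw [sum_comm]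
  push_cast
  refine sum_congr rfl fun d hd => ?_
  rw [sum_comm]
  refine sum_congr rfl fun e he => ?_
  have h1 := sum_range_ee_of_dvd hQ hq (Nat.lcm_dvd (hRQ d hd) (hRQ e he)) hqQ
  calc ∑ n ∈ range Q, ee (n / q) * ((if d.lcm e ∣ n then lam R x d * lam R x e else 0 : ℝ) : ℂ)
      = (∑ n ∈ range Q with d.lcm e ∣ n, ee (n / q)) * ((lam R x d * lam R x e : ℝ) : ℂ) := by
        rw [sum_mul, sum_filter]
        refine sum_congr rfl fun n _ => ?_
        split_ifs <;> simp
    _ = _ := by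
        rw [h1]
        split_ifs with h
        · push_cast; ring
        · simp

lemma sum_lamSum_sq {R : Finset ℕ} (hR : IsDivClosed R) (x : ℕ → ℝ) {Q : ℕ} (hQ : 0 < Q)
    (hRQ : ∀ r ∈ R, r ∣ Q) :
    ∑ n ∈ range Q, lamSum R x n ^ 2 = Q * ∑ l ∈ R, l.totient * x l ^ 2 := by
  have h := sum_ee_mul_lamSum_sq x hQ one_pos hRQ (one_dvd Q)
  have h1 : ∀ n : ℕ, ee ((n : ℝ) / (1 : ℕ)) = 1 := fun n => by
    rw [ee_eq_one_iff]; exact ⟨n, by simp⟩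
  simp only [h1, one_mul, one_dvd, if_true] at h
  rw [← Complex.ofReal_sum, Complex.ofReal_inj] at h
  rw [h, sum_lam_mul_lam_div_lcm hR]

end

section

open Finset ArithmeticFunction
open scoped ArithmeticFunction.Moebius

lemma lamSum_add (R : Finset ℕ) (x y : ℕ → ℝ) (n : ℕ) :
    lamSum R (fun r => x r + y r) n = lamSum R x n + lamSum R y n := by
  simp only [lamSum, lam, add_mul, sum_add_distrib, mul_add]

/-- The correlation of the square of a sieve with a rational phase, bounded by the part of the
dual variables supported on multiples of a prime. -/
lemma abs_sum_lam_mul_lam_le {R : Finset ℕ} (hR : IsDivClosed R) (x : ℕ → ℝ) {p q : ℕ}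
    (hp : p.Prime) (hq : 0 < q) (hpq : p ∣ q) :
    |∑ d ∈ R, ∑ e ∈ R, if q ∣ d.lcm e then lam R x d * lam R x e / d.lcm e else 0| ≤
      2 * √((∑ r ∈ R, r.totient * x r ^ 2) * ∑ r ∈ R with p ∣ r, r.totient * x r ^ 2) +
        ∑ r ∈ R with p ∣ r, r.totient * x r ^ 2 := by
  set x1 : ℕ → ℝ := fun r => if p ∣ r then x r else 0 with hx1
  set x0 : ℕ → ℝ := fun r => if p ∣ r then 0 else x r with hx0
  have hx : x = fun r => x0 r + x1 r := by
    funext r; simp only [hx0, hx1]; split_ifs <;> simp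
  set Q : ℕ := q * ∏ r ∈ R, r with hQdef
  have hQ : 0 < Q := Nat.mul_pos hq (prod_pos fun r hr => (hR r hr).1)
  have hRQ : ∀ r ∈ R, r ∣ Q := fun r hr =>
    (dvd_prod_of_mem (fun r => r) hr).trans (dvd_mul_left _ _)
  have hqQ : q ∣ Q := dvd_mul_right _ _
  set A := ∑ r ∈ R, (r.totient : ℝ) * x r ^ 2
  set B := ∑ r ∈ R with p ∣ r, (r.totient : ℝ) * x r ^ 2
  have hA : 0 ≤ A := sum_nonneg fun r _ => by positivity
  have hB : 0 ≤ B := sum_nonneg fun r _ => by positivity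
  have hQ' : (0 : ℝ) < Q := by exact_mod_cast hQ
  have h0 : ∑ n ∈ range Q, lamSum R x0 n ^ 2 ≤ Q * A := by
    rw [sum_lamSum_sq hR x0 hQ hRQ]
    refine mul_le_mul_of_nonneg_left (sum_le_sum fun r _ => ?_) hQ'.le
    simp only [hx0]; split_ifs
    · simp; positivity
    · exact le_rfl
  have h1 : ∑ n ∈ range Q, lamSum R x1 n ^ 2 = Q * B := by
    have hB' : B = ∑ r ∈ R, if p ∣ r then (r.totient : ℝ) * x r ^ 2 else 0 := sum_filter _ _
    rw [sum_lamSum_sq hR x1 hQ hRQ, hB']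
    congr 1
    refine sum_congr rfl fun r _ => ?_
    simp only [hx1]; split_ifs <;> simp
  have hlam0 : ∀ d, p ∣ d → lam R x0 d = 0 := by
    intro d hd
    rw [lam, sum_eq_zero, mul_zero]
    intro r hr
    have : p ∣ r := hd.trans (mem_filter.1 hr).2
    simp [hx0, this]
  have h2 : ∑ n ∈ range Q, ee (n / q) * (lamSum R x0 n ^ 2 : ℝ) = 0 := by
    rw [sum_ee_mul_lamSum_sq x0 hQ hq hRQ hqQ, sum_eq_zero, mul_zero, Complex.ofReal_zero]
    intro d _
    refine sum_eq_zero fun e _ => ?_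
    split_ifs with h
    · have h3 : p ∣ d * e := (hpq.trans h).trans (Nat.lcm_dvd_mul d e)
      rcases (Nat.Prime.dvd_mul hp).1 h3 with h4 | h4
      · rw [hlam0 d h4]; simp
      · rw [hlam0 e h4]; simp
    · rfl
  have h3 := sum_ee_mul_lamSum_sq x hQ hq hRQ hqQ
  set M := ∑ d ∈ R, ∑ e ∈ R, if q ∣ d.lcm e then lam R x d * lam R x e / d.lcm e else 0
  have h4 : ∑ n ∈ range Q, ee (n / q) * (lamSum R x n ^ 2 : ℝ) =
      ∑ n ∈ range Q, ee (n / q) *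
        ((2 * (lamSum R x0 n * lamSum R x1 n) + lamSum R x1 n ^ 2 : ℝ) : ℂ) := by
    rw [← sub_eq_zero, ← sum_sub_distrib, ← h2]
    refine sum_congr rfl fun n _ => ?_
    rw [hx, lamSum_add]
    push_cast; ring
  have h5 : Q * |M| ≤ 2 * (Q * √(A * B)) + Q * B := by
    calc Q * |M| = ‖((Q * M : ℝ) : ℂ)‖ := by
          rw [Complex.norm_real, Real.norm_eq_abs, abs_mul, abs_of_pos hQ']
      _ ≤ ∑ n ∈ range Q, (2 * (|lamSum R x0 n| * |lamSum R x1 n|) + lamSum R x1 n ^ 2) := by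
          rw [← h3, h4]
          refine (norm_sum_le _ _).trans (sum_le_sum fun n _ => ?_)
          rw [norm_mul, norm_ee, one_mul, Complex.norm_real, Real.norm_eq_abs]
          refine (abs_add_le _ _).trans (le_of_eq ?_)
          rw [abs_mul, abs_mul, abs_of_nonneg (sq_nonneg (lamSum R x1 n)),
            abs_of_pos (two_pos : (0 : ℝ) < 2)]
      _ ≤ 2 * (Q * √(A * B)) + Q * B := by
          rw [sum_add_distrib, ← mul_sum, h1]
          gcongr
          have h6 := Real.sum_mul_le_sqrt_mul_sqrt (range Q) (fun n => |lamSum R x0 n|)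
            (fun n => |lamSum R x1 n|)
          simp only [sq_abs] at h6
          refine h6.trans ?_
          rw [h1, ← Real.sqrt_mul (sum_nonneg fun n _ => sq_nonneg _)]
          refine (Real.sqrt_le_sqrt (mul_le_mul_of_nonneg_right h0 (by positivity))).trans ?_
          rw [show (Q : ℝ) * A * (Q * B) = Q ^ 2 * (A * B) by ring, Real.sqrt_mul (by positivity),
            Real.sqrt_sq hQ'.le]
  have h7 : Q * |M| ≤ Q * (2 * √(A * B) + B) := by linarith
  exact le_of_mul_le_mul_left h7 hQ'

/-- The squarefree positive integers up to `R` which are coprime to `P`. -/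
noncomputable def selSet (R P : ℕ) : Finset ℕ := {r ∈ Icc 1 R | Squarefree r ∧ r.Coprime P}

/-- The normalising factor of the Selberg sieve. -/
noncomputable def selG (R P : ℕ) : ℝ := ∑ r ∈ selSet R P, 1 / (r.totient : ℝ)

/-- The Selberg weight: its square is a majorant, up to scaling, of the primes beyond `R`. -/
noncomputable def selH (R P n : ℕ) : ℝ := lamSum (selSet R P) (fun r => μ r / r.totient) n

lemma mem_selSet {R P r : ℕ} : r ∈ selSet R P ↔ (1 ≤ r ∧ r ≤ R) ∧ Squarefree r ∧ r.Coprime P := by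
  simp [selSet]

lemma isDivClosed_selSet (R P : ℕ) : IsDivClosed (selSet R P) := by
  intro r hr
  rw [mem_selSet] at hr
  refine ⟨hr.1.1, fun d hd => mem_selSet.2 ⟨⟨Nat.pos_of_dvd_of_pos hd hr.1.1,
    (Nat.le_of_dvd hr.1.1 hd).trans hr.1.2⟩, hr.2.1.squarefree_of_dvd hd, hr.2.2.coprime_dvd_left hd⟩⟩

lemma moebius_sq_eq_one_real {r : ℕ} (hr : Squarefree r) : (μ r : ℝ) ^ 2 = 1 := by
  rw [← Int.cast_pow, (moebius_sq_eq_one_of_squarefree hr), Int.cast_one]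

lemma totient_mul_sq_eq {R P r : ℕ} (hr : r ∈ selSet R P) :
    (r.totient : ℝ) * (μ r / r.totient : ℝ) ^ 2 = 1 / r.totient := by
  rw [mem_selSet] at hr
  have : (r.totient : ℝ) ≠ 0 := by exact_mod_cast (Nat.totient_pos.2 hr.1.1).ne'
  rw [div_pow, moebius_sq_eq_one_real hr.2.1]
  field_simp

lemma selG_nonneg (R P : ℕ) : 0 ≤ selG R P := sum_nonneg fun r _ => by positivity

lemma one_le_selG {R P : ℕ} (hR : 1 ≤ R) : 1 ≤ selG R P := by
  have h : (1 : ℕ) ∈ selSet R P := mem_selSet.2 ⟨⟨le_rfl, hR⟩, squarefree_one, Nat.coprime_one_left P⟩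
  calc (1 : ℝ) = 1 / (Nat.totient 1 : ℝ) := by simp
    _ ≤ selG R P := single_le_sum (f := fun r : ℕ => 1 / (r.totient : ℝ))
        (fun r _ => by positivity) h

lemma sum_lam_selSet (R P : ℕ) :
    ∑ d ∈ selSet R P, ∑ e ∈ selSet R P, lam (selSet R P) (fun r => μ r / r.totient) d *
      lam (selSet R P) (fun r => μ r / r.totient) e / d.lcm e = selG R P := by
  rw [sum_lam_mul_lam_div_lcm (isDivClosed_selSet R P)]
  exact sum_congr rfl fun r hr => totient_mul_sq_eq hr

lemma selH_of_prime {R P n : ℕ} (hR : 1 ≤ R) (hn : n.Prime) (hRn : R < n) :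
    selH R P n = selG R P := by
  have h1 : {d ∈ selSet R P | d ∣ n} = {1} := by
    ext d
    simp only [mem_filter, mem_singleton, mem_selSet]
    constructor
    · rintro ⟨⟨⟨-, h2⟩, -⟩, h3⟩
      rcases (Nat.dvd_prime hn).1 h3 with h | h
      · exact h
      · omega
    · rintro rfl
      exact ⟨⟨⟨le_rfl, hR⟩, squarefree_one, Nat.coprime_one_left P⟩, one_dvd _⟩
  rw [selH, lamSum, h1, sum_singleton, lam, selG]
  simp only [one_dvd, filter_true, Nat.cast_one, one_mul, Nat.div_one]
  refine sum_congr rfl fun r hr => ?_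
  have := moebius_sq_eq_one_real (mem_selSet.1 hr).2.1
  rw [div_mul_eq_mul_div, ← sq, this]

lemma sum_selSet_dvd_le {R P p : ℕ} (hp : p.Prime) :
    ∑ r ∈ selSet R P with p ∣ r, 1 / (r.totient : ℝ) ≤ selG R P / (p - 1 : ℕ) := by
  rw [selG, sum_div]
  calc ∑ r ∈ selSet R P with p ∣ r, 1 / (r.totient : ℝ)
      = ∑ r ∈ selSet R P with p ∣ r, 1 / ((r / p).totient : ℝ) / (p - 1 : ℕ) := by
        refine sum_congr rfl fun r hr => ?_
        rw [mem_filter, mem_selSet] at hr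
        obtain ⟨k, rfl⟩ := hr.2
        have hc : p.Coprime k := Nat.coprime_of_squarefree_mul hr.1.2.1
        rw [Nat.mul_div_cancel_left _ hp.pos, Nat.totient_mul hc, Nat.totient_prime hp,
          Nat.cast_mul, div_div, mul_comm]
    _ = ∑ k ∈ ({r ∈ selSet R P | p ∣ r}).image (fun r => r / p), 1 / (k.totient : ℝ) / (p - 1 : ℕ) := by
        rw [sum_image]
        intro a ha b hb hab
        exact (Nat.div_left_inj (mem_filter.1 ha).2 (mem_filter.1 hb).2).1 hab
    _ ≤ _ := by
        refine sum_le_sum_of_subset_of_nonneg ?_ fun _ _ _ => by positivity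
        intro k hk
        obtain ⟨r, hr, rfl⟩ := mem_image.1 hk
        rw [mem_filter] at hr
        exact (isDivClosed_selSet R P r hr.1).2 _ (Nat.div_dvd_of_dvd hr.2)

lemma abs_sum_lam_selSet_le {R P z q : ℕ} (hz : 1 ≤ z)
    (hP : ∀ p : ℕ, p.Prime → p ≤ z → p ∣ P) (hq : 1 < q) :
    |∑ d ∈ selSet R P, ∑ e ∈ selSet R P, if q ∣ d.lcm e then
      lam (selSet R P) (fun r => μ r / r.totient) d *
      lam (selSet R P) (fun r => μ r / r.totient) e / d.lcm e else 0| ≤ 3 * selG R P / √z := by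
  have hG := selG_nonneg R P
  have hp : q.minFac.Prime := Nat.minFac_prime hq.ne'
  have hpq := q.minFac_dvd
  set p := q.minFac
  have hz' : (1 : ℝ) ≤ z := by exact_mod_cast hz
  by_cases hpP : p ∣ P
  · rw [sum_eq_zero, abs_zero]
    · positivity
    · intro d hd
      refine sum_eq_zero fun e he => if_neg fun h => ?_
      have h3 : p ∣ d * e := (hpq.trans h).trans (Nat.lcm_dvd_mul d e)
      have h4 := (Nat.Coprime.mul_left (mem_selSet.1 hd).2.2 (mem_selSet.1 he).2.2)
      exact Nat.not_coprime_of_dvd_of_dvd hp.one_lt h3 hpP h4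
  · have hzp : z ≤ p - 1 := by
      have : z < p := by
        by_contra h
        exact hpP (hP p hp (not_lt.1 h))
      omega
    refine (abs_sum_lam_mul_lam_le (isDivClosed_selSet R P) _ hp (by omega) hpq).trans ?_
    have hA : ∑ r ∈ selSet R P, (r.totient : ℝ) * (μ r / r.totient : ℝ) ^ 2 = selG R P :=
      sum_congr rfl fun r hr => totient_mul_sq_eq hr
    have hB : ∑ r ∈ selSet R P with p ∣ r, (r.totient : ℝ) * (μ r / r.totient : ℝ) ^ 2 ≤
        selG R P / z := by
      rw [sum_congr rfl fun r hr => totient_mul_sq_eq (mem_filter.1 hr).1]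
      refine (sum_selSet_dvd_le hp).trans ?_
      have : (z : ℝ) ≤ (p - 1 : ℕ) := by exact_mod_cast hzp
      gcongr
    rw [hA]
    have h1 : √(selG R P * ∑ r ∈ selSet R P with p ∣ r, (r.totient : ℝ) * (μ r / r.totient : ℝ) ^ 2)
        ≤ selG R P / √z := by
      rw [Real.sqrt_le_left (by positivity), div_pow, Real.sq_sqrt (by positivity), sq, mul_div_assoc]
      gcongr
    have h2 : selG R P / z ≤ selG R P / √z := by
      apply div_le_div_of_nonneg_left hG (by positivity)
      rw [Real.sqrt_le_left (by positivity)]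
      nlinarith
    calc _ ≤ 2 * (selG R P / √z) + selG R P / √z := by linarith
      _ = _ := by ring

end

section

open Finset ArithmeticFunction
open scoped ArithmeticFunction.Moebius

lemma selG_le_mul_selG (R W : ℕ) {P : ℕ} (hP : P ≠ 0) :
    selG R W ≤ (∑ k ∈ P.divisors, 1 / (k.totient : ℝ)) * selG R (W * P) := by
  rw [selG, selG, sum_mul_sum, ← sum_product']
  have hinj : Set.InjOn (fun r : ℕ => (r.gcd P, r / r.gcd P)) (selSet R W : Set ℕ) := by
    intro a ha b hb hab
    simp only [Prod.mk.injEq] at hab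
    rw [← Nat.mul_div_cancel' (Nat.gcd_dvd_left a P), ← Nat.mul_div_cancel' (Nat.gcd_dvd_left b P),
      hab.2, hab.1]
  calc ∑ r ∈ selSet R W, 1 / (r.totient : ℝ)
      = ∑ r ∈ selSet R W, 1 / ((r.gcd P).totient : ℝ) * (1 / ((r / r.gcd P).totient : ℝ)) := by
        refine sum_congr rfl fun r hr => ?_
        have h1 : r.gcd P * (r / r.gcd P) = r := Nat.mul_div_cancel' (Nat.gcd_dvd_left r P)
        have h2 : (r.gcd P).Coprime (r / r.gcd P) :=
          Nat.coprime_of_squarefree_mul (h1.symm ▸ (mem_selSet.1 hr).2.1)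
        conv_lhs => rw [← h1, Nat.totient_mul h2]
        push_cast; ring
    _ = ∑ x ∈ (selSet R W).image (fun r : ℕ => (r.gcd P, r / r.gcd P)),
          1 / (x.1.totient : ℝ) * (1 / (x.2.totient : ℝ)) := by rw [sum_image hinj]
    _ ≤ _ := by
        refine sum_le_sum_of_subset_of_nonneg ?_ fun _ _ _ => by positivity
        intro x hx
        obtain ⟨r, hr, rfl⟩ := mem_image.1 hx
        have h1 : r.gcd P * (r / r.gcd P) = r := Nat.mul_div_cancel' (Nat.gcd_dvd_left r P)
        have hr' := mem_selSet.1 hr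
        have h3 := mem_selSet.1 ((isDivClosed_selSet R W r hr).2 (r / r.gcd P)
          (Nat.div_dvd_of_dvd (Nat.gcd_dvd_left r P)))
        rw [mem_product, Nat.mem_divisors, mem_selSet]
        refine ⟨⟨Nat.gcd_dvd_right r P, hP⟩, h3.1, h3.2.1, Nat.Coprime.mul_right h3.2.2 ?_⟩
        by_contra hc
        obtain ⟨p, hp, hp1, hp2⟩ := Nat.Prime.not_coprime_iff_dvd.1 hc
        have h4 : p ∣ r.gcd P := Nat.dvd_gcd (hp1.trans (Nat.div_dvd_of_dvd (Nat.gcd_dvd_left r P))) hp2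
        have h2 : (r.gcd P).Coprime (r / r.gcd P) :=
          Nat.coprime_of_squarefree_mul (h1.symm ▸ hr'.2.1)
        exact Nat.not_coprime_of_dvd_of_dvd hp.one_lt h4 hp1 h2

lemma prod_one_sub_inv_eq {n : ℕ} (hn : n ≠ 0) :
    ∏ p ∈ n.primeFactors, (1 - (p : ℝ)⁻¹)⁻¹ = n / n.totient := by
  have h := congrArg (fun q : ℚ => (q : ℝ)) (Nat.totient_eq_mul_prod_factors n)
  push_cast at h
  have h0 : (n.totient : ℝ) ≠ 0 := by
    exact_mod_cast (Nat.totient_pos.2 (Nat.pos_of_ne_zero hn)).ne'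
  have hn' : (n : ℝ) ≠ 0 := by exact_mod_cast hn
  rw [prod_inv_distrib, eq_div_iff h0, h, mul_comm, mul_assoc, mul_inv_cancel₀, mul_one]
  intro h1
  rw [h1, mul_zero] at h
  exact h0 h

lemma sum_divisors_inv_totient {P : ℕ} (hP : Squarefree P) :
    ∑ k ∈ P.divisors, 1 / (k.totient : ℝ) = P / P.totient := by
  let f : ArithmeticFunction ℝ := ⟨fun k => 1 / (k.totient : ℝ), by simp⟩
  have hf : f.IsMultiplicative := by
    refine ⟨by simp [f], fun {m n} h => ?_⟩
    simp only [f, coe_mk]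
    rw [Nat.totient_mul h]
    push_cast
    rw [one_div_mul_one_div]
  have h := hf.prodPrimeFactors_one_add_of_squarefree hP
  calc ∑ k ∈ P.divisors, 1 / (k.totient : ℝ) = ∏ p ∈ P.primeFactors, (1 + f p) := h.symm
    _ = ∏ p ∈ P.primeFactors, (1 - (p : ℝ)⁻¹)⁻¹ := by
        refine prod_congr rfl fun p hp => ?_
        have hp' := Nat.prime_of_mem_primeFactors hp
        have h2 : (1 : ℝ) < p := by exact_mod_cast hp'.one_lt
        simp only [f, coe_mk]
        rw [Nat.totient_prime hp', Nat.cast_sub hp'.one_le]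
        have : (p : ℝ) - 1 ≠ 0 := by linarith
        have : (p : ℝ) ≠ 0 := by linarith
        rw [Nat.cast_one]
        have : 1 - (p : ℝ)⁻¹ = (p - 1) / p := by field_simp
        rw [this, inv_div]
        field_simp
        ring
    _ = _ := prod_one_sub_inv_eq hP.ne_zero

/-- The product of the primes dividing `n`. -/
def radic (n : ℕ) : ℕ := ∏ p ∈ n.primeFactors, p

lemma radic_dvd (n : ℕ) : radic n ∣ n := Nat.prod_primeFactors_dvd n

lemma primeFactors_radic (n : ℕ) : (radic n).primeFactors = n.primeFactors :=
  Nat.primeFactors_prod fun _ hp => Nat.prime_of_mem_primeFactors hp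

lemma squarefree_radic (n : ℕ) : Squarefree (radic n) := by
  refine Finset.squarefree_prod_of_pairwise_isCoprime ?_ ?_
  · intro p hp q hq hpq
    exact Nat.coprime_iff_isRelPrime.1 ((Nat.coprime_primes (Nat.prime_of_mem_primeFactors hp)
      (Nat.prime_of_mem_primeFactors hq)).2 hpq)
  · intro p hp
    exact (Nat.prime_of_mem_primeFactors hp).squarefree

lemma sum_inv_radic_le (R r : ℕ) (hr : r ≠ 0) :
    ∑ n ∈ Icc 1 R with radic n = r, (n : ℝ)⁻¹ ≤ 1 / r.totient := by
  let f : ℕ →* ℝ := ⟨⟨fun m => (m : ℝ)⁻¹, by simp⟩, fun a b => by simp [mul_comm]⟩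
  have hf : ∀ {p : ℕ}, p.Prime → ‖f p‖ < 1 := by
    intro p hp
    have : (1 : ℝ) < p := by exact_mod_cast hp.one_lt
    simp only [f, MonoidHom.coe_mk, OneHom.coe_mk, norm_inv, Real.norm_natCast]
    exact inv_lt_one_of_one_lt₀ this
  have h1 := (EulerProduct.summable_and_hasSum_factoredNumbers_prod_filter_prime_geometric hf
    r.primeFactors).2
  have h2 : ∏ p ∈ r.primeFactors with p.Prime, (1 - f p)⁻¹ = r / r.totient := by
    rw [filter_true_of_mem fun p hp => Nat.prime_of_mem_primeFactors hp, ← prod_one_sub_inv_eq hr]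
    rfl
  rw [h2] at h1
  have h3 := (hasSum_subtype_iff_indicator (f := fun m : ℕ => f m)
    (s := Nat.factoredNumbers r.primeFactors)).1 h1
  have hr0 : (0 : ℝ) < r := by exact_mod_cast Nat.pos_of_ne_zero hr
  calc ∑ n ∈ Icc 1 R with radic n = r, (n : ℝ)⁻¹
      = (r : ℝ)⁻¹ * ∑ n ∈ Icc 1 R with radic n = r, (((n / r : ℕ)) : ℝ)⁻¹ := by
        rw [mul_sum]
        refine sum_congr rfl fun n hn => ?_
        have : r * (n / r) = n := Nat.mul_div_cancel' ((mem_filter.1 hn).2 ▸ radic_dvd n)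
        conv_lhs => rw [← this]
        push_cast; rw [mul_inv]
    _ = (r : ℝ)⁻¹ * ∑ m ∈ ({n ∈ Icc 1 R | radic n = r}).image (fun n => n / r),
          (Nat.factoredNumbers r.primeFactors).indicator (fun m => f m) m := by
        congr 1
        rw [sum_image]
        · refine sum_congr rfl fun n hn => ?_
          rw [mem_filter, mem_Icc] at hn
          rw [Set.indicator_of_mem]
          · rfl
          · have hd : r ∣ n := hn.2 ▸ radic_dvd n
            refine Nat.mem_factoredNumbers_of_primeFactors_subset ?_ ?_
            · exact (Nat.div_pos (Nat.le_of_dvd hn.1.1 hd) (Nat.pos_of_ne_zero hr)).ne'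
            · rw [← hn.2, primeFactors_radic]
              exact Nat.primeFactors_mono (Nat.div_dvd_of_dvd (radic_dvd n)) (by omega)
        · intro a ha b hb hab
          have ha' : r ∣ a := (mem_filter.1 ha).2 ▸ radic_dvd a
          have hb' : r ∣ b := (mem_filter.1 hb).2 ▸ radic_dvd b
          exact (Nat.div_left_inj ha' hb').1 hab
    _ ≤ (r : ℝ)⁻¹ * (r / r.totient) := by
        refine mul_le_mul_of_nonneg_left (sum_le_hasSum _ (fun m _ => ?_) h3) (by positivity)
        refine Set.indicator_nonneg (fun m _ => ?_) m
        simp only [f, MonoidHom.coe_mk, OneHom.coe_mk]; positivity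
    _ = 1 / r.totient := by field_simp

lemma log_add_one_le_selG (R : ℕ) : Real.log (R + 1 : ℕ) ≤ selG R 1 := by
  refine (log_add_one_le_harmonic R).trans ?_
  rw [harmonic_eq_sum_Icc]
  push_cast
  rw [← sum_fiberwise_of_maps_to (t := selSet R 1) (g := radic)]
  · exact sum_le_sum fun r hr => sum_inv_radic_le R r (by have := (mem_selSet.1 hr).1.1; omega)
  · intro n hn
    rw [mem_Icc] at hn
    have h0 : radic n ≠ 0 := (squarefree_radic n).ne_zero
    exact mem_selSet.2 ⟨⟨Nat.pos_of_ne_zero h0, (Nat.le_of_dvd hn.1 (radic_dvd n)).trans hn.2⟩,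
      squarefree_radic n, Nat.coprime_one_right _⟩

lemma log_le_mul_selG (R : ℕ) {W : ℕ} (hW : Squarefree W) :
    Real.log (R + 1 : ℕ) ≤ W / W.totient * selG R W := by
  refine (log_add_one_le_selG R).trans ?_
  have h := selG_le_mul_selG R 1 hW.ne_zero
  rwa [one_mul, sum_divisors_inv_totient hW] at h

lemma le_totient_mul_card_divisors {n : ℕ} : n ≤ n.totient * #n.divisors := by
  rcases Nat.eq_zero_or_pos n with rfl | hn
  · simp
  conv_lhs => rw [← Nat.sum_totient n]
  rw [mul_comm, ← smul_eq_mul]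
  refine sum_le_card_nsmul _ _ _ fun d hd => ?_
  exact Nat.le_of_dvd (Nat.totient_pos.2 hn) (Nat.totient_dvd_of_dvd (Nat.dvd_of_mem_divisors hd))

lemma inv_totient_le {n : ℕ} (hn : 0 < n) : 1 / (n.totient : ℝ) ≤ #n.divisors / n := by
  have h1 : (0 : ℝ) < n.totient := by exact_mod_cast Nat.totient_pos.2 hn
  have h2 : (0 : ℝ) < n := by exact_mod_cast hn
  rw [div_le_div_iff₀ h1 h2, one_mul, mul_comm]
  exact_mod_cast le_totient_mul_card_divisors

lemma sum_Icc_inv_le (R : ℕ) : ∑ n ∈ Icc 1 R, (n : ℝ)⁻¹ ≤ 1 + Real.log R := by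
  have h := harmonic_le_one_add_log R
  rw [harmonic_eq_sum_Icc] at h
  push_cast at h
  exact h

lemma selG_le (R P : ℕ) : selG R P ≤ (1 + Real.log R) ^ 2 := by
  calc selG R P ≤ ∑ n ∈ Icc 1 R, ∑ d ∈ n.divisors, ((d : ℝ)⁻¹ * ((n / d : ℕ) : ℝ)⁻¹) := by
        refine (sum_le_sum_of_subset_of_nonneg (t := Icc 1 R) (filter_subset _ _)
          fun _ _ _ => by positivity).trans (sum_le_sum fun n hn => ?_)
        have hn0 : 0 < n := (mem_Icc.1 hn).1
        refine (inv_totient_le hn0).trans (le_of_eq ?_)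
        rw [div_eq_mul_inv, ← nsmul_eq_mul, ← sum_const]
        refine sum_congr rfl fun d hd => ?_
        rw [← mul_inv, ← Nat.cast_mul, Nat.mul_div_cancel' (Nat.dvd_of_mem_divisors hd)]
    _ = ∑ x ∈ (Icc 1 R).sigma fun n => n.divisors, ((x.2 : ℝ)⁻¹ * ((x.1 / x.2 : ℕ) : ℝ)⁻¹) := by
        rw [sum_sigma]
    _ = ∑ y ∈ ((Icc 1 R).sigma fun n => n.divisors).image
          (fun x : (_ : ℕ) × ℕ => (x.2, x.1 / x.2)), ((y.1 : ℝ)⁻¹ * (y.2 : ℝ)⁻¹) := by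
        rw [sum_image]
        rintro ⟨a, a'⟩ ha ⟨b, b'⟩ hb hab
        simp only [coe_sigma, Set.mem_sigma_iff, mem_coe, Nat.mem_divisors, Prod.mk.injEq] at ha hb hab
        have h1 := Nat.mul_div_cancel' ha.2.1
        have h2 := Nat.mul_div_cancel' hb.2.1
        rw [hab.2, hab.1, h2] at h1
        simp [h1, hab.1]
    _ ≤ ∑ y ∈ Icc 1 R ×ˢ Icc 1 R, ((y.1 : ℝ)⁻¹ * (y.2 : ℝ)⁻¹) := by
        refine sum_le_sum_of_subset_of_nonneg ?_ fun _ _ _ => by positivity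
        intro y hy
        obtain ⟨⟨a, d⟩, hx, rfl⟩ := mem_image.1 hy
        simp only [mem_sigma, mem_Icc, Nat.mem_divisors] at hx
        simp only [mem_product, mem_Icc]
        have h1 := Nat.le_of_dvd hx.1.1 hx.2.1
        have h2 := Nat.pos_of_dvd_of_pos hx.2.1 hx.1.1
        exact ⟨⟨h2, h1.trans hx.1.2⟩, Nat.div_pos h1 h2, (Nat.div_le_self _ _).trans hx.1.2⟩
    _ = (∑ n ∈ Icc 1 R, (n : ℝ)⁻¹) ^ 2 := by
        rw [sq, sum_mul_sum, ← sum_product']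
    _ ≤ _ := pow_le_pow_left₀ (sum_nonneg fun _ _ => by positivity) (sum_Icc_inv_le R) 2

end

section

open Finset

lemma card_divisors_le_of_squarefree {n : ℕ} (hn : Squarefree n) :
    #n.divisors ≤ 2 ^ #n.primeFactors := by
  rw [Nat.card_divisors hn.ne_zero, ← prod_const]
  refine prod_le_prod' fun p _ => ?_
  have := hn.natFactorization_le_one p
  omega

/-- The divisor bound, for squarefree numbers. -/
lemma exists_card_divisors_le {ε : ℝ} (hε : 0 < ε) :
    ∃ C : ℝ, 1 ≤ C ∧ ∀ n : ℕ, Squarefree n → (#n.divisors : ℝ) ≤ C * (n : ℝ) ^ ε := by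
  obtain ⟨P, hP⟩ := exists_nat_ge ((2 : ℝ) ^ (1 / ε))
  refine ⟨2 ^ P, one_le_pow₀ one_le_two, fun n hn => ?_⟩
  have h1 : (#n.divisors : ℝ) ≤ ∏ p ∈ n.primeFactors, (2 : ℝ) := by
    rw [prod_const]; exact_mod_cast card_divisors_le_of_squarefree hn
  refine h1.trans ?_
  have h2 : ∀ p ∈ n.primeFactors, (2 : ℝ) ≤ (if p < P then 2 else 1) * (p : ℝ) ^ ε := by
    intro p hp
    have hp1 : (1 : ℝ) ≤ p := by exact_mod_cast (Nat.prime_of_mem_primeFactors hp).one_le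
    split_ifs with h
    · have := Real.one_le_rpow hp1 hε.le
      linarith
    · have h3 : (2 : ℝ) ^ (1 / ε) ≤ p := hP.trans (by exact_mod_cast not_lt.1 h)
      have h4 := Real.rpow_le_rpow (by positivity) h3 hε.le
      rw [← Real.rpow_mul (by norm_num), one_div_mul_cancel hε.ne', Real.rpow_one] at h4
      linarith
  refine (prod_le_prod (fun _ _ => by norm_num) h2).trans ?_
  rw [prod_mul_distrib, Real.finsetProd_rpow _ _ (fun _ _ => by positivity), ← Nat.cast_prod,
    Nat.prod_primeFactors_of_squarefree hn]
  refine mul_le_mul_of_nonneg_right ?_ (by positivity)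
  rw [prod_ite, prod_const_one, mul_one, prod_const]
  refine pow_le_pow_right₀ one_le_two ?_
  refine (card_le_card (t := range P) fun p hp => ?_).trans (card_range P).le
  exact mem_range.2 (mem_filter.1 hp).2

/-- The Mertens product over the primes up to `z`. -/
noncomputable def mertens (z : ℕ) : ℝ := ∏ p ∈ Icc 1 z with p.Prime, (1 - (p : ℝ)⁻¹)⁻¹

lemma one_le_one_sub_inv_inv {p : ℕ} (hp : 2 ≤ p) : 1 ≤ (1 - (p : ℝ)⁻¹)⁻¹ := by
  have h2 : (2 : ℝ) ≤ p := by exact_mod_cast hp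
  have h3 : (p : ℝ)⁻¹ ≤ 1 / 2 := by rw [inv_eq_one_div]; gcongr
  have h4 : 0 < (p : ℝ)⁻¹ := by positivity
  exact (one_le_inv₀ (by linarith)).2 (by linarith)

lemma mertens_pos (z : ℕ) : 0 < mertens z :=
  prod_pos fun _ hp => lt_of_lt_of_le one_pos (one_le_one_sub_inv_inv (mem_filter.1 hp).2.two_le)

lemma mertens_mono {a b : ℕ} (h : a ≤ b) : mertens a ≤ mertens b := by
  have hs : ({p ∈ Icc 1 a | p.Prime} : Finset ℕ) ⊆ {p ∈ Icc 1 b | p.Prime} :=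
    filter_subset_filter _ (Icc_subset_Icc le_rfl h)
  rw [mertens, mertens, ← prod_sdiff hs]
  refine le_mul_of_one_le_left (mertens_pos a).le ?_
  refine prod_induction _ (fun x : ℝ => 1 ≤ x) (fun _ _ => one_le_mul_of_one_le_of_one_le) le_rfl ?_
  exact fun p hp => one_le_one_sub_inv_inv (mem_filter.1 (Finset.mem_sdiff.1 hp).1).2.two_le

lemma one_sub_inv_inv_le_exp {x : ℝ} (hx : 2 ≤ x) : (1 - x⁻¹)⁻¹ ≤ Real.exp (2 / x) := by
  have h1 : 0 < x⁻¹ := by positivity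
  have h2 : x⁻¹ ≤ 1 / 2 := by rw [inv_eq_one_div]; gcongr
  have h3 := Real.add_one_le_exp (2 / x)
  refine le_trans ?_ h3
  rw [inv_le_iff_one_le_mul₀ (by linarith), div_eq_mul_inv]
  nlinarith

lemma mul_card_primes_le (j : ℕ) :
    j * #{p ∈ Ioc (2 ^ j) (2 ^ (j + 1)) | p.Prime} ≤ 2 ^ (j + 2) := by
  have h1 : (2 ^ j) ^ #{p ∈ Ioc (2 ^ j) (2 ^ (j + 1)) | p.Prime} ≤ 4 ^ (2 ^ (j + 1)) := by
    refine le_trans ?_ (primorial_le_four_pow (2 ^ (j + 1)))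
    refine (pow_card_le_prod _ (fun p => p) _ fun p hp => ?_).trans ?_
    · exact (mem_Ioc.1 (mem_filter.1 hp).1).1.le
    · rw [primorial]
      refine prod_le_prod_of_subset_of_one_le' ?_ fun p hp _ => (mem_filter.1 hp).2.one_le
      intro p hp
      simp only [mem_filter, mem_Ioc, mem_range] at hp ⊢
      exact ⟨by omega, hp.2⟩
  rw [← pow_mul, show 4 = 2 ^ 2 by norm_num, ← pow_mul] at h1
  have h2 := (Nat.pow_le_pow_iff_right (by norm_num : 1 < 2)).1 h1
  have h3 : 2 * 2 ^ (j + 1) = 2 ^ (j + 2) := by ring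
  rwa [h3] at h2

lemma mertens_two_pow_succ_le {j : ℕ} (hj : 1 ≤ j) :
    mertens (2 ^ (j + 1)) ≤ Real.exp (8 / j) * mertens (2 ^ j) := by
  have h0 : ({p ∈ Icc 1 (2 ^ (j + 1)) | p.Prime} : Finset ℕ) =
      {p ∈ Ioc (2 ^ j) (2 ^ (j + 1)) | p.Prime} ∪ {p ∈ Icc 1 (2 ^ j) | p.Prime} := by
    have : 2 ^ j ≤ 2 ^ (j + 1) := Nat.pow_le_pow_right (by norm_num) (by omega)
    ext p
    simp only [mem_filter, mem_Icc, mem_union, mem_Ioc]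
    constructor
    · rintro ⟨⟨h1, h2⟩, h3⟩
      by_cases h : p ≤ 2 ^ j
      · exact Or.inr ⟨⟨h1, h⟩, h3⟩
      · exact Or.inl ⟨⟨by omega, h2⟩, h3⟩
    · rintro (⟨⟨h1, h2⟩, h3⟩ | ⟨⟨h1, h2⟩, h3⟩)
      · exact ⟨⟨by omega, h2⟩, h3⟩
      · exact ⟨⟨h1, by omega⟩, h3⟩
  have hd : Disjoint ({p ∈ Ioc (2 ^ j) (2 ^ (j + 1)) | p.Prime} : Finset ℕ)
      {p ∈ Icc 1 (2 ^ j) | p.Prime} := by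
    rw [disjoint_left]
    intro p h1 h2
    simp only [mem_filter, mem_Ioc, mem_Icc] at h1 h2
    omega
  rw [mertens, h0, prod_union hd]
  refine mul_le_mul_of_nonneg_right ?_ (mertens_pos _).le
  set N := #{p ∈ Ioc (2 ^ j) (2 ^ (j + 1)) | p.Prime} with hN
  have hj0 : (0 : ℝ) < j := by exact_mod_cast hj
  calc ∏ p ∈ ({p ∈ Ioc (2 ^ j) (2 ^ (j + 1)) | p.Prime} : Finset ℕ), (1 - (p : ℝ)⁻¹)⁻¹
      ≤ ∏ p ∈ ({p ∈ Ioc (2 ^ j) (2 ^ (j + 1)) | p.Prime} : Finset ℕ), Real.exp (2 / 2 ^ j) := by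
        refine prod_le_prod (fun p hp => ?_) fun p hp => ?_
        · exact zero_le_one.trans (one_le_one_sub_inv_inv (mem_filter.1 hp).2.two_le)
        · simp only [mem_filter, mem_Ioc] at hp
          refine (one_sub_inv_inv_le_exp (by exact_mod_cast hp.2.two_le)).trans ?_
          rw [Real.exp_le_exp]
          have : ((2 : ℝ) ^ j) ≤ p := by exact_mod_cast hp.1.1.le
          gcongr
    _ = Real.exp (N * (2 / 2 ^ j)) := by rw [prod_const, ← Real.exp_nat_mul]
    _ ≤ Real.exp (8 / j) := by
        rw [Real.exp_le_exp]
        have h1 : (j : ℝ) * N ≤ 2 ^ (j + 2) := by exact_mod_cast mul_card_primes_le j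
        rw [mul_div_assoc', div_le_div_iff₀ (by positivity) hj0]
        rw [pow_add] at h1
        linarith

lemma exists_mertens_le {η : ℝ} (hη : 0 < η) :
    ∃ C : ℝ, 1 ≤ C ∧ ∀ z : ℕ, 1 ≤ z → mertens z ≤ C * (z : ℝ) ^ η := by
  obtain ⟨J, hJ⟩ := exists_nat_ge (max 1 (8 / (η * Real.log 2)))
  have hl2 : 0 < Real.log 2 := Real.log_pos one_lt_two
  have hJ1 : 1 ≤ J := by exact_mod_cast (le_max_left _ _).trans hJ
  have hJ2 : 8 / (η * Real.log 2) ≤ J := (le_max_right _ _).trans hJ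
  have h1 : ∀ j, mertens (2 ^ (J + j)) ≤ mertens (2 ^ J) * ((2 : ℝ) ^ j) ^ η := by
    intro j
    induction j with
    | zero => simp
    | succ j ih =>
      refine (mertens_two_pow_succ_le (j := J + j) (by omega)).trans ?_
      have h2 : Real.exp (8 / (J + j : ℕ)) ≤ (2 : ℝ) ^ η := by
        rw [Real.rpow_def_of_pos two_pos, Real.exp_le_exp]
        have h3 : (0 : ℝ) < J := by exact_mod_cast hJ1
        rw [div_le_iff₀ (by positivity)] at hJ2
        rw [div_le_iff₀ (by push_cast; positivity)]
        push_cast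
        have : 0 ≤ Real.log 2 * η * j := by positivity
        nlinarith
      rw [pow_succ (2 : ℝ) j, Real.mul_rpow (by positivity) (by norm_num)]
      calc _ ≤ (2 : ℝ) ^ η * (mertens (2 ^ J) * ((2 : ℝ) ^ j) ^ η) := by
            have := (mertens_pos (2 ^ (J + j))).le
            gcongr
        _ = _ := by ring
  have hM := mertens_pos (2 ^ J)
  refine ⟨max 1 (mertens (2 ^ J) * 2 ^ η), le_max_left _ _, fun z hz => ?_⟩
  have h3 : z ≤ 2 ^ (J + Nat.clog 2 z) := (Nat.le_pow_clog (by norm_num) z).trans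
    (Nat.pow_le_pow_right (by norm_num) (by omega))
  refine (mertens_mono h3).trans ((h1 _).trans ?_)
  have h4 : ((2 : ℝ) ^ Nat.clog 2 z) ≤ 2 * z := by
    rcases hz.eq_or_lt with rfl | hz
    · simp
    · have h5 := Nat.pow_pred_clog_lt_self (b := 2) (by norm_num) hz
      have h6 : 0 < Nat.clog 2 z := Nat.clog_pos (by norm_num) hz
      obtain ⟨k, hk⟩ := Nat.exists_eq_add_of_lt h6
      rw [hk] at h5 ⊢
      simp only [zero_add, Nat.pred_eq_sub_one, Nat.add_sub_cancel] at h5 ⊢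
      rw [pow_succ]
      have : ((2 : ℝ) ^ k) < z := by exact_mod_cast h5
      linarith
  calc _ ≤ mertens (2 ^ J) * (2 * z : ℝ) ^ η := by gcongr
    _ = mertens (2 ^ J) * 2 ^ η * z ^ η := by
      rw [Real.mul_rpow (by norm_num) (by positivity)]; ring
    _ ≤ _ := by gcongr; exact le_max_right _ _

lemma primorial_div_totient (z : ℕ) :
    (primorial z : ℝ) / (primorial z).totient = mertens z := by
  rw [← prod_one_sub_inv_eq (primorial_pos z).ne', mertens]
  refine prod_congr ?_ fun _ _ => rfl
  rw [primeFactors_primorial]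
  ext p
  simp only [Nat.mem_primesLE, mem_filter, mem_Icc]
  exact ⟨fun h => ⟨⟨h.2.one_le, h.1⟩, h.2⟩, fun h => ⟨h.1.2, h.2⟩⟩

end

section

open Finset

lemma norm_ee_sub_one_ge {γ δ : ℝ} (h : ∀ n : ℤ, δ ≤ |γ - n|) : 4 * δ ≤ ‖ee γ - 1‖ := by
  set t := γ - round γ with ht
  have h1 : ee γ = ee t := by
    have := ee_add_int t (round γ)
    rw [← this, ht, sub_add_cancel]
  have h2 : |t| ≤ 1 / 2 := abs_sub_round γ
  have h3 : ‖ee t - 1‖ = 2 * |Real.sin (Real.pi * t)| := by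
    have := Complex.norm_exp_I_mul_ofReal_sub_one (2 * Real.pi * t)
    rw [ee]
    convert this using 3
    · congr 1; push_cast; ring
    · rw [Real.norm_eq_abs, abs_mul, abs_two]
      congr 3; ring
  have h4 : 2 * |t| ≤ |Real.sin (Real.pi * t)| := by
    have h5 := Real.mul_le_sin (x := Real.pi * |t|) (by positivity) (by nlinarith [Real.pi_pos])
    have h6 : Real.sin (Real.pi * |t|) ≤ |Real.sin (Real.pi * t)| := by
      rcases abs_choice t with h | h <;> rw [h]
      · exact le_abs_self _
      · rw [mul_neg, Real.sin_neg]; exact neg_le_abs _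
    refine le_trans (le_of_eq ?_) (h5.trans h6)
    field_simp
  have h7 := h (round γ)
  rw [h1, h3]
  linarith

/-- The geometric sum bound for additive characters. -/
lemma norm_sum_ee_le {γ δ : ℝ} (hδ : 0 < δ) (h : ∀ n : ℤ, δ ≤ |γ - n|) (K : ℕ) :
    ‖∑ k ∈ range K, ee (k * γ)‖ ≤ 1 / (2 * δ) := by
  have h1 := norm_ee_sub_one_ge h
  have h2 : ee γ ≠ 1 := by
    intro h2; rw [h2, sub_self, norm_zero] at h1; linarith
  simp_rw [ee_nat_mul]
  rw [geom_sum_eq h2, norm_div, div_le_div_iff₀ (by linarith) (by linarith)]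
  have h3 : ‖ee γ ^ K - 1‖ ≤ 2 := by
    refine (norm_sub_le _ _).trans ?_
    rw [norm_pow, norm_ee, one_pow, norm_one]; norm_num
  nlinarith

lemma norm_sum_ee_le_card (s : Finset ℕ) (F : ℕ → ℝ) :
    ‖∑ k ∈ s, ee (F k)‖ ≤ #s := by
  refine (norm_sum_le _ _).trans ?_
  simp [norm_ee]

lemma exists_progression {D W : ℕ} (hD : 0 < D) (h : D.Coprime W) (B Y : ℕ) :
    ∃ y₀ K : ℕ, |(K : ℝ) - Y / D| ≤ 1 ∧ ∀ F : ℕ → ℂ,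
      ∑ y ∈ range Y with D ∣ W * y + B, F y = ∑ k ∈ range K, F (y₀ + D * k) := by
  obtain ⟨y₀, hy₀, hy⟩ : ∃ y₀ < D, ∀ y, D ∣ W * y + B ↔ y % D = y₀ := by
    have : NeZero D := ⟨hD.ne'⟩
    obtain ⟨v, hv⟩ := (ZMod.isUnit_iff_coprime W D).2 h.symm
    refine ⟨(-((v⁻¹ : (ZMod D)ˣ) : ZMod D) * B).val, ZMod.val_lt _, fun y => ?_⟩
    have h1 : y % D = (y : ZMod D).val := (ZMod.val_natCast D y).symm
    rw [h1, (ZMod.val_injective D).eq_iff, ← ZMod.natCast_eq_zero_iff]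
    push_cast
    rw [← hv]
    constructor
    · intro h2
      have h3 := congrArg (fun t => ((v⁻¹ : (ZMod D)ˣ) : ZMod D) * t) h2
      simp only [mul_add, mul_zero, Units.inv_mul_cancel_left] at h3
      linear_combination h3
    · intro h2
      rw [h2]; simp [← mul_assoc]
  refine ⟨y₀, (Y - y₀ + (D - 1)) / D, ?_, fun F => ?_⟩
  · set K := (Y - y₀ + (D - 1)) / D with hK
    have h1 : K * D ≤ Y - y₀ + (D - 1) := Nat.div_mul_le_self _ _
    have h2 : Y - y₀ + (D - 1) < (K + 1) * D := by
      rw [Nat.succ_mul]; exact Nat.lt_div_mul_add hD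
    have hD' : (0 : ℝ) < D := by exact_mod_cast hD
    have h3 : (K : ℝ) * D ≤ Y + D := by
      have : K * D ≤ Y + D := by omega
      exact_mod_cast this
    have h4 : (Y : ℝ) ≤ K * D + D := by
      have h5 : (K + 1) * D = K * D + D := by ring
      have : Y ≤ K * D + D := by omega
      exact_mod_cast this
    have h5 : (Y / D : ℝ) * D = Y := by field_simp
    rw [abs_le]
    constructor <;> nlinarith
  · rw [show ({y ∈ range Y | D ∣ W * y + B} : Finset ℕ) =
      (range ((Y - y₀ + (D - 1)) / D)).image fun k => y₀ + D * k from ?_]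
    · refine sum_image fun a _ b _ hab => ?_
      exact Nat.eq_of_mul_eq_mul_left hD (by simpa using hab)
    ext y
    simp only [mem_filter, mem_range, mem_image, hy]
    have key : ∀ k, k < (Y - y₀ + (D - 1)) / D ↔ y₀ + D * k < Y := by
      intro k
      rw [← Nat.succ_le_iff, Nat.le_div_iff_mul_le hD, Nat.succ_mul, mul_comm D k]
      omega
    constructor
    · rintro ⟨h1, h2⟩
      have h3 := Nat.mod_add_div y D
      rw [h2] at h3
      exact ⟨y / D, (key _).2 (by omega), h3⟩
    · rintro ⟨k, h1, rfl⟩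
      refine ⟨(key _).1 h1, ?_⟩
      rw [Nat.add_mul_mod_self_left, Nat.mod_eq_of_lt hy₀]

/-- Summation by parts against a slowly rotating phase. -/
lemma norm_sum_mul_ee_le {g : ℕ → ℂ} {L : ℕ} {B β : ℝ}
    (h : ∀ Y ≤ L, ‖∑ y ∈ range Y, g y‖ ≤ B) :
    ‖∑ y ∈ range L, g y * ee (y * β)‖ ≤ B * (1 + 2 * Real.pi * |β| * L) := by
  have hB : 0 ≤ B := (norm_nonneg _).trans (h 0 (Nat.zero_le _))
  have key : ∀ n ≤ L, ∑ y ∈ range n, g y * ee (y * β) =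
      (∑ y ∈ range n, g y) * ee (n * β) +
        ∑ k ∈ range n, (∑ y ∈ range (k + 1), g y) * (ee (k * β) - ee ((k + 1 : ℕ) * β)) := by
    intro n _
    induction n with
    | zero => simp
    | succ n ih =>
      rw [sum_range_succ, ih (by omega), sum_range_succ _ n, sum_range_succ _ n]
      rw [sum_range_succ _ n]
      ring
  rw [key L le_rfl]
  have h2 : ∀ k ∈ range L, ‖(∑ y ∈ range (k + 1), g y) * (ee (k * β) - ee ((k + 1 : ℕ) * β))‖
      ≤ B * (2 * Real.pi * |β|) := by
    intro k hk
    rw [norm_mul]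
    refine mul_le_mul (h _ (mem_range.1 hk)) ?_ (norm_nonneg _) hB
    refine (norm_ee_sub_le _ _).trans (le_of_eq ?_)
    rw [show (k : ℝ) * β - (k + 1 : ℕ) * β = -β by push_cast; ring, abs_neg]
  refine (norm_add_le _ _).trans ?_
  have h3 := (norm_sum_le _ _).trans (sum_le_sum h2)
  rw [sum_const, card_range, nsmul_eq_mul] at h3
  have h4 : ‖(∑ y ∈ range L, g y) * ee (L * β)‖ ≤ B := by
    rw [norm_mul, norm_ee, mul_one]; exact h L le_rfl
  linarith

end

section

open Finset

/-- A weighted divisor sum over the moduli up to `V`, along the progression `W * y + B`. -/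
noncomputable def divSum (c : ℕ → ℝ) (V W B y : ℕ) : ℝ :=
  ∑ D ∈ Icc 1 V, if D ∣ W * y + B then c D else 0

lemma sum_divSum_mul (c : ℕ → ℝ) (V W B Y : ℕ) (F : ℕ → ℂ) :
    ∑ y ∈ range Y, (divSum c V W B y : ℂ) * F y =
      ∑ D ∈ Icc 1 V, (c D : ℂ) * ∑ y ∈ range Y with D ∣ W * y + B, F y := by
  simp_rw [divSum, Complex.ofReal_sum, sum_mul]
  rw [sum_comm]
  refine sum_congr rfl fun D _ => ?_
  rw [sum_filter, mul_sum]
  refine sum_congr rfl fun y _ => ?_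
  split_ifs <;> simp

/-- The mean value of `divSum` weighted by a character of exact order `q`. -/
noncomputable def divMean (c : ℕ → ℝ) (V q : ℕ) : ℝ :=
  ∑ D ∈ Icc 1 V, if q ∣ D then c D / D else 0

lemma inv_le_abs_div_sub {q : ℕ} {a : ℤ} (hq : 0 < q) (h : ¬ (q : ℤ) ∣ a) (n : ℤ) :
    (q : ℝ)⁻¹ ≤ |(a : ℝ) / q - n| := by
  have hq' : (0 : ℝ) < q := by exact_mod_cast hq
  have h1 : (a : ℝ) / q - n = ((a - q * n : ℤ) : ℝ) / q := by
    push_cast; field_simp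
  have h2 : a - q * n ≠ 0 := fun h3 => h ⟨n, by linarith⟩
  rw [h1, abs_div, abs_of_pos hq', inv_eq_one_div]
  gcongr
  exact_mod_cast Int.one_le_abs h2

lemma exists_phase (W B q : ℕ) (hq : 0 < q) (a : ℤ) :
    ∃ Φ : ℂ, ‖Φ‖ = 1 ∧ (q = 1 → Φ = 1) ∧ ∀ D y : ℕ, q ∣ D → D.Coprime W → D ∣ W * y + B →
      ee (y * (a / q)) = Φ := by
  have hq' : (q : ℝ) ≠ 0 := by positivity
  by_cases h : ∃ D y : ℕ, q ∣ D ∧ D.Coprime W ∧ D ∣ W * y + B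
  · obtain ⟨D, y₀, h1, h2, h3⟩ := h
    refine ⟨ee (y₀ * (a / q)), norm_ee _, ?_, ?_⟩
    · rintro rfl
      have := ee_int (y₀ * a)
      push_cast at this
      simpa using this
    · intro D' y h4 _ h6
      have h7 : (q : ℤ) ∣ (W : ℤ) * (y - y₀) := by
        have h8 : (q : ℤ) ∣ ((W * y + B : ℕ) : ℤ) := by exact_mod_cast h4.trans h6
        have h9 : (q : ℤ) ∣ ((W * y₀ + B : ℕ) : ℤ) := by exact_mod_cast h1.trans h3
        have := dvd_sub h8 h9
        push_cast at this
        rwa [show (W : ℤ) * (y - y₀) = W * y + B - (W * y₀ + B) by ring]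
      have h8 : IsCoprime (q : ℤ) (W : ℤ) :=
        Nat.isCoprime_iff_coprime.2 (Nat.Coprime.coprime_dvd_left h1 h2)
      obtain ⟨k, hk⟩ := h8.dvd_of_dvd_mul_left h7
      have h9 : (y : ℝ) = y₀ + q * k := by
        have : (y : ℤ) = y₀ + q * k := by linarith
        exact_mod_cast this
      rw [h9, show ((y₀ : ℝ) + q * k) * (a / q) = y₀ * (a / q) + (k * a : ℤ) by
        push_cast; field_simp, ee_add_int]
  · push Not at h
    exact ⟨1, norm_one, fun _ => rfl, fun D y h1 h2 h3 => absurd h3 (h D y h1 h2)⟩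

/-- Partial sums against an additive character of exact order `q`. -/
lemma norm_sum_divSum_sub_le {c : ℕ → ℝ} {V W B : ℕ} {A : ℝ} (hA : ∀ D, |c D| ≤ A)
    (hW : ∀ D, c D ≠ 0 → D.Coprime W) {q : ℕ} (hq : 0 < q) {a : ℤ} (haq : IsCoprime a q) :
    ∃ Φ : ℂ, ‖Φ‖ = 1 ∧ ∀ Y : ℕ, ‖∑ y ∈ range Y,
      (((divSum c V W B y : ℂ) - divMean c V 1) * ee (y * (a / q)) -
        if q = 1 then 0 else (divMean c V q : ℂ) * Φ)‖ ≤ V * A * (1 + q) + |divMean c V 1| * q := by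
  obtain ⟨Φ, hΦ, hΦ1, hΦ2⟩ := exists_phase W B q hq a
  refine ⟨Φ, hΦ, fun Y => ?_⟩
  have hq' : (1 : ℝ) ≤ q := by exact_mod_cast hq
  have hA0 : 0 ≤ A := (abs_nonneg _).trans (hA 0)
  have hD : ∀ D ∈ Icc 1 V, ‖(c D : ℂ) * (∑ y ∈ range Y with D ∣ W * y + B, ee (y * (a / q)) -
      if q ∣ D then (Y : ℂ) / D * Φ else 0)‖ ≤ A * (1 + q) := by
    intro D hD
    have hD0 : 0 < D := (mem_Icc.1 hD).1
    by_cases hc : c D = 0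
    · rw [hc]; simp; positivity
    have hcop := hW D hc
    rw [norm_mul, Complex.norm_real, Real.norm_eq_abs]
    refine mul_le_mul (hA D) ?_ (norm_nonneg _) hA0
    obtain ⟨y₀, K, hK, hF⟩ := exists_progression hD0 hcop B Y
    split_ifs with hqD
    · have h1 : ∑ y ∈ range Y with D ∣ W * y + B, ee (y * (a / q)) = K * Φ := by
        have h2 := hF fun _ => Φ
        simp only [sum_const, card_range, nsmul_eq_mul] at h2
        rw [← h2, ← nsmul_eq_mul, ← sum_const]
        exact sum_congr rfl fun y hy => hΦ2 D y hqD hcop (mem_filter.1 hy).2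
      rw [h1, ← sub_mul, norm_mul, hΦ, mul_one]
      have h3 : (K : ℂ) - Y / D = ((K - Y / D : ℝ) : ℂ) := by push_cast; ring
      rw [h3, Complex.norm_real, Real.norm_eq_abs]
      linarith
    · rw [sub_zero, hF]
      have h1 : ∀ k : ℕ, ee ((y₀ + D * k : ℕ) * (a / q)) =
          ee (y₀ * (a / q)) * ee (k * ((D * a : ℤ) / q)) := by
        intro k; rw [← ee_add]; congr 1; push_cast; ring
      simp_rw [h1]
      rw [← mul_sum, norm_mul, norm_ee, one_mul]
      have h2 : ¬ (q : ℤ) ∣ D * a := by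
        intro h3
        exact hqD (by exact_mod_cast haq.symm.dvd_of_dvd_mul_right h3)
      refine (norm_sum_ee_le (δ := (q : ℝ)⁻¹) (by positivity) (inv_le_abs_div_sub hq h2) K).trans ?_
      rw [div_le_iff₀ (by positivity)]
      field_simp
      linarith
  have hmean : ∀ r, (divMean c V r : ℂ) * (Y * Φ) =
      ∑ D ∈ Icc 1 V, (c D : ℂ) * (if r ∣ D then (Y : ℂ) / D * Φ else 0) := by
    intro r
    rw [divMean, Complex.ofReal_sum, sum_mul]
    refine sum_congr rfl fun D _ => ?_
    split_ifs
    · push_cast; ring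
    · simp
  have hS : ‖∑ y ∈ range Y, (divSum c V W B y : ℂ) * ee (y * (a / q)) -
      divMean c V q * (Y * Φ)‖ ≤ V * A * (1 + q) := by
    rw [sum_divSum_mul, hmean, ← sum_sub_distrib]
    simp_rw [← mul_sub]
    refine (norm_sum_le _ _).trans ((sum_le_sum hD).trans ?_)
    rw [sum_const, Nat.card_Icc, Nat.add_sub_cancel, nsmul_eq_mul, mul_assoc]
  rcases eq_or_ne q 1 with rfl | hq1
  · simp only [if_true, sub_zero]
    rw [hΦ1 rfl, mul_one] at hS
    have h1 : ∀ y : ℕ, ee (y * ((a : ℝ) / (1 : ℕ))) = 1 := by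
      intro y
      have := ee_int (y * a)
      push_cast at this
      simpa using this
    simp_rw [h1, mul_one] at hS ⊢
    rw [sum_sub_distrib, sum_const, card_range, nsmul_eq_mul, mul_comm (Y : ℂ)]
    have : 0 ≤ |divMean c V 1| * ((1 : ℕ) : ℝ) := by positivity
    linarith
  · simp only [if_neg hq1]
    have h1 : ¬ (q : ℤ) ∣ a := by
      intro h2
      have h3 := haq.isUnit_of_dvd' h2 dvd_rfl
      rw [Int.isUnit_iff] at h3
      omega
    have h2 := norm_sum_ee_le (δ := (q : ℝ)⁻¹) (by positivity) (inv_le_abs_div_sub hq h1) Y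
    have h3 : ‖∑ y ∈ range Y, ee (y * ((a : ℝ) / q))‖ ≤ q := by
      refine h2.trans ?_
      rw [div_le_iff₀ (by positivity)]
      field_simp
      linarith
    have h4 : ∑ y ∈ range Y, (((divSum c V W B y : ℂ) - divMean c V 1) * ee (y * (a / q)) -
        (divMean c V q : ℂ) * Φ) = (∑ y ∈ range Y, (divSum c V W B y : ℂ) * ee (y * (a / q)) -
          divMean c V q * (Y * Φ)) - divMean c V 1 * ∑ y ∈ range Y, ee (y * (a / q)) := by
      rw [sum_sub_distrib]
      simp_rw [sub_mul]
      rw [sum_sub_distrib, sum_const, card_range, nsmul_eq_mul, mul_sum]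
      ring
    rw [h4]
    refine (norm_sub_le _ _).trans (add_le_add hS ?_)
    rw [norm_mul, Complex.norm_real, Real.norm_eq_abs]
    gcongr

/-- Major arc estimate for divisor sums. -/
lemma norm_sum_divSum_ee_le_of_major {c : ℕ → ℝ} {V W B : ℕ} {A : ℝ} (hA : ∀ D, |c D| ≤ A)
    (hW : ∀ D, c D ≠ 0 → D.Coprime W) {q : ℕ} (hq : 0 < q) {a : ℤ} (haq : IsCoprime a q)
    (L : ℕ) (β : ℝ) :
    ‖∑ y ∈ range L, (((divSum c V W B y - divMean c V 1 : ℝ)) : ℂ) * ee (y * (a / q + β))‖ ≤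
      (if q = 1 then 0 else |divMean c V q| * L) +
        (V * A * (1 + q) + |divMean c V 1| * q) * (1 + 2 * Real.pi * |β| * L) := by
  obtain ⟨Φ, hΦ, h⟩ := norm_sum_divSum_sub_le (V := V) (B := B) hA hW hq haq
  have h1 := norm_sum_mul_ee_le (L := L) (β := β) fun Y _ => h Y
  set m : ℂ := if q = 1 then 0 else (divMean c V q : ℂ) * Φ with hm
  have h2 : ∑ y ∈ range L, (((divSum c V W B y - divMean c V 1 : ℝ)) : ℂ) * ee (y * (a / q + β)) =
      m * ∑ y ∈ range L, ee (y * β) + ∑ y ∈ range L,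
        (((divSum c V W B y : ℂ) - divMean c V 1) * ee (y * (a / q)) - m) * ee (y * β) := by
    rw [mul_sum, ← sum_add_distrib]
    refine sum_congr rfl fun y _ => ?_
    rw [mul_add, ee_add]; push_cast; ring
  rw [h2]
  refine (norm_add_le _ _).trans (add_le_add ?_ h1)
  rw [norm_mul]
  have h3 := norm_sum_ee_le_card (range L) fun y => y * β
  rw [card_range] at h3
  rw [hm]
  split_ifs
  · simp
  · rw [norm_mul, hΦ, Complex.norm_real, Real.norm_eq_abs, mul_one]
    gcongr

end

section

open Finset

lemma sum_range_succ_inv_le (n : ℕ) : ∑ k ∈ range (n + 1), (k : ℝ)⁻¹ ≤ 1 + Real.log n := by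
  refine le_trans (le_of_eq ?_) (sum_Icc_inv_le n)
  rw [range_eq_Ico, sum_eq_sum_Ico_succ_bot (Nat.succ_pos n)]
  simp only [Nat.cast_zero, inv_zero, zero_add]
  rfl

lemma sum_range_inv_le (n : ℕ) : ∑ k ∈ range n, (k : ℝ)⁻¹ ≤ 1 + Real.log n :=
  (sum_le_sum_of_subset_of_nonneg (range_subset_range.2 (Nat.le_succ n))
    fun _ _ _ => by positivity).trans (sum_range_succ_inv_le n)

/-- A sum over `1 / (2 q)`-spaced points modulo one of quantities controlled by the distance to the
nearest integer. -/
lemma sum_le_of_spaced {s : Finset ℕ} {γ t : ℕ → ℝ} {q : ℕ} {b : ℝ} (hq : 0 < q) (hb : 0 ≤ b)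
    (hs : ∀ i ∈ s, ∀ j ∈ s, i ≠ j → ∀ n : ℤ, (2 * q : ℝ)⁻¹ ≤ |γ i - γ j - n|)
    (htb : ∀ i ∈ s, t i ≤ b)
    (ht : ∀ i ∈ s, ∀ δ > 0, (∀ n : ℤ, δ ≤ |γ i - n|) → t i ≤ 1 / (2 * δ)) :
    ∑ i ∈ s, t i ≤ 2 * b + 2 * q * (1 + Real.log (2 * q)) := by
  have hq' : (0 : ℝ) < q := by exact_mod_cast hq
  set κ : ℕ → ℕ := fun i => ⌊2 * q * Int.fract (γ i)⌋₊ with hκ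
  have hf0 : ∀ i, 0 ≤ 2 * q * Int.fract (γ i) := fun i =>
    mul_nonneg (by positivity) (Int.fract_nonneg _)
  have hκ1 : ∀ i, (κ i : ℝ) ≤ 2 * q * Int.fract (γ i) := fun i => Nat.floor_le (hf0 i)
  have hκ2 : ∀ i, 2 * q * Int.fract (γ i) < κ i + 1 := fun i => Nat.lt_floor_add_one _
  have hκ3 : ∀ i, κ i < 2 * q := by
    intro i
    rw [hκ, Nat.floor_lt (hf0 i)]
    push_cast
    have := Int.fract_lt_one (γ i)
    nlinarith
  have hinj : ∀ i ∈ s, ∀ j ∈ s, κ i = κ j → i = j := by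
    intro i hi j hj hij
    by_contra hne
    have h1 := hs i hi j hj hne (⌊γ i⌋ - ⌊γ j⌋)
    have h2 : γ i - γ j - (⌊γ i⌋ - ⌊γ j⌋ : ℤ) = Int.fract (γ i) - Int.fract (γ j) := by
      push_cast; rw [← Int.self_sub_floor, ← Int.self_sub_floor]; ring
    rw [h2] at h1
    have h3 := hκ1 i; have h4 := hκ2 i; have h5 := hκ1 j; have h6 := hκ2 j
    rw [hij] at h3 h4
    have h7 : |Int.fract (γ i) - Int.fract (γ j)| < (2 * q : ℝ)⁻¹ := by
      rw [inv_eq_one_div, lt_div_iff₀ (by positivity), ← abs_of_pos (show (0 : ℝ) < 2 * q by positivity),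
        ← abs_mul, abs_lt]
      constructor <;> nlinarith
    linarith
  set w : ℕ → ℝ := fun k => (if k = 0 then b else 0) + (if k = 2 * q - 1 then b else 0) +
    q * (k : ℝ)⁻¹ + q * ((2 * q - 1 - k : ℕ) : ℝ)⁻¹ with hw
  have hw0 : ∀ k, 0 ≤ w k := fun k => by
    simp only [hw]; split_ifs <;> positivity
  have htw : ∀ i ∈ s, t i ≤ w (κ i) := by
    intro i hi
    by_cases h : κ i = 0 ∨ κ i = 2 * q - 1
    · refine (htb i hi).trans ?_
      have h1 : 0 ≤ q * (κ i : ℝ)⁻¹ := by positivity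
      have h2 : 0 ≤ q * ((2 * q - 1 - κ i : ℕ) : ℝ)⁻¹ := by positivity
      simp only [hw]
      split_ifs <;> first | linarith | tauto
    · push Not at h
      have h3 := hκ3 i
      obtain ⟨l, hl⟩ : ∃ l, 2 * q = κ i + 1 + l := ⟨2 * q - 1 - κ i, by omega⟩
      have hl' : (2 * q : ℝ) = κ i + 1 + l := by exact_mod_cast hl
      have hk0 : (0 : ℝ) < κ i := by exact_mod_cast Nat.pos_of_ne_zero h.1
      have hl0 : (0 : ℝ) < l := by
        have : 0 < l := by omega
        exact_mod_cast this
      have hmin : 0 < min (κ i : ℝ) l := lt_min hk0 hl0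
      have h4 := ht i hi (min (κ i : ℝ) l / (2 * q)) (by positivity) (by
        intro n
        have h5 : γ i - n = Int.fract (γ i) + (⌊γ i⌋ - n : ℤ) := by
          rw [← Int.self_sub_floor]; push_cast; ring
        have h6 := hκ1 i; have h7 := hκ2 i
        rw [div_le_iff₀ (by positivity), h5]
        have h8 := min_le_left (κ i : ℝ) l
        have h9 := min_le_right (κ i : ℝ) l
        rcases le_or_gt 0 (⌊γ i⌋ - n) with h0 | h0
        · have h10 : (0 : ℝ) ≤ (⌊γ i⌋ - n : ℤ) := by exact_mod_cast h0
          have h11 := le_abs_self (Int.fract (γ i) + (⌊γ i⌋ - n : ℤ))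
          nlinarith
        · have h10 : ((⌊γ i⌋ - n : ℤ) : ℝ) ≤ -1 := by exact_mod_cast Int.le_sub_one_of_lt h0
          have h11 := neg_le_abs (Int.fract (γ i) + (⌊γ i⌋ - n : ℤ))
          nlinarith)
      have h5 : 1 / (2 * (min (κ i : ℝ) l / (2 * q))) = q * (min (κ i : ℝ) l)⁻¹ := by
        field_simp
      have h6 : 2 * q - 1 - κ i = l := by omega
      rw [h5] at h4
      refine h4.trans ?_
      simp only [hw]
      rw [if_neg h.1, if_neg h.2, h6]
      have h7 : 0 < (κ i : ℝ)⁻¹ := by positivity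
      have h8 : 0 < (l : ℝ)⁻¹ := by positivity
      rcases min_choice (κ i : ℝ) l with h9 | h9 <;> rw [h9] <;> nlinarith
  calc ∑ i ∈ s, t i ≤ ∑ i ∈ s, w (κ i) := sum_le_sum htw
    _ = ∑ k ∈ s.image κ, w k := (sum_image fun i hi j hj => hinj i hi j hj).symm
    _ ≤ ∑ k ∈ range (2 * q), w k := by
        refine sum_le_sum_of_subset_of_nonneg ?_ fun k _ _ => hw0 k
        intro k hk
        obtain ⟨i, -, rfl⟩ := mem_image.1 hk
        exact mem_range.2 (hκ3 i)
    _ ≤ _ := by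
        simp only [hw]
        rw [sum_add_distrib, sum_add_distrib, sum_add_distrib, ← mul_sum, ← mul_sum,
          sum_range_reflect (fun k : ℕ => (k : ℝ)⁻¹)]
        have h1 := sum_range_inv_le (2 * q)
        push_cast at h1
        rw [sum_ite_eq' (range (2 * q)), sum_ite_eq' (range (2 * q)), if_pos (mem_range.2 (by omega)),
          if_pos (mem_range.2 (by omega))]
        nlinarith

lemma inv_two_mul_le_abs_mul_sub {q : ℕ} (hq : 0 < q) {a : ℤ} (haq : IsCoprime a q) {β : ℝ}
    (hβ : |β| ≤ 1 / (q : ℝ) ^ 2) {k : ℤ} (hk : k ≠ 0) (hkq : 2 * |k| ≤ q) (n : ℤ) :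
    (2 * q : ℝ)⁻¹ ≤ |k * (a / q + β) - n| := by
  have hq' : (0 : ℝ) < q := by exact_mod_cast hq
  have h1 : ¬ (q : ℤ) ∣ k * a := by
    intro h
    have h2 := Int.le_of_dvd (abs_pos.2 hk) ((dvd_abs _ _).2 (haq.symm.dvd_of_dvd_mul_right h))
    have h3 := abs_pos.2 hk
    omega
  have h2 := inv_le_abs_div_sub hq h1 n
  have h3 : |(k : ℝ)| ≤ q / 2 := by
    have : (2 : ℝ) * |(k : ℝ)| ≤ q := by exact_mod_cast hkq
    linarith
  have h4 : |k * β| ≤ (2 * q : ℝ)⁻¹ := by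
    rw [abs_mul]
    calc |(k : ℝ)| * |β| ≤ q / 2 * (1 / (q : ℝ) ^ 2) := by gcongr
      _ = _ := by field_simp
  have h5 : (k : ℝ) * (a / q + β) - n = (((k * a : ℤ) : ℝ) / q - n) + k * β := by
    push_cast; ring
  have h6 := abs_add_le (((k * a : ℤ) : ℝ) / q - n + k * β) (-(k * β))
  rw [add_neg_cancel_right, abs_neg, ← h5] at h6
  have h7 : (q : ℝ)⁻¹ = 2 * (2 * q : ℝ)⁻¹ := by field_simp
  linarith

end

section

open Finset

lemma norm_sum_ee_dvd_le_div {D W B L : ℕ} (hD : 0 < D) (h : D.Coprime W) (α : ℝ) :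
    ‖∑ y ∈ range L with D ∣ W * y + B, ee (y * α)‖ ≤ L / D + 1 := by
  obtain ⟨y₀, K, hK, hF⟩ := exists_progression hD h B L
  rw [hF]
  have h1 := norm_sum_ee_le_card (range K) fun k => ((y₀ + D * k : ℕ) : ℝ) * α
  rw [card_range] at h1
  linarith [(abs_le.1 hK).2]

lemma norm_sum_ee_dvd_le_inv {D W B L : ℕ} (hD : 0 < D) (h : D.Coprime W) {α δ : ℝ} (hδ : 0 < δ)
    (hα : ∀ n : ℤ, δ ≤ |D * α - n|) :
    ‖∑ y ∈ range L with D ∣ W * y + B, ee (y * α)‖ ≤ 1 / (2 * δ) := by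
  obtain ⟨y₀, K, -, hF⟩ := exists_progression hD h B L
  rw [hF]
  have h1 : ∀ k : ℕ, ee ((y₀ + D * k : ℕ) * α) = ee (y₀ * α) * ee (k * (D * α)) := by
    intro k; rw [← ee_add]; congr 1; push_cast; ring
  simp_rw [h1]
  rw [← mul_sum, norm_mul, norm_ee, one_mul]
  exact norm_sum_ee_le hδ hα K

lemma sum_norm_sum_ee_dvd_le {V W B L q : ℕ} (hq : 2 ≤ q) {a : ℤ} (haq : IsCoprime a q) {β : ℝ}
    (hβ : |β| ≤ 1 / (q : ℝ) ^ 2) :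
    ∑ D ∈ Icc 1 V with D.Coprime W,
      ‖∑ y ∈ range L with D ∣ W * y + B, ee (y * ((a : ℝ) / q + β))‖ ≤
      9 * (L / q + V + q) * (1 + Real.log (2 * q) + Real.log V) := by
  have hq2 : (2 : ℝ) ≤ q := by exact_mod_cast hq
  have hq' : (0 : ℝ) < q := by linarith
  set H := q / 2 with hH
  have hH0 : 0 < H := by omega
  have hH3 : q ≤ 3 * H := by omega
  have hH0' : (0 : ℝ) < H := by exact_mod_cast hH0
  have hH3' : (q : ℝ) ≤ 3 * H := by exact_mod_cast hH3
  set α := (a : ℝ) / q + β with hα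
  set t : ℕ → ℝ := fun D => ‖∑ y ∈ range L with D ∣ W * y + B, ee (y * α)‖ with ht
  set s := {D ∈ Icc 1 V | D.Coprime W} with hs
  set J := V / H with hJ
  have hJV : J ≤ V := Nat.div_le_self _ _
  have hmaps : ∀ D ∈ s, D / H ∈ range (J + 1) := by
    intro D hD
    rw [hs, mem_filter, mem_Icc] at hD
    exact mem_range.2 (Nat.lt_succ_of_le (Nat.div_le_div_right hD.1.2))
  rw [← sum_fiberwise_of_maps_to hmaps]
  have hspace : ∀ j, ∀ D ∈ ({D ∈ s | D / H = j} : Finset ℕ), ∀ D' ∈ ({D ∈ s | D / H = j} : Finset ℕ),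
      D ≠ D' → ∀ n : ℤ, (2 * q : ℝ)⁻¹ ≤ |D * α - D' * α - n| := by
    intro j D hD D' hD' hne n
    have h1 := (Nat.div_eq_iff hH0).1 (mem_filter.1 hD).2
    have h2 := (Nat.div_eq_iff hH0).1 (mem_filter.1 hD').2
    have h3 : 2 * |(D : ℤ) - D'| ≤ q := by
      have : |(D : ℤ) - D'| ≤ H := by rw [abs_le]; constructor <;> omega
      omega
    have h4 := inv_two_mul_le_abs_mul_sub (by omega) haq hβ (k := (D : ℤ) - D') (by omega) h3 n
    push_cast at h4
    rwa [sub_mul] at h4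
  have hlog : 0 ≤ Real.log (2 * q) := Real.log_nonneg (by linarith)
  have hlogV : 0 ≤ Real.log V := Real.log_natCast_nonneg V
  set Λ := 1 + Real.log (2 * q) with hΛ
  have hdist : ∀ D ∈ s, ∀ δ > 0, (∀ n : ℤ, δ ≤ |D * α - n|) → t D ≤ 1 / (2 * δ) := by
    intro D hD δ hδ h
    rw [hs, mem_filter, mem_Icc] at hD
    exact norm_sum_ee_dvd_le_inv hD.1.1 hD.2 hδ h
  have hblock : ∀ j ∈ range (J + 1), ∑ D ∈ s with D / H = j, t D ≤
      2 * ((if j = 0 then (q : ℝ) else 0) + (L / H * (j : ℝ)⁻¹ + 1)) + 2 * q * Λ := by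
    intro j _
    refine sum_le_of_spaced (γ := fun D => D * α) (by omega) (by positivity) (hspace j) ?_
      fun D hD => hdist D (mem_filter.1 hD).1
    intro D hD
    have hDs := (mem_filter.1 hD).1
    have hDj := (Nat.div_eq_iff hH0).1 (mem_filter.1 hD).2
    have hD0 := hDs
    rw [hs, mem_filter, mem_Icc] at hD0
    split_ifs with hj
    · subst hj
      have h1 : (2 : ℤ) * |(D : ℤ)| ≤ q := by rw [Nat.abs_cast]; omega
      have h2 := inv_two_mul_le_abs_mul_sub (by omega) haq hβ (k := (D : ℤ)) (by omega) h1
      simp only [Int.cast_natCast] at h2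
      refine (hdist D hDs (2 * q : ℝ)⁻¹ (by positivity) h2).trans ?_
      have : 1 / (2 * (2 * q : ℝ)⁻¹) = q := by field_simp
      rw [this]
      simp
    · rw [zero_add]
      refine (norm_sum_ee_dvd_le_div hD0.1.1 hD0.2 α).trans ?_
      have hj0 : (0 : ℝ) < j := by exact_mod_cast Nat.pos_of_ne_zero hj
      have h1 : (j : ℝ) * H ≤ D := by exact_mod_cast hDj.1
      rw [← div_eq_mul_inv, div_div, mul_comm (H : ℝ)]
      gcongr
  refine (sum_le_sum hblock).trans ?_
  rw [sum_add_distrib, ← mul_sum, sum_add_distrib, sum_add_distrib, ← mul_sum, sum_const, sum_const,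
    card_range, sum_ite_eq', if_pos (mem_range.2 (Nat.succ_pos _)), nsmul_eq_mul, nsmul_eq_mul]
  have h1 : ∑ j ∈ range (J + 1), (j : ℝ)⁻¹ ≤ 1 + Real.log V := by
    refine (sum_range_succ_inv_le J).trans ?_
    rcases Nat.eq_zero_or_pos J with h | h
    · rw [h, Nat.cast_zero, Real.log_zero]; linarith
    · have : Real.log J ≤ Real.log V :=
        Real.log_le_log (by exact_mod_cast h) (by exact_mod_cast hJV)
      linarith
  have hLH : (L : ℝ) / H ≤ 3 * (L / q) := by
    rw [mul_div_assoc', div_le_div_iff₀ hH0' hq']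
    have : (0 : ℝ) ≤ L := Nat.cast_nonneg L
    nlinarith
  have hJq : (J : ℝ) * q ≤ 3 * V := by
    have h2 : (J : ℝ) * H ≤ V := by exact_mod_cast Nat.div_mul_le_self V H
    have : (0 : ℝ) ≤ J := Nat.cast_nonneg J
    nlinarith
  have hJV' : (J : ℝ) ≤ V := by exact_mod_cast hJV
  set Γ := 1 + Real.log (2 * q) + Real.log V with hΓ
  have hLq : (0 : ℝ) ≤ L / q := by positivity
  have hV0 : (0 : ℝ) ≤ V := Nat.cast_nonneg V
  have e1 : (L : ℝ) / H * ∑ j ∈ range (J + 1), (j : ℝ)⁻¹ ≤ 3 * (L / q) * Γ := by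
    refine mul_le_mul hLH (h1.trans (by linarith)) (sum_nonneg fun _ _ => by positivity)
      (by positivity)
  have e2 : ((J + 1 : ℕ) : ℝ) * (2 * q * Λ) ≤ (6 * V + 2 * q) * Γ := by
    have : ((J + 1 : ℕ) : ℝ) * (2 * q * Λ) = (2 * (J * q) + 2 * q) * Λ := by push_cast; ring
    rw [this]
    have hΛ0 : 0 ≤ Λ := by linarith
    refine mul_le_mul (by linarith) (by linarith) hΛ0 (by positivity)
  have e3 : (2 * q + 2 * (V + 1) : ℝ) ≤ (3 * q + 2 * V) * Γ := by
    have : 1 ≤ Γ := by linarith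
    nlinarith
  have e4 : (9 * (L / q + V + q) * Γ : ℝ) = 6 * (L / q) * Γ + (6 * V + 2 * q) * Γ +
      (3 * q + 2 * V) * Γ + (3 * (L / q) + V + 4 * q) * Γ := by ring
  have e5 : 0 ≤ (3 * (L / q) + V + 4 * q : ℝ) * Γ :=
    mul_nonneg (by positivity) (by linarith)
  rw [e4]
  push_cast at e2 ⊢
  linarith

/-- Minor arc estimate for divisor sums. -/
lemma norm_sum_divSum_ee_le_of_minor {c : ℕ → ℝ} {V W B L : ℕ} {A : ℝ} (hA : ∀ D, |c D| ≤ A)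
    (hW : ∀ D, c D ≠ 0 → D.Coprime W) {q : ℕ} (hq : 2 ≤ q) {a : ℤ} (haq : IsCoprime a q) {β : ℝ}
    (hβ : |β| ≤ 1 / (q : ℝ) ^ 2) :
    ‖∑ y ∈ range L, (((divSum c V W B y - divMean c V 1 : ℝ)) : ℂ) * ee (y * (a / q + β))‖ ≤
      A * (9 * (L / q + V + q) * (1 + Real.log (2 * q) + Real.log V)) + |divMean c V 1| * q := by
  have hA0 : 0 ≤ A := (abs_nonneg _).trans (hA 0)
  have h1 : ∑ y ∈ range L, (((divSum c V W B y - divMean c V 1 : ℝ)) : ℂ) * ee (y * (a / q + β)) =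
      ∑ y ∈ range L, (divSum c V W B y : ℂ) * ee (y * (a / q + β)) -
        divMean c V 1 * ∑ y ∈ range L, ee (y * (a / q + β)) := by
    rw [mul_sum, ← sum_sub_distrib]
    refine sum_congr rfl fun y _ => ?_
    push_cast; ring
  rw [h1]
  refine (norm_sub_le _ _).trans (add_le_add ?_ ?_)
  · refine le_trans ?_ (mul_le_mul_of_nonneg_left
      (sum_norm_sum_ee_dvd_le (V := V) (W := W) (B := B) (L := L) hq haq hβ) hA0)
    rw [sum_divSum_mul, mul_sum, sum_filter]
    refine (norm_sum_le _ _).trans (sum_le_sum fun D _ => ?_)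
    rw [norm_mul, Complex.norm_real, Real.norm_eq_abs]
    split_ifs with h
    · exact mul_le_mul_of_nonneg_right (hA D) (norm_nonneg _)
    · rw [not_imp_comm.1 (hW D) h, abs_zero, zero_mul]
  · rw [norm_mul, Complex.norm_real, Real.norm_eq_abs]
    refine mul_le_mul_of_nonneg_left ?_ (abs_nonneg _)
    have h2 := inv_two_mul_le_abs_mul_sub (by omega) haq hβ one_ne_zero
      (by rw [abs_one]; exact_mod_cast hq)
    simp only [Int.cast_one, one_mul] at h2
    refine (norm_sum_ee_le (δ := (2 * q : ℝ)⁻¹) (by positivity) h2 L).trans (le_of_eq ?_)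
    field_simp

end

section

open Finset ArithmeticFunction ArithmeticFunction.Moebius

/-- The sieve coefficients underlying `selH`. -/
noncomputable def selLam (R P d : ℕ) : ℝ := lam (selSet R P) (fun r => μ r / r.totient) d

lemma one_add_log_le {ε : ℝ} (hε : 0 < ε) {R : ℕ} (hR : 1 ≤ R) :
    1 + Real.log R ≤ (1 + 1 / ε) * (R : ℝ) ^ ε := by
  have h1 := Real.log_le_rpow_div (Nat.cast_nonneg R) hε
  have h2 : (1 : ℝ) ≤ (R : ℝ) ^ ε := Real.one_le_rpow (by exact_mod_cast hR) hε.le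
  calc 1 + Real.log R ≤ (R : ℝ) ^ ε + (R : ℝ) ^ ε / ε := by linarith
    _ = _ := by ring

lemma exists_abs_selLam_le {ε : ℝ} (hε : 0 < ε) :
    ∃ C : ℝ, 1 ≤ C ∧ ∀ R P d : ℕ, 1 ≤ R → |selLam R P d| ≤ C * (R : ℝ) ^ ε := by
  obtain ⟨C, hC, h⟩ := exists_card_divisors_le (half_pos hε)
  have hC2 : 1 ≤ 1 + 1 / (ε / 2) := by
    have : 0 ≤ 1 / (ε / 2) := by positivity
    linarith
  refine ⟨C * (1 + 1 / (ε / 2)), one_le_mul_of_one_le_of_one_le hC hC2, fun R P d hR => ?_⟩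
  have hR0 : (0 : ℝ) < R := by exact_mod_cast hR
  rcases Nat.eq_zero_or_pos d with rfl | hd
  · rw [selLam, lam]; simp; positivity
  have hd' : (0 : ℝ) < d := by exact_mod_cast hd
  have h1 : ∀ r ∈ selSet R P, |(μ r / r.totient : ℝ) * μ (r / d)| ≤
      C * (R : ℝ) ^ (ε / 2) * (r : ℝ)⁻¹ := by
    intro r hr
    rw [mem_selSet] at hr
    have hr0 : 0 < r := hr.1.1
    have hr' : (0 : ℝ) < r := by exact_mod_cast hr0
    have hm : ∀ k, |(μ k : ℝ)| ≤ 1 := fun k => by exact_mod_cast abs_moebius_le_one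
    rw [abs_mul, abs_div, Nat.abs_cast]
    calc |(μ r : ℝ)| / r.totient * |(μ (r / d) : ℝ)| ≤ 1 / r.totient * 1 := by
          gcongr <;> exact hm _
      _ ≤ #r.divisors / r := by rw [mul_one]; exact inv_totient_le hr0
      _ ≤ C * (R : ℝ) ^ (ε / 2) / r := by
          have h2 : (r : ℝ) ^ (ε / 2) ≤ (R : ℝ) ^ (ε / 2) :=
            Real.rpow_le_rpow hr'.le (by exact_mod_cast hr.1.2) (by positivity)
          have := h r hr.2.1
          gcongr
          exact this.trans (by gcongr)
      _ = _ := by rw [div_eq_mul_inv]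
  have h2 : ∑ r ∈ selSet R P with d ∣ r, (r : ℝ)⁻¹ ≤ (d : ℝ)⁻¹ * (1 + Real.log R) := by
    have h3 : ∑ r ∈ selSet R P with d ∣ r, (r : ℝ)⁻¹ ≤
        ∑ r ∈ (Icc 1 R).image fun k => d * k, (r : ℝ)⁻¹ := by
      refine sum_le_sum_of_subset_of_nonneg ?_ fun _ _ _ => by positivity
      intro r hr
      rw [mem_filter, mem_selSet] at hr
      obtain ⟨k, rfl⟩ := hr.2
      have h4 : 0 < k := Nat.pos_of_mul_pos_left hr.1.1.1
      exact mem_image.2 ⟨k, mem_Icc.2 ⟨h4, (Nat.le_mul_of_pos_left k hd).trans hr.1.1.2⟩, rfl⟩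
    refine h3.trans ?_
    rw [sum_image fun a _ b _ hab => Nat.eq_of_mul_eq_mul_left hd hab]
    simp_rw [Nat.cast_mul, mul_inv]
    rw [← mul_sum]
    gcongr
    exact sum_Icc_inv_le R
  rw [selLam, lam, abs_mul, Nat.abs_cast]
  calc (d : ℝ) * |∑ r ∈ selSet R P with d ∣ r, (μ r / r.totient : ℝ) * μ (r / d)|
      ≤ d * ∑ r ∈ selSet R P with d ∣ r, C * (R : ℝ) ^ (ε / 2) * (r : ℝ)⁻¹ := by
        gcongr
        exact (abs_sum_le_sum_abs _ _).trans (sum_le_sum fun r hr => h1 r (mem_filter.1 hr).1)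
    _ ≤ d * (C * (R : ℝ) ^ (ε / 2) * ((d : ℝ)⁻¹ * (1 + Real.log R))) := by
        rw [← mul_sum]
        gcongr
    _ = C * (R : ℝ) ^ (ε / 2) * (1 + Real.log R) := by field_simp
    _ ≤ C * (R : ℝ) ^ (ε / 2) * ((1 + 1 / (ε / 2)) * (R : ℝ) ^ (ε / 2)) := by
        gcongr; exact one_add_log_le (half_pos hε) hR
    _ = C * (1 + 1 / (ε / 2)) * ((R : ℝ) ^ (ε / 2) * (R : ℝ) ^ (ε / 2)) := by ring
    _ = _ := by rw [← Real.rpow_add hR0, add_halves]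

/-- The coefficients of the square of the Selberg weight as a divisor sum. -/
noncomputable def selCoeff (R P D : ℕ) : ℝ :=
  ∑ x ∈ selSet R P ×ˢ selSet R P with x.1.lcm x.2 = D, selLam R P x.1 * selLam R P x.2

lemma lcm_mem_Icc {R P : ℕ} {x : ℕ × ℕ} (hx : x ∈ selSet R P ×ˢ selSet R P) :
    x.1.lcm x.2 ∈ Icc 1 (R ^ 2) := by
  rw [mem_product, mem_selSet, mem_selSet] at hx
  refine mem_Icc.2 ⟨Nat.lcm_pos hx.1.1.1 hx.2.1.1, ?_⟩
  refine (Nat.le_of_dvd (Nat.mul_pos hx.1.1.1 hx.2.1.1) (Nat.lcm_dvd_mul _ _)).trans ?_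
  rw [sq]
  exact Nat.mul_le_mul hx.1.1.2 hx.2.1.2

lemma sum_selCoeff_mul (R P : ℕ) (F : ℕ → ℝ) :
    ∑ D ∈ Icc 1 (R ^ 2), selCoeff R P D * F D =
      ∑ d ∈ selSet R P, ∑ e ∈ selSet R P, selLam R P d * selLam R P e * F (d.lcm e) := by
  rw [← sum_product', ← sum_fiberwise_of_maps_to fun x => lcm_mem_Icc]
  refine sum_congr rfl fun D _ => ?_
  rw [selCoeff, sum_mul]
  refine sum_congr rfl fun x hx => ?_
  rw [(mem_filter.1 hx).2]

lemma selH_sq_eq_divSum (R P W B y : ℕ) :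
    selH R P (W * y + B) ^ 2 = divSum (selCoeff R P) (R ^ 2) W B y := by
  have h := sum_selCoeff_mul R P fun D => if D ∣ W * y + B then 1 else 0
  simp only [mul_ite, mul_one, mul_zero] at h
  rw [divSum, h, selH, lamSum_sq]
  rfl

lemma divMean_selCoeff (R P q : ℕ) : divMean (selCoeff R P) (R ^ 2) q =
    ∑ d ∈ selSet R P, ∑ e ∈ selSet R P, if q ∣ d.lcm e then
      selLam R P d * selLam R P e / d.lcm e else 0 := by
  have h := sum_selCoeff_mul R P fun D => if q ∣ D then (D : ℝ)⁻¹ else 0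
  simp only [mul_ite, mul_zero, ← div_eq_mul_inv] at h
  exact h

lemma divMean_selCoeff_one (R P : ℕ) : divMean (selCoeff R P) (R ^ 2) 1 = selG R P := by
  rw [divMean_selCoeff, ← sum_lam_selSet R P]
  simp only [one_dvd, if_true]
  rfl

lemma abs_divMean_selCoeff_le {R P z q : ℕ} (hz : 1 ≤ z)
    (hP : ∀ p : ℕ, p.Prime → p ≤ z → p ∣ P) (hq : 1 < q) :
    |divMean (selCoeff R P) (R ^ 2) q| ≤ 3 * selG R P / √z := by
  rw [divMean_selCoeff]
  exact abs_sum_lam_selSet_le hz hP hq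

lemma coprime_of_selCoeff_ne_zero {R P D : ℕ} (h : selCoeff R P D ≠ 0) : D.Coprime P := by
  obtain ⟨x, hx, -⟩ := exists_ne_zero_of_sum_ne_zero h
  rw [mem_filter, mem_product, mem_selSet, mem_selSet] at hx
  rw [← hx.2]
  exact Nat.Coprime.coprime_dvd_left (Nat.lcm_dvd_mul _ _)
    (Nat.Coprime.mul_left hx.1.1.2.2 hx.1.2.2.2)

lemma squarefree_lcm {d e : ℕ} (hd : Squarefree d) (he : Squarefree e) : Squarefree (d.lcm e) := by
  rw [Nat.squarefree_iff_factorization_le_one (Nat.lcm_ne_zero hd.ne_zero he.ne_zero)]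
  intro p
  rw [Nat.factorization_lcm hd.ne_zero he.ne_zero]
  exact sup_le (hd.natFactorization_le_one p) (he.natFactorization_le_one p)

lemma exists_abs_selCoeff_le {ε : ℝ} (hε : 0 < ε) :
    ∃ C : ℝ, 1 ≤ C ∧ ∀ R P D : ℕ, 1 ≤ R → |selCoeff R P D| ≤ C * (R : ℝ) ^ ε := by
  obtain ⟨C₁, hC₁, h₁⟩ := exists_card_divisors_le (show 0 < ε / 8 by positivity)
  obtain ⟨C₂, hC₂, h₂⟩ := exists_abs_selLam_le (show 0 < ε / 4 by positivity)
  refine ⟨C₁ ^ 2 * C₂ ^ 2, one_le_mul_of_one_le_of_one_le (one_le_pow₀ hC₁) (one_le_pow₀ hC₂),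
    fun R P D hR => ?_⟩
  have hR0 : (0 : ℝ) < R := by exact_mod_cast hR
  rw [selCoeff]
  set s := {x ∈ selSet R P ×ˢ selSet R P | x.1.lcm x.2 = D} with hs
  rcases s.eq_empty_or_nonempty with h0 | ⟨x₀, hx₀⟩
  · rw [h0]; simp; positivity
  have hx₁ := mem_filter.1 hx₀
  have hsq : Squarefree D := by
    have h3 := mem_product.1 hx₁.1
    rw [← hx₁.2]
    exact squarefree_lcm (mem_selSet.1 h3.1).2.1 (mem_selSet.1 h3.2).2.1
  have hDR : D ≤ R ^ 2 := by
    rw [← hx₁.2]; exact (mem_Icc.1 (lcm_mem_Icc hx₁.1)).2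
  have hcard : #s ≤ #D.divisors ^ 2 := by
    rw [sq, ← card_product]
    refine card_le_card fun x hx => ?_
    have h3 := (mem_filter.1 hx).2
    rw [mem_product, Nat.mem_divisors, Nat.mem_divisors, ← h3]
    have h4 : x.1.lcm x.2 ≠ 0 := by rw [h3]; exact hsq.ne_zero
    exact ⟨⟨Nat.dvd_lcm_left _ _, h4⟩, ⟨Nat.dvd_lcm_right _ _, h4⟩⟩
  have hdiv : (#D.divisors : ℝ) ≤ C₁ * (R : ℝ) ^ (ε / 4) := by
    refine (h₁ D hsq).trans ?_
    have h3 : (D : ℝ) ≤ (R : ℝ) ^ (2 : ℝ) := by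
      rw [Real.rpow_two]; exact_mod_cast hDR
    have h4 := Real.rpow_le_rpow (Nat.cast_nonneg D) h3 (show 0 ≤ ε / 8 by positivity)
    rw [← Real.rpow_mul hR0.le, show 2 * (ε / 8) = ε / 4 by ring] at h4
    gcongr
  calc |∑ x ∈ s, selLam R P x.1 * selLam R P x.2|
      ≤ ∑ x ∈ s, (C₂ * (R : ℝ) ^ (ε / 4)) ^ 2 := by
        refine (abs_sum_le_sum_abs _ _).trans (sum_le_sum fun x _ => ?_)
        rw [abs_mul, sq]
        exact mul_le_mul (h₂ R P _ hR) (h₂ R P _ hR) (abs_nonneg _) (by positivity)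
    _ = #s * (C₂ * (R : ℝ) ^ (ε / 4)) ^ 2 := by rw [sum_const, nsmul_eq_mul]
    _ ≤ (C₁ * (R : ℝ) ^ (ε / 4)) ^ 2 * (C₂ * (R : ℝ) ^ (ε / 4)) ^ 2 := by
        have h3 : (#s : ℝ) ≤ (#D.divisors : ℝ) ^ 2 := by exact_mod_cast hcard
        have h4 := pow_le_pow_left₀ (Nat.cast_nonneg _) hdiv 2
        gcongr
        exact h3.trans h4
    _ = C₁ ^ 2 * C₂ ^ 2 * ((R : ℝ) ^ (ε / 4)) ^ 4 := by ring
    _ = _ := by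
        have h3 : ((R : ℝ) ^ (ε / 4)) ^ 4 = (R : ℝ) ^ ε := by
          rw [← Real.rpow_natCast, ← Real.rpow_mul hR0.le]; norm_num
        rw [h3]

end

section

open Finset

set_option maxHeartbeats 1000000 in
/-- The normalised Selberg weight has no Fourier correlations beyond the first sieved prime. -/
theorem exists_norm_sum_selH_sq_sub_one_le : ∃ C : ℝ, 1 ≤ C ∧ ∀ L R W B P z : ℕ, 1 ≤ L → 1 ≤ R →
    (R : ℝ) ^ 2 ≤ (L : ℝ) ^ (0.9994 : ℝ) → 1 ≤ z → W ∣ P →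
    (∀ p : ℕ, p.Prime → p ≤ z → p ∣ P) → ∀ α : ℝ,
    ‖∑ y ∈ range L, ((selH R P (W * y + B) ^ 2 / selG R P - 1 : ℝ) : ℂ) * ee (y * α)‖ ≤
      L * (3 / √z + C * (L : ℝ) ^ (-(0.00005 : ℝ))) := by
  obtain ⟨C₁, hC₁, hcoeff⟩ := exists_abs_selCoeff_le (show (0 : ℝ) < 0.000025 by norm_num)
  refine ⟨24 * C₁ + 27 * C₁ * (2 * (1 + 1 / 0.000025)) + 1, by
    have : (0 : ℝ) < 27 * C₁ * (2 * (1 + 1 / 0.000025)) := by positivity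
    linarith, fun L R W B P z hL hR hRL hz hWP hP α => ?_⟩
  set l : ℝ := (L : ℝ) with hl
  have hl1 : 1 ≤ l := by rw [hl]; exact_mod_cast hL
  have hl0 : 0 < l := by linarith
  have hmono : ∀ {a b : ℝ}, a ≤ b → l ^ a ≤ l ^ b := fun h =>
    Real.rpow_le_rpow_of_exponent_le hl1 h
  have hone : ∀ {a : ℝ}, 0 ≤ a → 1 ≤ l ^ a := fun h => Real.one_le_rpow hl1 h
  set G := selG R P with hG
  have hG1 : 1 ≤ G := one_le_selG hR
  set V := R ^ 2 with hV
  have hVl : (V : ℝ) ≤ l ^ (0.9994 : ℝ) := by rw [hV]; push_cast; exact hRL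
  have hR1 : (1 : ℝ) ≤ R := by exact_mod_cast hR
  have hV1 : (1 : ℝ) ≤ V := by rw [hV]; push_cast; exact one_le_pow₀ hR1
  have hVl1 : (V : ℝ) ≤ l := hVl.trans ((hmono (by norm_num)).trans (Real.rpow_one l).le)
  have hRl : (R : ℝ) ≤ l := by
    refine le_trans ?_ hVl1
    rw [hV]; push_cast; nlinarith
  set A := C₁ * l ^ (0.000025 : ℝ) with hA
  have hA1 : 1 ≤ A := one_le_mul_of_one_le_of_one_le hC₁ (hone (by norm_num))
  have hcA : ∀ D, |selCoeff R P D| ≤ A := fun D => by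
    refine (hcoeff R P D hR).trans ?_
    rw [hA]
    gcongr
  have hcW : ∀ D, selCoeff R P D ≠ 0 → D.Coprime W := fun D h =>
    Nat.Coprime.coprime_dvd_right hWP (coprime_of_selCoeff_ne_zero h)
  set N := ⌊l ^ (0.9999 : ℝ)⌋₊ with hN
  have hN0 : 0 < N := Nat.floor_pos.2 (hone (by norm_num))
  have hNl : (N : ℝ) ≤ l ^ (0.9999 : ℝ) := Nat.floor_le (by positivity)
  have hNl' : l ^ (0.9999 : ℝ) ≤ N + 1 := (Nat.lt_floor_add_one _).le
  obtain ⟨x, hx1, hx2⟩ := Real.exists_rat_abs_sub_le_and_den_le α hN0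
  set q := x.den with hq
  have hq0 : 0 < q := x.den_pos
  have haq : IsCoprime x.num (q : ℤ) := by
    rw [Int.isCoprime_iff_nat_coprime]; exact x.reduced
  obtain ⟨β, hβ⟩ : ∃ β : ℝ, α = (x.num : ℝ) / q + β := ⟨α - x.num / q, by ring⟩
  have hβ1 : |β| ≤ 1 / ((N + 1) * q) := by
    rw [Rat.cast_def, hβ, add_sub_cancel_left] at hx1
    exact hx1
  have hq1 : (1 : ℝ) ≤ q := by exact_mod_cast hq0
  have hqN : (q : ℝ) ≤ N := by exact_mod_cast hx2
  have hsum : ‖∑ y ∈ range L, ((selH R P (W * y + B) ^ 2 / G - 1 : ℝ) : ℂ) * ee (y * α)‖ * G =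
      ‖∑ y ∈ range L, ((divSum (selCoeff R P) V W B y - divMean (selCoeff R P) V 1 : ℝ) : ℂ) *
        ee (y * (x.num / q + β))‖ := by
    rw [divMean_selCoeff_one, ← hβ]
    have h1 : ‖(G : ℂ)‖ = G := by
      rw [Complex.norm_real, Real.norm_eq_abs, abs_of_nonneg (by linarith)]
    rw [← hG, show ∀ t : ℝ, t * G = t * ‖(G : ℂ)‖ by rw [h1]; exact fun _ => rfl, ← norm_mul,
      mul_comm, mul_sum]
    congr 1
    refine sum_congr rfl fun y _ => ?_
    rw [selH_sq_eq_divSum, ← mul_assoc, ← Complex.ofReal_mul, ← hV]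
    congr 2
    field_simp
  have hG0 : 0 < G := by linarith
  have hz0 : 0 ≤ 3 / √(z : ℝ) := by positivity
  suffices h : ‖∑ y ∈ range L, ((divSum (selCoeff R P) V W B y - divMean (selCoeff R P) V 1 : ℝ) : ℂ) *
      ee (y * (x.num / q + β))‖ ≤ l * (3 / √z + (24 * C₁ + 27 * C₁ * (2 * (1 + 1 / 0.000025)) + 1) *
        l ^ (-(0.00005 : ℝ))) * G by
    rw [← hsum] at h
    exact le_of_mul_le_mul_right h hG0
  have hll : l * l ^ (-(0.00005 : ℝ)) = l ^ (0.99995 : ℝ) := by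
    nth_rewrite 1 [← Real.rpow_one l]
    rw [← Real.rpow_add hl0]; norm_num
  rw [mul_add, mul_left_comm l, hll]
  rcases le_or_gt (q : ℝ) (l ^ (0.0001 : ℝ)) with hql | hql
  · refine (norm_sum_divSum_ee_le_of_major hcA hcW hq0 haq L β).trans ?_
    rw [divMean_selCoeff_one, ← hG, abs_of_pos hG0]
    have h1 : (if q = 1 then 0 else |divMean (selCoeff R P) V q| * L) ≤ l * (3 / √z) * G := by
      split_ifs with h
      · positivity
      · have h2 := abs_divMean_selCoeff_le hz hP (q := q) (R := R) (by omega)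
        calc _ ≤ 3 * G / √z * L := by gcongr
          _ = _ := by ring
    have h2 : |β| * L ≤ l ^ (0.0001 : ℝ) := by
      have h3 : l ^ (0.9999 : ℝ) * l ^ (0.0001 : ℝ) = l := by
        rw [← Real.rpow_add hl0]; norm_num
      have h4 : |β| ≤ 1 / l ^ (0.9999 : ℝ) := by
        refine hβ1.trans ?_
        gcongr
        nlinarith
      calc |β| * L ≤ 1 / l ^ (0.9999 : ℝ) * l := by gcongr
        _ = l ^ (0.0001 : ℝ) := by
          nth_rewrite 2 [← h3]; field_simp
    have h3 : 1 + 2 * Real.pi * |β| * L ≤ 8 * l ^ (0.0001 : ℝ) := by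
      have h4 : 1 ≤ l ^ (0.0001 : ℝ) := hone (by norm_num)
      have h5 := Real.pi_lt_d2
      have h6 : 0 ≤ |β| * L := by positivity
      nlinarith [Real.pi_pos]
    have h4 : V * A * (1 + q) + G * q ≤ 3 * C₁ * l ^ (0.999525 : ℝ) * G := by
      have h5 : (V : ℝ) * A * (1 + q) ≤ l ^ (0.9994 : ℝ) * (C₁ * l ^ (0.000025 : ℝ)) *
          (2 * l ^ (0.0001 : ℝ)) := by
        have h7 : (1 + q : ℝ) ≤ 2 * l ^ (0.0001 : ℝ) := by linarith
        gcongr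
      have h6 : l ^ (0.9994 : ℝ) * (C₁ * l ^ (0.000025 : ℝ)) * (2 * l ^ (0.0001 : ℝ)) =
          2 * C₁ * l ^ (0.999525 : ℝ) := by
        rw [show (0.999525 : ℝ) = 0.9994 + 0.000025 + 0.0001 by norm_num, Real.rpow_add hl0,
          Real.rpow_add hl0]
        ring
      have h7 : (q : ℝ) ≤ C₁ * l ^ (0.999525 : ℝ) := by
        refine hql.trans ((hmono (b := 0.999525) (by norm_num)).trans ?_)
        exact le_mul_of_one_le_left (by positivity) hC₁
      have h8 : 2 * C₁ * l ^ (0.999525 : ℝ) ≤ 2 * C₁ * l ^ (0.999525 : ℝ) * G :=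
        le_mul_of_one_le_right (by positivity) hG1
      have h9 := mul_le_mul_of_nonneg_left h7 hG0.le
      linarith
    have h5 : (V * A * (1 + q) + G * q) * (1 + 2 * Real.pi * |β| * L) ≤
        24 * C₁ * l ^ (0.99995 : ℝ) * G := by
      calc _ ≤ 3 * C₁ * l ^ (0.999525 : ℝ) * G * (8 * l ^ (0.0001 : ℝ)) := by gcongr
        _ = 24 * C₁ * l ^ (0.999625 : ℝ) * G := by
          rw [show (0.999625 : ℝ) = 0.999525 + 0.0001 by norm_num, Real.rpow_add hl0]; ring
        _ ≤ _ := by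
          have := hmono (a := 0.999625) (b := 0.99995) (by norm_num)
          gcongr
    have h6 : 0 ≤ (27 * C₁ * (2 * (1 + 1 / 0.000025)) + 1) * l ^ (0.99995 : ℝ) * G := by positivity
    linarith
  · have hq2 : 2 ≤ q := by
      have : (1 : ℝ) < q := lt_of_le_of_lt (hone (by norm_num)) hql
      exact_mod_cast this
    have hβ2 : |β| ≤ 1 / (q : ℝ) ^ 2 := by
      refine hβ1.trans ?_
      rw [sq]
      gcongr
      linarith
    refine (norm_sum_divSum_ee_le_of_minor hcA hcW hq2 haq hβ2).trans ?_
    rw [divMean_selCoeff_one, ← hG, abs_of_pos hG0]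
    have hql' : (q : ℝ) ≤ l ^ (0.9999 : ℝ) := hqN.trans hNl
    have h1 : (L : ℝ) / q + V + q ≤ 3 * l ^ (0.9999 : ℝ) := by
      have h2 : (L : ℝ) / q ≤ l ^ (0.9999 : ℝ) := by
        rw [div_le_iff₀ (by linarith)]
        calc l = l ^ (0.9999 : ℝ) * l ^ (0.0001 : ℝ) := by rw [← Real.rpow_add hl0]; norm_num
          _ ≤ _ := by gcongr
      have h3 := hVl.trans (hmono (a := 0.9994) (b := 0.9999) (by norm_num))
      linarith
    have h2 : 1 + Real.log (2 * q) + Real.log V ≤ 2 * (1 + 1 / 0.000025) * l ^ (0.000025 : ℝ) := by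
      have h3 := one_add_log_le (show (0 : ℝ) < 0.000025 by norm_num) hL
      have h4 : Real.log V ≤ Real.log l := Real.log_le_log (by linarith) hVl1
      have h5 : Real.log q ≤ Real.log l := by
        refine Real.log_le_log (by linarith) (hql'.trans ?_)
        exact (hmono (by norm_num)).trans (Real.rpow_one l).le
      have h6 : Real.log 2 ≤ 1 := by linarith [Real.log_two_lt_d9]
      rw [Real.log_mul (by norm_num) (by linarith)]
      rw [← hl] at h3
      linarith
    have h3 : A * (9 * (L / q + V + q) * (1 + Real.log (2 * q) + Real.log V)) ≤
        27 * C₁ * (2 * (1 + 1 / 0.000025)) * l ^ (0.99995 : ℝ) := by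
      have h4 : 0 ≤ 1 + Real.log (2 * q) + Real.log V := by
        have h5 := Real.log_nonneg hV1
        have h6 := Real.log_nonneg (show (1 : ℝ) ≤ 2 * q by linarith)
        linarith
      calc _ ≤ C₁ * l ^ (0.000025 : ℝ) * (9 * (3 * l ^ (0.9999 : ℝ)) *
            (2 * (1 + 1 / 0.000025) * l ^ (0.000025 : ℝ))) := by
            rw [hA]; gcongr
        _ = _ := by
          rw [show (0.99995 : ℝ) = 0.000025 + 0.9999 + 0.000025 by norm_num, Real.rpow_add hl0,
            Real.rpow_add hl0]
          ring
    have h4 : (q : ℝ) ≤ l ^ (0.99995 : ℝ) := hql'.trans (hmono (by norm_num))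
    have h5 : 0 ≤ l ^ (0.99995 : ℝ) := by positivity
    have h6 : 27 * C₁ * (2 * (1 + 1 / 0.000025)) * l ^ (0.99995 : ℝ) ≤
        27 * C₁ * (2 * (1 + 1 / 0.000025)) * l ^ (0.99995 : ℝ) * G :=
      le_mul_of_one_le_right (by positivity) hG1
    have h7 : 0 ≤ l * (3 / √z) * G := by positivity
    have h8 : 0 ≤ 24 * C₁ * l ^ (0.99995 : ℝ) * G := by positivity
    have h9 : G * q ≤ l ^ (0.99995 : ℝ) * G := by
      rw [mul_comm]; gcongr
    linarith

end

section

open Finset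

lemma exists_norm_one_mul_eq (z : ℂ) : ∃ c : ℂ, ‖c‖ = 1 ∧ c * z = ‖z‖ := by
  rcases eq_or_ne z 0 with rfl | hz
  · exact ⟨1, by simp, by simp⟩
  · have h : (‖z‖ : ℂ) ≠ 0 := by simpa using hz
    refine ⟨(starRingEnd ℂ) z / ‖z‖, ?_, ?_⟩
    · rw [norm_div, Complex.norm_conj, Complex.norm_real, norm_norm, div_self (by simpa using hz)]
    · rw [div_mul_eq_mul_div, mul_comm, Complex.mul_conj, div_eq_iff h, Complex.normSq_eq_norm_sq]
      push_cast; ring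

/-- The large values estimate for a function with a pseudorandom majorant. -/
lemma sq_card_mul_le {L M : ℕ} (hM : 0 < M) (hLM : L ≤ M) {F N : ℕ → ℝ} {ρ E δ : ℝ}
    (hδ : 0 ≤ δ) (hρ : 0 ≤ ρ)
    (hF : ∀ y < L, 0 ≤ F y) (hFN : ∀ y < L, F y ≤ ρ * N y)
    (hE : ∀ α : ℝ, ‖∑ y ∈ range L, ((N y - 1 : ℝ) : ℂ) * ee (y * α)‖ ≤ E * L)
    {Λ : Finset ℕ} (hΛM : Λ ⊆ range M)
    (hΛ : ∀ r ∈ Λ, δ * L ≤ ‖∑ y ∈ range L, (F y : ℂ) * ee (y * (r / M))‖) :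
    (#Λ * (δ * L)) ^ 2 ≤ (∑ y ∈ range L, F y) * (ρ * (M * #Λ + #Λ ^ 2 * (E * L))) := by
  choose c hc1 hc2 using fun r : ℕ =>
    exists_norm_one_mul_eq (∑ y ∈ range L, (F y : ℂ) * ee (y * (r / M)))
  set g : ℕ → ℂ := fun y => ∑ r ∈ Λ, c r * ee (r * (y / M)) with hg
  have h1 : (#Λ : ℝ) * (δ * L) ≤ ∑ y ∈ range L, F y * ‖g y‖ := by
    calc (#Λ : ℝ) * (δ * L) = ∑ r ∈ Λ, δ * L := by rw [sum_const, nsmul_eq_mul]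
      _ ≤ ∑ r ∈ Λ, ‖∑ y ∈ range L, (F y : ℂ) * ee (y * (r / M))‖ := sum_le_sum hΛ
      _ = ‖∑ r ∈ Λ, c r * ∑ y ∈ range L, (F y : ℂ) * ee (y * (r / M))‖ := by
          simp_rw [hc2]
          rw [← Complex.ofReal_sum, Complex.norm_real, Real.norm_eq_abs,
            abs_of_nonneg (sum_nonneg fun _ _ => norm_nonneg _)]
      _ = ‖∑ y ∈ range L, (F y : ℂ) * g y‖ := by
          congr 1
          simp_rw [hg, mul_sum]
          rw [sum_comm]
          refine sum_congr rfl fun y _ => sum_congr rfl fun r _ => ?_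
          rw [show (y : ℝ) * (r / M) = r * (y / M) by ring]; ring
      _ ≤ _ := by
          refine (norm_sum_le _ _).trans (sum_le_sum fun y hy => ?_)
          rw [norm_mul, Complex.norm_real, Real.norm_eq_abs, abs_of_nonneg (hF y (mem_range.1 hy))]
  have h2 : (∑ y ∈ range L, F y * ‖g y‖) ^ 2 ≤
      (∑ y ∈ range L, F y) * ∑ y ∈ range L, F y * ‖g y‖ ^ 2 := by
    refine sum_sq_le_sum_mul_sum_of_sq_le_mul _ (fun y hy => hF y (mem_range.1 hy))
      (fun y hy => mul_nonneg (hF y (mem_range.1 hy)) (sq_nonneg _)) fun y _ => le_of_eq (by ring)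
  have h3 : ∑ y ∈ range L, ‖g y‖ ^ 2 ≤ M * #Λ := by
    have h4 := parseval_ee hM (Λ.map Nat.castEmbedding) (fun a : ℤ => c a.toNat) (by
      intro a ha b hb hab
      obtain ⟨r, hr, rfl⟩ := mem_map.1 ha
      obtain ⟨r', hr', rfl⟩ := mem_map.1 hb
      have h5 := mem_range.1 (hΛM hr)
      have h6 := mem_range.1 (hΛM hr')
      rw [Nat.castEmbedding_apply, Nat.castEmbedding_apply] at hab ⊢
      have h7 := Int.eq_zero_of_abs_lt_dvd hab (abs_lt.2 ⟨by omega, by omega⟩)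
      omega)
    simp only [sum_map, Nat.castEmbedding_apply, Int.cast_natCast, Int.toNat_natCast, hc1] at h4
    rw [sum_const, nsmul_eq_mul, one_pow, mul_one] at h4
    rw [← h4]
    exact sum_le_sum_of_subset_of_nonneg (range_subset_range.2 hLM) fun _ _ _ => sq_nonneg _
  have h4 : ∑ y ∈ range L, (N y - 1) * ‖g y‖ ^ 2 ≤ #Λ ^ 2 * (E * L) := by
    have h5 : ((∑ y ∈ range L, (N y - 1) * ‖g y‖ ^ 2 : ℝ) : ℂ) = ∑ r ∈ Λ, ∑ r' ∈ Λ,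
        c r * (starRingEnd ℂ) (c r') * ∑ y ∈ range L, ((N y - 1 : ℝ) : ℂ) * ee (y * ((r - r') / M)) := by
      have h6 : ∀ y : ℕ, ((‖g y‖ ^ 2 : ℝ) : ℂ) = ∑ r ∈ Λ, ∑ r' ∈ Λ,
          c r * (starRingEnd ℂ) (c r') * ee (y * ((r - r') / M)) := by
        intro y
        rw [← Complex.normSq_eq_norm_sq, ← Complex.mul_conj, hg, map_sum, sum_mul_sum]
        refine sum_congr rfl fun r _ => sum_congr rfl fun r' _ => ?_
        rw [map_mul, ← ee_neg, mul_mul_mul_comm, ← ee_add]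
        congr 2; ring
      rw [Complex.ofReal_sum]
      simp_rw [Complex.ofReal_mul, h6, mul_sum]
      rw [sum_comm]
      refine sum_congr rfl fun r _ => ?_
      rw [sum_comm]
      refine sum_congr rfl fun r' _ => sum_congr rfl fun y _ => ?_
      ring
    refine (le_abs_self _).trans ?_
    rw [← Real.norm_eq_abs, ← Complex.norm_real, h5]
    have h6 : ∀ r ∈ Λ, ∀ r' ∈ Λ, ‖c r * (starRingEnd ℂ) (c r') *
        ∑ y ∈ range L, ((N y - 1 : ℝ) : ℂ) * ee (y * ((r - r') / M))‖ ≤ E * L := by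
      intro r _ r' _
      rw [norm_mul, norm_mul, Complex.norm_conj, hc1, hc1, one_mul, one_mul]
      exact hE _
    refine (norm_sum_le _ _).trans ((sum_le_sum fun r hr =>
      (norm_sum_le _ _).trans (sum_le_sum (h6 r hr))).trans (le_of_eq ?_))
    simp only [sum_const, nsmul_eq_mul]; ring
  have h5 : ∑ y ∈ range L, F y * ‖g y‖ ^ 2 ≤ ρ * (M * #Λ + #Λ ^ 2 * (E * L)) := by
    calc ∑ y ∈ range L, F y * ‖g y‖ ^ 2 ≤ ∑ y ∈ range L, ρ * N y * ‖g y‖ ^ 2 :=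
          sum_le_sum fun y hy => mul_le_mul_of_nonneg_right (hFN y (mem_range.1 hy)) (sq_nonneg _)
      _ = ρ * (∑ y ∈ range L, ‖g y‖ ^ 2 + ∑ y ∈ range L, (N y - 1) * ‖g y‖ ^ 2) := by
          rw [← sum_add_distrib, mul_sum]
          refine sum_congr rfl fun y _ => by ring
      _ ≤ _ := by gcongr
  calc ((#Λ : ℝ) * (δ * L)) ^ 2 ≤ (∑ y ∈ range L, F y * ‖g y‖) ^ 2 := by gcongr
    _ ≤ _ := h2
    _ ≤ _ := by
      have : 0 ≤ ∑ y ∈ range L, F y := sum_nonneg fun y hy => hF y (mem_range.1 hy)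
      gcongr

end

section

open Finset

/-- The weight of `y`: a constant multiple of the indicator function of `W * y + B` being prime. -/
noncomputable def primeWt (R W B y : ℕ) : ℝ := if (W * y + B).Prime then selG R W else 0

lemma primeWt_nonneg (R W B y : ℕ) : 0 ≤ primeWt R W B y := by
  rw [primeWt]; split_ifs
  exacts [selG_nonneg R W, le_rfl]

lemma primeWt_le {R W B : ℕ} (hR : 1 ≤ R) (hRB : R < B) {P : ℕ} (hP : Squarefree P) (y : ℕ) :
    primeWt R W B y ≤
      P / P.totient * (selH R (W * P) (W * y + B) ^ 2 / selG R (W * P)) := by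
  have h0 : 0 < selG R (W * P) := one_pos.trans_le (one_le_selG hR)
  rw [primeWt]
  split_ifs with h
  · rw [selH_of_prime hR h (by omega), sq, mul_div_cancel_right₀ _ h0.ne',
      ← sum_divisors_inv_totient hP]
    exact selG_le_mul_selG R W hP.ne_zero
  · positivity

lemma card_mul_sq_le {L M : ℕ} (hM : 0 < M) (hLM : L ≤ M) {F : ℕ → ℝ} {δ : ℝ}
    (hδ : 0 ≤ δ) {Λ : Finset ℕ} (hΛM : Λ ⊆ range M)
    (hΛ : ∀ r ∈ Λ, δ * L ≤ ‖∑ y ∈ range L, (F y : ℂ) * ee (y * (r / M))‖) :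
    #Λ * (δ * L) ^ 2 ≤ M * ∑ y ∈ range L, F y ^ 2 := by
  have h4 := parseval_ee hM ((range L).map Nat.castEmbedding) (fun a : ℤ => (F a.toNat : ℂ)) (by
    intro a ha b hb hab
    obtain ⟨r, hr, rfl⟩ := mem_map.1 ha
    obtain ⟨r', hr', rfl⟩ := mem_map.1 hb
    have h5 := mem_range.1 hr
    have h6 := mem_range.1 hr'
    rw [Nat.castEmbedding_apply, Nat.castEmbedding_apply] at hab ⊢
    have h7 := Int.eq_zero_of_abs_lt_dvd hab (abs_lt.2 ⟨by omega, by omega⟩)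
    omega)
  simp only [sum_map, Nat.castEmbedding_apply, Int.cast_natCast, Int.toNat_natCast,
    Complex.norm_real, Real.norm_eq_abs, sq_abs] at h4
  rw [← h4, ← nsmul_eq_mul, ← sum_const]
  exact (sum_le_sum fun r hr => pow_le_pow_left₀ (by positivity) (hΛ r hr) 2).trans
    (sum_le_sum_of_subset_of_nonneg hΛM fun _ _ _ => sq_nonneg _)

set_option maxHeartbeats 1000000 in
lemma exists_card_largeValues_le : ∃ C : ℝ, 1 ≤ C ∧ ∀ L R W B : ℕ, 1 ≤ L → 1 ≤ R →
    (R : ℝ) ^ 2 ≤ (L : ℝ) ^ (0.9994 : ℝ) → R < B → ∑ y ∈ range L, primeWt R W B y ≤ 2 * L →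
    ∀ s : ℝ, 0 < s → s ≤ 2 → ∀ Λ ⊆ range (4 * L),
      (∀ r ∈ Λ, s ^ 2 * L ≤ ‖∑ y ∈ range L, (primeWt R W B y : ℂ) * ee (y * (r / (4 * L : ℕ)))‖) →
      #Λ * s ^ 5 ≤ C := by
  obtain ⟨C₀, hC₀, hmert⟩ := exists_mertens_le (show (0 : ℝ) < 1 / 10 by norm_num)
  obtain ⟨C₁, hC₁, hmaj⟩ := exists_norm_sum_selH_sq_sub_one_le
  obtain ⟨a, ha⟩ : ∃ a, a = 24 * C₀ := ⟨_, rfl⟩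
  obtain ⟨C₂, hC₂⟩ : ∃ C₂, C₂ = 16 * a * C₀ * C₁ := ⟨_, rfl⟩
  have ha1 : 24 ≤ a := by linarith
  have hC₂1 : 1 ≤ C₂ := by
    rw [hC₂]
    have := one_le_mul_of_one_le_of_one_le (show 1 ≤ 16 * a by linarith) hC₀
    exact one_le_mul_of_one_le_of_one_le this hC₁
  obtain ⟨D, hD⟩ : ∃ D : ℝ, D = 1 + 1 / 0.000005 := ⟨_, rfl⟩
  have hD1 : 1 ≤ D := by rw [hD]; norm_num
  refine ⟨32 * a * C₀ + 8 * D ^ 2 * C₂, by nlinarith [sq_nonneg D], ?_⟩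
  intro L R W B hL hR hRL hRB hsum s hs hs2 Λ hΛM hΛ
  have hL1 : (1 : ℝ) ≤ L := by exact_mod_cast hL
  have hL0 : (0 : ℝ) < L := by linarith
  rcases le_or_gt (C₂ * (L : ℝ) ^ (-(0.00005 : ℝ))) (s ^ 5) with hbig | hsmall
  · have hA : (#Λ : ℝ) * s ^ 5 ≤ 32 * a * C₀ := by
      rcases Nat.eq_zero_or_pos #Λ with h0 | hpos
      · rw [h0]; simp; nlinarith
      have hn : (0 : ℝ) < #Λ := by exact_mod_cast hpos
      obtain ⟨z, hz⟩ : ∃ z, z = ⌈(a / s) ^ 10⌉₊ := ⟨_, rfl⟩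
      have has : 1 ≤ a / s := by rw [le_div_iff₀ hs]; linarith
      have hz1 : (a / s) ^ 10 ≤ z := hz ▸ Nat.le_ceil _
      have hz2 : (z : ℝ) ≤ (2 * a / s) ^ 10 := by
        have h1 := (Nat.ceil_lt_add_one (show 0 ≤ (a / s) ^ 10 by positivity)).le
        have h2 := one_le_pow₀ has (n := 10)
        rw [← hz] at h1
        rw [mul_div_assoc, mul_pow]
        nlinarith
      have hz1' : (1 : ℝ) ≤ z := (one_le_pow₀ has).trans hz1
      have hzN : 1 ≤ z := by exact_mod_cast hz1'
      have hρ : mertens z ≤ 2 * a * C₀ / s := by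
        refine (hmert z hzN).trans ?_
        have h3 : (z : ℝ) ^ (1 / 10 : ℝ) ≤ 2 * a / s := by
          refine (Real.rpow_le_rpow (by positivity) hz2 (by norm_num)).trans (le_of_eq ?_)
          rw [← Real.rpow_natCast, ← Real.rpow_mul (by positivity)]
          norm_num
        calc C₀ * (z : ℝ) ^ (1 / 10 : ℝ) ≤ C₀ * (2 * a / s) := by gcongr
          _ = _ := by ring
      have hρ0 := mertens_pos z
      have hsq : (a / s) ^ 5 ≤ √(z : ℝ) := by
        apply Real.le_sqrt_of_sq_le
        rw [← pow_mul]; exact hz1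
      have hmaj' := hmaj L R W B (W * primorial z) z hL hR hRL hzN (dvd_mul_right _ _)
        fun p hp hpz => (hp.dvd_primorial_iff.2 hpz).mul_left _
      have key := sq_card_mul_le (L := L) (M := 4 * L) (F := primeWt R W B)
        (N := fun y => selH R (W * primorial z) (W * y + B) ^ 2 / selG R (W * primorial z))
        (ρ := mertens z) (E := 3 / √(z : ℝ) + C₁ * (L : ℝ) ^ (-(0.00005 : ℝ))) (δ := s ^ 2)
        (Λ := Λ) (by omega) (by omega) (by positivity) hρ0.le
        (fun y _ => primeWt_nonneg _ _ _ _) (fun y _ => by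
          rw [← primorial_div_totient]
          exact primeWt_le hR hRB (squarefree_primorial z) y)
        (fun α => (hmaj' α).trans_eq (mul_comm _ _)) hΛM hΛ
      obtain ⟨E, hE⟩ : ∃ E, E = 3 / √(z : ℝ) + C₁ * (L : ℝ) ^ (-(0.00005 : ℝ)) := ⟨_, rfl⟩
      rw [← hE] at key
      have hE0 : 0 ≤ E := by rw [hE]; positivity
      have hρE : 2 * (mertens z * E) ≤ s ^ 4 / 2 := by
        have h1 : mertens z * (3 / √(z : ℝ)) ≤ s ^ 4 / 8 := by
          calc mertens z * (3 / √(z : ℝ)) ≤ 2 * a * C₀ / s * (3 / (a / s) ^ 5) := by gcongr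
            _ = 6 * C₀ * s ^ 4 / a ^ 4 := by field_simp; ring
            _ ≤ s ^ 4 / 8 := by
              rw [div_le_div_iff₀ (by positivity) (by norm_num)]
              have : 48 * C₀ ≤ a ^ 4 := by 
                have h24 : a * 24 ^ 3 ≤ a * a ^ 3 := by gcongr
                linarith [pow_succ' a 3]
              nlinarith [pow_pos hs 4]
        have h2 : mertens z * (C₁ * (L : ℝ) ^ (-(0.00005 : ℝ))) ≤ s ^ 4 / 8 := by
          calc mertens z * (C₁ * (L : ℝ) ^ (-(0.00005 : ℝ)))
              ≤ 2 * a * C₀ / s * (C₁ * (L : ℝ) ^ (-(0.00005 : ℝ))) := by gcongr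
            _ = C₂ * (L : ℝ) ^ (-(0.00005 : ℝ)) / (8 * s) := by rw [hC₂]; field_simp; ring
            _ ≤ s ^ 5 / (8 * s) := by gcongr
            _ = s ^ 4 / 8 := by field_simp
        rw [hE, mul_add]; linarith
      have h1 : (#Λ : ℝ) ^ 2 * s ^ 4 * L ^ 2 ≤
          (8 * mertens z * #Λ + #Λ ^ 2 * (s ^ 4 / 2)) * L ^ 2 := by
        calc (#Λ : ℝ) ^ 2 * s ^ 4 * L ^ 2 = (#Λ * (s ^ 2 * L)) ^ 2 := by ring
          _ ≤ _ := key
          _ ≤ 2 * L * (mertens z * ((4 * L : ℕ) * #Λ + #Λ ^ 2 * (E * L))) := by gcongr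
          _ = (8 * mertens z * #Λ + #Λ ^ 2 * (2 * (mertens z * E))) * L ^ 2 := by
            push_cast; ring
          _ ≤ _ := by gcongr
      have h2 := le_of_mul_le_mul_right h1 (by positivity)
      have h3 : (#Λ : ℝ) * s ^ 4 ≤ 16 * mertens z := by
        refine le_of_mul_le_mul_left ?_ hn
        nlinarith
      calc (#Λ : ℝ) * s ^ 5 = #Λ * s ^ 4 * s := by ring
        _ ≤ 16 * (2 * a * C₀ / s) * s :=
          mul_le_mul_of_nonneg_right (h3.trans (by linarith)) hs.le
        _ = 32 * a * C₀ := by field_simp; ring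
    have : 0 ≤ 8 * D ^ 2 * C₂ := by positivity
    linarith
  · have h1 := card_mul_sq_le (L := L) (M := 4 * L) (F := primeWt R W B) (δ := s ^ 2) (by omega)
      (by omega) (by positivity) hΛM hΛ
    have h2 : ∑ y ∈ range L, primeWt R W B y ^ 2 ≤ selG R W * (2 * L) := by
      refine le_trans ?_ (mul_le_mul_of_nonneg_left hsum (selG_nonneg R W))
      rw [mul_sum]
      refine sum_le_sum fun y _ => ?_
      rw [primeWt]; split_ifs
      · rw [sq]
      · simp
    have hR1 : (1 : ℝ) ≤ R := by exact_mod_cast hR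
    have hRL' : (R : ℝ) ≤ L := by
      calc (R : ℝ) ≤ R ^ 2 := by nlinarith
        _ ≤ _ := hRL
        _ ≤ (L : ℝ) ^ (1 : ℝ) := Real.rpow_le_rpow_of_exponent_le hL1 (by norm_num)
        _ = L := Real.rpow_one _
    have h3 : selG R W ≤ D ^ 2 * (L : ℝ) ^ (0.00001 : ℝ) := by
      have h4 : 1 + Real.log R ≤ D * (L : ℝ) ^ (0.000005 : ℝ) := by
        refine le_trans ?_ (hD ▸ one_add_log_le (by norm_num) hL)
        have := Real.log_le_log (by linarith) hRL'
        linarith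
      calc selG R W ≤ (1 + Real.log R) ^ 2 := selG_le R W
        _ ≤ (D * (L : ℝ) ^ (0.000005 : ℝ)) ^ 2 := by
          have := Real.log_nonneg hR1
          gcongr
        _ = _ := by
          rw [mul_pow, ← Real.rpow_natCast, ← Real.rpow_natCast ((L : ℝ) ^ (0.000005 : ℝ)), ← Real.rpow_mul hL0.le]
          norm_num
    have h5 : (#Λ : ℝ) * s ^ 4 ≤ 8 * selG R W := by
      refine le_of_mul_le_mul_right ?_ (show (0 : ℝ) < L ^ 2 by positivity)
      calc (#Λ : ℝ) * s ^ 4 * L ^ 2 = #Λ * (s ^ 2 * L) ^ 2 := by ring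
        _ ≤ _ := h1
        _ ≤ (4 * L : ℕ) * (selG R W * (2 * L)) := by gcongr
        _ = _ := by push_cast; ring
    have h6 : s ≤ C₂ * (L : ℝ) ^ (-(0.00001 : ℝ)) := by
      by_contra! h
      have h7 := pow_lt_pow_left₀ h (by positivity) (show 5 ≠ 0 by norm_num)
      rw [mul_pow, ← Real.rpow_natCast ((L : ℝ) ^ (-(0.00001 : ℝ))), ← Real.rpow_mul hL0.le] at h7
      norm_num at h7 hsmall
      have h8 : C₂ ≤ C₂ ^ 5 := le_self_pow₀ hC₂1 (by norm_num)
      have h9 : (0:ℝ) < (L : ℝ) ^ (-(1 / 20000) : ℝ) := by positivity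
      nlinarith
    have h10 : (L : ℝ) ^ (0.00001 : ℝ) * (L : ℝ) ^ (-(0.00001 : ℝ)) = 1 := by
      rw [← Real.rpow_add hL0]; simp
    calc (#Λ : ℝ) * s ^ 5 = #Λ * s ^ 4 * s := by ring
      _ ≤ 8 * (D ^ 2 * (L : ℝ) ^ (0.00001 : ℝ)) * (C₂ * (L : ℝ) ^ (-(0.00001 : ℝ))) :=
        mul_le_mul (h5.trans (by linarith)) h6 hs.le (by positivity)
      _ = 8 * D ^ 2 * C₂ * ((L : ℝ) ^ (0.00001 : ℝ) * (L : ℝ) ^ (-(0.00001 : ℝ))) := by ring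
      _ ≤ _ := by
        rw [h10]
        have : 0 ≤ 32 * a * C₀ := by positivity
        linarith

end

section

open Finset

lemma exists_card_primes_modEq_ge {q : ℕ} (hq : q ≠ 0) {η : ℝ} (hη : 0 < η) :
    ∃ X₀ : ℝ, ∀ b : ℕ, b.Coprime q → ∀ X Y : ℕ, X₀ ≤ X → X ≤ Y → (Y : ℝ) ≤ Real.exp 1 * X →
      (Real.log (Y / X) / q.totient - η) * X ≤
        #{p ∈ Ioc X Y | p.Prime ∧ p ≡ b [MOD q]} * Real.log X := by
  have h : ∀ b : ℕ, ∃ X₀ : ℝ, b.Coprime q → ∀ X ≥ X₀, ∀ Y, X ≤ Y → Y ≤ Real.exp 1 * X →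
      (Real.log (Y / X) / q.totient - η) * X ≤
        #{p ∈ Ioc ⌊X⌋₊ ⌊Y⌋₊ | p.Prime ∧ p ≡ b [MOD q]} * Real.log X := by
    intro b
    by_cases hb : b.Coprime q
    · obtain ⟨X₀, h⟩ := card_primes_modEq_ge hq hb hη
      exact ⟨X₀, fun _ => h⟩
    · exact ⟨0, fun h => absurd h hb⟩
  choose X₀ hX₀ using h
  refine ⟨∑ b ∈ range q, |X₀ b|, fun b hb X Y hX hXY hY => ?_⟩
  have hb' : (b % q).Coprime q := by rwa [Nat.Coprime, ← Nat.gcd_rec, Nat.gcd_comm]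
  have h1 : X₀ (b % q) ≤ X := by
    refine (le_abs_self _).trans (le_trans ?_ hX)
    exact single_le_sum (f := fun b => |X₀ b|) (fun _ _ => abs_nonneg _)
      (mem_range.2 (Nat.mod_lt _ (Nat.pos_of_ne_zero hq)))
  have h2 := hX₀ (b % q) hb' X h1 Y (by exact_mod_cast hXY) hY
  rw [Nat.floor_natCast, Nat.floor_natCast] at h2
  have h3 : ∀ p : ℕ, p ≡ b % q [MOD q] ↔ p ≡ b [MOD q] := fun p => by simp [Nat.ModEq]
  simpa only [h3] using h2

lemma card_primes_modEq_le {W B a T : ℕ} (hB : 0 < B) :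
    #{p ∈ Ioc (W * a + B - 1) (W * a + B - 1 + 2 * W * T) |
      p.Prime ∧ p ≡ W * a + B [MOD 2 * W]} ≤ #{t ∈ range T | (W * (a + 2 * t) + B).Prime} := by
  refine card_le_card_of_surjOn (fun t => W * (a + 2 * t) + B) ?_
  intro p hp
  simp only [coe_filter, Set.mem_ofPred_eq, mem_Ioc] at hp
  obtain ⟨⟨hp1, hp2⟩, hp3, hp4⟩ := hp
  have h1 : W * a + B ≤ p := by omega
  obtain ⟨t, ht⟩ := (Nat.modEq_iff_dvd' h1).1 hp4.symm
  have h2 : p = W * (a + 2 * t) + B := by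
    have : p = W * a + B + 2 * W * t := by omega
    rw [this]; ring
  refine ⟨t, ?_, h2.symm⟩
  simp only [coe_filter, Set.mem_ofPred_eq, mem_range]
  refine ⟨?_, h2 ▸ hp3⟩
  by_contra! h
  have := Nat.mul_le_mul_left (2 * W) h
  omega

/-- The level of the sieve for intervals of length `64 * T`. -/
noncomputable def sieveLevel (T : ℕ) : ℕ := ⌊((64 * T : ℕ) : ℝ) ^ (0.4997 : ℝ)⌋₊

lemma one_le_sieveLevel {T : ℕ} (hT : 1 ≤ T) : 1 ≤ sieveLevel T := by
  rw [sieveLevel, Nat.le_floor_iff (by positivity)]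
  exact_mod_cast Real.one_le_rpow (by exact_mod_cast (by omega : 1 ≤ 64 * T)) (by norm_num)

lemma sieveLevel_sq_le (T : ℕ) :
    (sieveLevel T : ℝ) ^ 2 ≤ ((64 * T : ℕ) : ℝ) ^ (0.9994 : ℝ) := by
  calc (sieveLevel T : ℝ) ^ 2 ≤ (((64 * T : ℕ) : ℝ) ^ (0.4997 : ℝ)) ^ 2 := by
        gcongr; exact Nat.floor_le (by positivity)
    _ = _ := by
      rw [← Real.rpow_natCast, ← Real.rpow_mul (by positivity)]
      norm_num

lemma sieveLevel_le {T : ℕ} (hT : 1 ≤ T) : sieveLevel T ≤ 64 * T := by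
  have h1 : (1 : ℝ) ≤ (64 * T : ℕ) := by exact_mod_cast (by omega : 1 ≤ 64 * T)
  have h2 : (sieveLevel T : ℝ) ≤ (64 * T : ℕ) :=
    (Nat.floor_le (by positivity)).trans
      ((Real.rpow_le_rpow_of_exponent_le h1 (by norm_num)).trans_eq (Real.rpow_one _))
  exact_mod_cast h2

lemma log_le_log_sieveLevel {T : ℕ} (hT : 1 ≤ T) :
    0.4997 * Real.log (64 * T : ℕ) ≤ Real.log (sieveLevel T + 1 : ℕ) := by
  have h1 : (0 : ℝ) < (64 * T : ℕ) := by exact_mod_cast (by omega : 0 < 64 * T)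
  rw [← Real.log_rpow h1]
  refine Real.log_le_log (by positivity) ?_
  rw [Nat.cast_add, Nat.cast_one]
  exact (Nat.lt_floor_add_one _).le

lemma exists_sum_primeWt_ge {W : ℕ} (hW : Squarefree W) (hW2 : 2 ∣ W) {K : ℝ} (hK : 1 ≤ K) :
    ∃ T₀ : ℕ, ∀ T ≥ T₀, ∀ B : ℕ, B.Coprime W → 10 ^ 4 * W * T < B →
      ((B + 64 * W * T : ℕ) : ℝ) ≤ K * T → ∀ a ≤ 62 * T,
      4995 / 10000 * (T : ℝ) ≤ ∑ t ∈ range T, primeWt (sieveLevel T) W B (a + 2 * t) := by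
  have hW0 : 0 < W := Nat.pos_of_ne_zero hW.ne_zero
  have hη : (0 : ℝ) < 0.0001 / K := by positivity
  obtain ⟨X₀, hX₀⟩ := exists_card_primes_modEq_ge (q := 2 * W) (by omega) hη
  refine ⟨max 2 (max ⌈X₀⌉₊ ⌈K ^ 10000⌉₊), fun T hT B hBW hB hBK a ha => ?_⟩
  simp only [ge_iff_le, max_le_iff, Nat.ceil_le] at hT
  obtain ⟨hT2, hTX, hTK⟩ := hT
  have hT2' : (2 : ℝ) ≤ T := by exact_mod_cast hT2
  have hWT : T ≤ W * T := Nat.le_mul_of_pos_left T hW0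
  have hWa : W * a ≤ 62 * (W * T) := by
    calc W * a ≤ W * (62 * T) := Nat.mul_le_mul_left W ha
      _ = _ := by ring
  obtain ⟨X, hX⟩ : ∃ X, X = W * a + B - 1 := ⟨_, rfl⟩
  have hWT' : W * T = W * T := rfl
  have hX1 : 10 ^ 4 * (W * T) ≤ X := by
    rw [mul_assoc] at hB; omega
  have hX2 : X + 2 * W * T ≤ B + 64 * W * T := by
    have h1 : 2 * W * T = 2 * (W * T) := by ring
    have h2 : 64 * W * T = 64 * (W * T) := by ring
    omega
  have hX1' : 10 ^ 4 * ((W : ℝ) * T) ≤ X := by exact_mod_cast hX1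
  have hX2' : (X : ℝ) + 2 * W * T ≤ K * T := le_trans (by exact_mod_cast hX2) hBK
  have hWr : (1 : ℝ) ≤ W := by exact_mod_cast hW0
  have hWTr : (T : ℝ) ≤ W * T := by exact_mod_cast hWT
  have hXpos : (0 : ℝ) < X := by nlinarith
  have hcop : (W * a + B).Coprime (2 * W) := by
    have h1 : (W * a + B).Coprime W := by
      rwa [Nat.coprime_mul_left_add_left]
    exact Nat.Coprime.mul_right (h1.coprime_dvd_right hW2) h1
  have h1 := hX₀ (W * a + B) hcop X (X + 2 * W * T) (hTX.trans (by nlinarith)) (by omega) (by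
    have := Real.exp_one_gt_d9
    push_cast
    nlinarith)
  have h2 := card_primes_modEq_le (W := W) (B := B) (a := a) (T := T) (by omega)
  rw [← hX] at h2
  have hlogX : 0 < Real.log X := Real.log_pos (by nlinarith)
  have hφ : (2 * W).totient = 2 * W.totient := Nat.totient_mul_of_prime_of_dvd Nat.prime_two hW2
  have hφ0 : (0 : ℝ) < W.totient := by exact_mod_cast Nat.totient_pos.2 hW0
  obtain ⟨V, hV⟩ : ∃ V : ℝ, V = W / W.totient := ⟨_, rfl⟩
  have hV1 : 1 ≤ V := by
    rw [hV, le_div_iff₀ hφ0, one_mul]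
    exact_mod_cast Nat.totient_le W
  have h3 : V * T * 0.9997 ≤
      #{t ∈ range T | (W * (a + 2 * t) + B).Prime} * Real.log X := by
    refine le_trans ?_ (h1.trans (mul_le_mul_of_nonneg_right (by exact_mod_cast h2) hlogX.le))
    rw [hφ]
    push_cast
    have hY : (0 : ℝ) < X + 2 * W * T := by positivity
    have h4 : 2 * (W * T) / (X + 2 * W * T) ≤ Real.log ((X + 2 * W * T) / X) := by
      have := Real.one_sub_inv_le_log_of_pos (show (0 : ℝ) < (X + 2 * W * T) / X by positivity)
      refine le_trans (le_of_eq ?_) this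
      field_simp; ring
    have h5 : 0.9998 * (V * T) ≤ 2 * (W * T) / (X + 2 * W * T) / (2 * W.totient) * X := by
      have : 2 * ((W : ℝ) * T) / (X + 2 * W * T) / (2 * W.totient) * X =
          X / (X + 2 * W * T) * (V * T) := by
        rw [hV]; field_simp
      rw [this]
      have : 0.9998 ≤ (X : ℝ) / (X + 2 * W * T) := by
        rw [le_div_iff₀ hY]; nlinarith
      gcongr
    have h6 : 0.0001 / K * X ≤ 0.0001 * (V * T) := by
      calc 0.0001 / K * X ≤ 0.0001 / K * (K * T) := by gcongr; nlinarith
        _ = 0.0001 * (1 * T) := by field_simp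
        _ ≤ _ := by gcongr
    have h7 : 2 * (W * T) / (X + 2 * W * T) / (2 * W.totient) * X ≤
        Real.log ((X + 2 * W * T) / X) / (2 * W.totient) * X := by gcongr
    rw [sub_mul]; linarith
  have h4 : 0.9999 * Real.log X ≤ Real.log (64 * T : ℕ) := by
    have hlogK : 10000 * Real.log K ≤ Real.log T := by
      have := Real.log_le_log (by positivity) hTK
      rwa [Real.log_pow] at this
    have h5 : Real.log X ≤ Real.log K + Real.log T := by
      rw [← Real.log_mul (by positivity) (by positivity)]
      exact Real.log_le_log hXpos (by nlinarith)
    have h6 : Real.log T ≤ Real.log (64 * T : ℕ) :=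
      Real.log_le_log (by positivity) (by push_cast; linarith)
    have := Real.log_nonneg hK
    linarith
  have h5 : ∑ t ∈ range T, primeWt (sieveLevel T) W B (a + 2 * t) =
      #{t ∈ range T | (W * (a + 2 * t) + B).Prime} * selG (sieveLevel T) W := by
    simp_rw [primeWt, ← sum_filter, sum_const, nsmul_eq_mul]
  rw [h5]
  have h6 := log_le_mul_selG (sieveLevel T) hW
  rw [← hV] at h6
  have h7 := log_le_log_sieveLevel (show 1 ≤ T by omega)
  refine le_of_mul_le_mul_left ?_ (show 0 < V * Real.log X by positivity)
  calc V * Real.log X * (4995 / 10000 * T)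
      ≤ (V * T * 0.9997) * (0.4997 * (0.9999 * Real.log X)) := by
        have : 0 ≤ V * Real.log X * T := by positivity
        linarith
    _ ≤ (#{t ∈ range T | (W * (a + 2 * t) + B).Prime} * Real.log X) *
        (V * selG (sieveLevel T) W) := by
        refine mul_le_mul h3 (by linarith) (by positivity) (by positivity)
    _ = _ := by ring

end

section

open Finset

lemma ftZ_eq_sum_range (f : ℤ → ℝ) (L : ℕ) (α : ℝ) :
    ftZ f L α = ∑ y ∈ range L, (f y : ℂ) * ee (y * α) := by
  rw [ftZ]
  refine (sum_nbij (fun y : ℕ => (y : ℤ)) ?_ ?_ ?_ ?_).symm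
  · intro y hy
    rw [mem_range] at hy
    rw [mem_Ico]; omega
  · intro x _ y _ h
    exact Int.ofNat_inj.1 h
  · intro x hx
    rw [mem_coe, mem_Ico] at hx
    exact ⟨x.toNat, by rw [mem_coe, mem_range]; omega, by simp only; omega⟩
  · intro y _
    simp

theorem exists_isDenseModulo_primes : ∃ C : ℝ, 1 ≤ C ∧ ∀ θ : ℝ, 0 < θ → ∃ w ≥ 2, ∀ K : ℝ, 1 ≤ K →
    ∃ T₀ : ℕ, ∀ T ≥ T₀, ∀ B : ℕ, B.Coprime (primorial w) → 10 ^ 4 * primorial w * T < B →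
      ((B + 64 * primorial w * T : ℕ) : ℝ) ≤ K * T →
      ∃ f ν, IsDenseModulo T θ C f ν ∧
        ∀ x : ℤ, 0 < f x → ∃ y : ℕ, x = y ∧ y < 64 * T ∧ (primorial w * y + B).Prime := by
  obtain ⟨C, hC, hlevel⟩ := exists_card_largeValues_le
  obtain ⟨C₁, hC₁, hmaj⟩ := exists_norm_sum_selH_sq_sub_one_le
  refine ⟨C, hC, fun θ hθ => ?_⟩
  obtain ⟨θ', hθ'⟩ : ∃ θ', θ' = min θ 1 := ⟨_, rfl⟩
  have hθ'0 : 0 < θ' := hθ' ▸ lt_min hθ one_pos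
  have hθ'1 : θ' ≤ 1 := hθ' ▸ min_le_right _ _
  have hθ'θ : θ' ≤ θ := hθ' ▸ min_le_left _ _
  obtain ⟨w, hw⟩ : ∃ w : ℕ, w = max 2 ⌈(6 / θ') ^ 2⌉₊ := ⟨_, rfl⟩
  have hw2 : 2 ≤ w := hw ▸ le_max_left _ _
  have hw6 : 3 / √(w : ℝ) ≤ θ' / 2 := by
    have h1 : (6 / θ') ^ 2 ≤ (w : ℝ) := (Nat.le_ceil _).trans (by
      rw [hw]; exact_mod_cast le_max_right _ _)
    have h2 : 6 / θ' ≤ √(w : ℝ) := Real.le_sqrt_of_sq_le h1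
    calc 3 / √(w : ℝ) ≤ 3 / (6 / θ') := by gcongr
      _ = θ' / 2 := by field_simp; norm_num
  refine ⟨w, hw2, fun K hK => ?_⟩
  have hW2 : 2 ∣ primorial w := Nat.prime_two.dvd_primorial_iff.2 hw2
  obtain ⟨W, hW⟩ : ∃ W, W = primorial w := ⟨_, rfl⟩
  have hWsf : Squarefree W := hW ▸ squarefree_primorial w
  have hpW : ∀ p : ℕ, p.Prime → p ≤ w → p ∣ W := fun p hp hpw => hW ▸ hp.dvd_primorial_iff.2 hpw
  rw [← hW] at hW2 ⊢
  obtain ⟨T₀, hT₀⟩ := exists_sum_primeWt_ge hWsf hW2 hK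
  have hlim : ∀ᶠ x : ℝ in Filter.atTop, x ^ (-(0.00005 : ℝ)) < θ' / (2 * C₁) :=
    (tendsto_rpow_neg_atTop (by norm_num)).eventually_lt_const (by positivity)
  obtain ⟨X₀, hX₀⟩ := Filter.eventually_atTop.1 hlim
  refine ⟨max 1 (max T₀ ⌈X₀⌉₊), fun T hT B hBW hB hBK => ?_⟩
  simp only [ge_iff_le, max_le_iff, Nat.ceil_le] at hT
  obtain ⟨hT1, hT0, hTX⟩ := hT
  obtain ⟨L, hL⟩ : ∃ L, L = 64 * T := ⟨_, rfl⟩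
  have hLT : (T : ℝ) ≤ L := by exact_mod_cast (by omega : T ≤ L)
  have hL1 : 1 ≤ L := by omega
  have hL0 : (0 : ℝ) < L := by exact_mod_cast hL1
  have hW0 : 0 < W := Nat.pos_of_ne_zero hWsf.ne_zero
  have hRB : sieveLevel T < B := by
    have h1 := sieveLevel_le hT1
    have h2 := Nat.le_mul_of_pos_left T hW0
    rw [mul_assoc] at hB
    omega
  have hR1 := one_le_sieveLevel hT1
  have hRL := sieveLevel_sq_le T
  have havg := hT₀ T hT0 B hBW hB hBK
  obtain ⟨R, hR⟩ : ∃ R, R = sieveLevel T := ⟨_, rfl⟩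
  rw [← hL, ← hR] at hRL
  rw [← hR] at hR1 hRB havg
  obtain ⟨N, hN⟩ : ∃ N : ℕ → ℝ, N = fun y => selH R W (W * y + B) ^ 2 / selG R W := ⟨_, rfl⟩
  have hFN : ∀ y, primeWt R W B y ≤ N y := fun y => by
    have := primeWt_le (W := W) hR1 hRB squarefree_one y
    simpa [hN] using this
  have hfour : ∀ α : ℝ, ‖∑ y ∈ range L, ((N y - 1 : ℝ) : ℂ) * ee (y * α)‖ ≤ θ' * L := by
    intro α
    rw [hN]
    refine (hmaj L R W B W w hL1 hR1 hRL (by omega) dvd_rfl hpW α).trans ?_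
    have h1 := hX₀ L (hTX.trans hLT)
    rw [lt_div_iff₀ (by positivity)] at h1
    rw [mul_comm θ']
    gcongr
    linarith
  have hsum : ∑ y ∈ range L, primeWt R W B y ≤ 2 * L := by
    have h1 := hfour 0
    simp only [mul_zero, ee_zero, mul_one] at h1
    rw [← Complex.ofReal_sum, Complex.norm_real, Real.norm_eq_abs, sum_sub_distrib] at h1
    have h2 := (abs_le.1 h1).2
    have h3 := sum_le_sum (s := range L) fun y _ => hFN y
    simp only [sum_const, card_range, nsmul_eq_mul, mul_one] at h2
    nlinarith
  obtain ⟨f, hf⟩ : ∃ f : ℤ → ℝ,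
    f = fun x => if 0 ≤ x ∧ x < (L : ℤ) then primeWt R W B x.toNat else 0 := ⟨_, rfl⟩
  have hfy : ∀ y : ℕ, y < L → f y = primeWt R W B y := fun y hy => by
    simp [hf, hy]
  refine ⟨f, fun x => N x.toNat, ⟨?_, ?_, ?_, ?_, ?_, ?_⟩, ?_⟩
  · intro x
    rw [hf]; dsimp only; split_ifs
    exacts [primeWt_nonneg _ _ _ _, le_rfl]
  · intro x hx
    rw [hf] at hx; dsimp only at hx; split_ifs at hx with h
    · rwa [← hL]
    · exact absurd rfl hx
  · intro x hx0 hx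
    rw [← hL] at hx
    rw [hf]; dsimp only; rw [if_pos ⟨hx0, hx⟩]
    exact hFN _
  · intro r _
    rw [← hL, ftZ_eq_sum_range]
    simp only [Int.toNat_natCast]
    exact (hfour _).trans (by gcongr)
  · intro s hs hs2
    rw [← hL, show 256 * T = 4 * L by omega]
    refine hlevel L R W B hL1 hR1 hRL hRB hsum s hs hs2 _ (filter_subset _ _) fun r hr => ?_
    have h1 := (mem_filter.1 hr).2
    rw [le_div_iff₀ hL0, ftZ_eq_sum_range] at h1
    refine h1.trans_eq (congrArg _ (sum_congr rfl fun y hy => ?_))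
    rw [hfy y (mem_range.1 hy)]
  · intro a ha0 ha
    lift a to ℕ using ha0
    refine (havg a (by omega)).trans_eq (sum_congr rfl fun t ht => ?_)
    have := mem_range.1 ht
    rw [← hfy _ (by omega)]
    push_cast; rfl
  · intro x hx
    rw [hf] at hx; dsimp only at hx; split_ifs at hx with h
    · refine ⟨x.toNat, by omega, by omega, ?_⟩
      rw [primeWt] at hx
      by_contra hp
      rw [if_neg hp] at hx
      exact lt_irrefl _ hx
    · exact absurd hx (lt_irrefl _)

end

section

open Finset

lemma exists_residue {m W : ℕ} (hm : Odd m) (hW : Squarefree W) :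
    ∃ b : ℤ, ∀ p : ℕ, p.Prime → p ∣ W → ¬ (p : ℤ) ∣ b ∧ ¬ (p : ℤ) ∣ m - 2 * b := by
  obtain ⟨g, hg⟩ : ∃ g, g = Nat.gcd W (m + 2 * W - 2) := ⟨_, rfl⟩
  have hW0 : 0 < W := Nat.pos_of_ne_zero hW.ne_zero
  obtain ⟨k, hk⟩ : g ∣ W := hg ▸ Nat.gcd_dvd_left _ _
  have hcop : g.Coprime k := Nat.coprime_of_squarefree_mul (hk ▸ hW)
  obtain ⟨b, hb1, hb2⟩ := Nat.chineseRemainder hcop 2 1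
  have hg2 : ∀ p : ℕ, p ∣ W → (p ∣ g ↔ (p : ℤ) ∣ m - 2) := by
    intro p hp
    rw [hg, Nat.dvd_gcd_iff]
    have h1 : ((m + 2 * W - 2 : ℕ) : ℤ) = (m - 2) + 2 * W := by
      have : 2 ≤ m + 2 * W := by omega
      push_cast [this]; ring
    have h2 : (p : ℤ) ∣ 2 * W := (Int.natCast_dvd_natCast.2 hp).mul_left 2
    rw [← Int.natCast_dvd_natCast (n := m + 2 * W - 2), h1, dvd_add_left h2]
    exact and_iff_right hp
  have hp2 : ∀ p : ℕ, p.Prime → p ∣ W → p ∣ g → ¬ (p : ℤ) ∣ 2 := by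
    intro p hp hpW hpg h
    have h1 := (hg2 p hpW).1 hpg
    have h2 : p = 2 := (Nat.prime_dvd_prime_iff_eq hp Nat.prime_two).1 (by exact_mod_cast h)
    subst h2
    obtain ⟨j, rfl⟩ := hm
    push_cast at h1
    omega
  refine ⟨b, fun p hp hpW => ?_⟩
  rcases (hp.dvd_mul.1 (hk ▸ hpW) : p ∣ g ∨ p ∣ k) with hpg | hpk
  · have h1 := (hg2 p hpW).1 hpg
    have h2 : (p : ℤ) ∣ 2 - b := by
      exact_mod_cast (Int.natCast_dvd_natCast.2 hpg).trans (Nat.modEq_iff_dvd.1 hb1)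
    refine ⟨fun h => hp2 p hp hpW hpg ?_, fun h => hp2 p hp hpW hpg ?_⟩
    · have := dvd_add h2 h
      rwa [sub_add_cancel] at this
    · have h3 := dvd_sub (dvd_sub h1 h) (h2.mul_left (-2))
      ring_nf at h3
      simpa using h3
  · have h2 : (p : ℤ) ∣ 1 - b := by
      exact_mod_cast (Int.natCast_dvd_natCast.2 hpk).trans (Nat.modEq_iff_dvd.1 hb2)
    refine ⟨fun h => ?_, fun h => ?_⟩
    · have := dvd_add h2 h
      rw [sub_add_cancel] at this
      exact hp.one_lt.ne' (by exact_mod_cast Int.eq_one_of_dvd_one (by positivity) this)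
    · have h3 := dvd_sub h (h2.mul_left 2)
      have h4 : p ∣ g := (hg2 p hpW).2 (by
        rwa [show (m : ℤ) - 2 * b - 2 * (1 - b) = m - 2 by ring] at h3)
      exact hp.one_lt.ne' (Nat.dvd_one.1 (hcop ▸ Nat.dvd_gcd h4 hpk))

lemma exists_shifts {m W : ℕ} (hm : Odd m) (hW : Squarefree W) (hW2 : 2 ∣ W) {T : ℕ}
    (hT : 96 * W * T + 3 * W + 3 ≤ m) : ∃ B B' : ℕ, B.Coprime W ∧ B'.Coprime W ∧
      2 * B + B' + 96 * W * T = m ∧ 3 * B ≤ m ∧ m ≤ 3 * B + 96 * W * T + 3 * W + 3 ∧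
      m ≤ 3 * B' + 96 * W * T ∧ 3 * B' ≤ m + 6 * W + 6 := by
  have hW0 : 0 < W := Nat.pos_of_ne_zero hW.ne_zero
  obtain ⟨b, hb⟩ := exists_residue hm hW
  obtain ⟨V, hV⟩ : ∃ V, V = W * T := ⟨_, rfl⟩
  rw [mul_assoc, ← hV] at hT ⊢
  obtain ⟨X, hX⟩ : ∃ X, X = m / 3 - 32 * V := ⟨_, rfl⟩
  obtain ⟨r, hr⟩ : ∃ r : ℤ, r = (X - b) % W := ⟨_, rfl⟩
  have hr0 : 0 ≤ r := hr ▸ Int.emod_nonneg _ (by omega)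
  have hr1 : r < W := hr ▸ Int.emod_lt_of_pos _ (by omega)
  have hrb : (W : ℤ) ∣ X - r - b := by
    have := Int.dvd_sub_self_of_emod_eq (hr.symm)
    rw [show (X : ℤ) - r - b = -(r - (X - b)) by ring]
    exact this.neg_right
  obtain ⟨B, hB⟩ : ∃ B, B = X - r.toNat := ⟨_, rfl⟩
  have hBr : (B : ℤ) = X - r := by omega
  obtain ⟨B', hB'⟩ : ∃ B', B' = m - 96 * V - 2 * B := ⟨_, rfl⟩
  have hBr' : (B' : ℤ) = m - 96 * V - 2 * B := by omega
  refine ⟨B, B', ?_, ?_, by omega, by omega, by omega, by omega, by omega⟩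
  · refine Nat.coprime_of_dvd fun p hp hpB hpW => (hb p hp hpW).1 ?_
    have h1 : (p : ℤ) ∣ X - r - b := (Int.natCast_dvd_natCast.2 hpW).trans hrb
    have h2 := Int.natCast_dvd_natCast.2 hpB
    rw [hBr] at h2
    exact (dvd_sub_right h2).1 h1
  · refine Nat.coprime_of_dvd fun p hp hpB hpW => (hb p hp hpW).2 ?_
    have h0 := Int.natCast_dvd_natCast.2 hpW
    have h1 : (p : ℤ) ∣ X - r - b := h0.trans hrb
    have h2 := Int.natCast_dvd_natCast.2 hpB
    rw [hBr', hBr] at h2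
    have h3 : (p : ℤ) ∣ 96 * V := by
      rw [hV]; push_cast
      exact (h0.mul_right _).mul_left _
    have h4 := dvd_add (dvd_add h2 h3) (h1.mul_left 2)
    rwa [show (m : ℤ) - 96 * V - 2 * (X - r) + 96 * V + 2 * (X - r - b) = m - 2 * b by ring] at h4

/-- Vinogradov's theorem with almost equal summands. -/
theorem exists_primes_add_eq {ε : ℝ} (hε : 0 < ε) : ∃ m₀ : ℕ, ∀ m ≥ m₀, Odd m →
    ∃ p q r : ℕ, p.Prime ∧ q.Prime ∧ r.Prime ∧ p + q + r = m ∧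
      (m : ℝ) ≤ (3 + ε) * p ∧ (m : ℝ) ≤ (3 + ε) * q ∧ (m : ℝ) ≤ (3 + ε) * r := by
  obtain ⟨C, hC, hprimes⟩ := exists_isDenseModulo_primes
  obtain ⟨θ, hθ, -, htrans⟩ := exists_add_eq_of_isDenseModulo hC
  obtain ⟨w, hw2, hdense⟩ := hprimes θ hθ
  have hW2 : 2 ∣ primorial w := Nat.prime_two.dvd_primorial_iff.2 hw2
  have hWsf := squarefree_primorial w
  obtain ⟨W, hW⟩ : ∃ W, W = primorial w := ⟨_, rfl⟩
  rw [← hW] at hW2 hWsf hdense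
  have hW0 : 0 < W := Nat.pos_of_ne_zero hWsf.ne_zero
  have hW1 : (1 : ℝ) ≤ W := by exact_mod_cast hW0
  obtain ⟨c, hc⟩ : ∃ c, c = min ε 1 / 10 ^ 6 := ⟨_, rfl⟩
  have hc0 : 0 < c := hc ▸ div_pos (lt_min hε one_pos) (by norm_num)
  have hc1 : 10 ^ 6 * c ≤ 1 := by
    rw [hc, mul_div_cancel₀ _ (by norm_num)]; exact min_le_right _ _
  have hcε : 10 ^ 6 * c ≤ ε := by
    rw [hc, mul_div_cancel₀ _ (by norm_num)]; exact min_le_left _ _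
  obtain ⟨T₀, hT₀⟩ := hdense (2 * W / c) (by rw [le_div_iff₀ hc0]; linarith)
  refine ⟨⌈(W * (T₀ + 100) / c : ℝ)⌉₊, fun m hm hodd => ?_⟩
  rw [ge_iff_le, Nat.ceil_le, div_le_iff₀ hc0] at hm
  have hcmW : (T₀ + 100 : ℝ) ≤ c * m / W := by
    rw [le_div_iff₀ (by linarith)]; linarith
  obtain ⟨T, hT⟩ : ∃ T, T = ⌊c * m / W⌋₊ := ⟨_, rfl⟩
  have hT1 : (T : ℝ) ≤ c * m / W := hT ▸ Nat.floor_le (by positivity)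
  have hT2 : c * m / W < T + 1 := hT ▸ Nat.lt_floor_add_one _
  have hTT : T₀ + 100 ≤ T := by
    rw [hT, Nat.le_floor_iff (by positivity)]
    exact_mod_cast hcmW
  have hTr : (100 : ℝ) ≤ T := by exact_mod_cast (by omega : 100 ≤ T)
  have hWT : W * T ≤ c * m := by rw [mul_comm]; exact (le_div_iff₀ (by linarith)).1 hT1
  have hWT2 : c * m ≤ 2 * W * T := by
    rw [div_lt_iff₀ (by linarith)] at hT2
    nlinarith
  have hW100 : 100 * (W : ℝ) ≤ W * T := by nlinarith
  have hm0 : (0 : ℝ) ≤ m := by positivity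
  have hcm : 10 ^ 6 * (c * m) ≤ m := by nlinarith
  obtain ⟨B, B', hB, hB', hsum, h1, h2, h3, h4⟩ := exists_shifts hodd hWsf hW2 (T := T) (by
    have : (96 * W * T + 3 * W + 3 : ℝ) ≤ m := by linarith
    exact_mod_cast this)
  have h1' : 3 * (B : ℝ) ≤ m := by exact_mod_cast h1
  have h2' : (m : ℝ) ≤ 3 * B + 96 * W * T + 3 * W + 3 := by exact_mod_cast h2
  have h3' : (m : ℝ) ≤ 3 * B' + 96 * W * T := by exact_mod_cast h3
  have h4' : 3 * (B' : ℝ) ≤ m + 6 * W + 6 := by exact_mod_cast h4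
  have hmK : (m : ℝ) ≤ 2 * W / c * T := by
    rw [div_mul_eq_mul_div, le_div_iff₀ hc0]; linarith
  have hup : ∀ {D : ℕ}, 3 * (D : ℝ) ≤ m + 6 * W + 6 →
      ((D + 64 * W * T : ℕ) : ℝ) ≤ 2 * W / c * T := by
    intro D hD
    refine le_trans ?_ hmK
    push_cast
    linarith
  have hlow : ∀ {D : ℕ}, (m : ℝ) ≤ 3 * D + 96 * W * T + 3 * W + 3 → 10 ^ 4 * W * T < D := by
    intro D hD
    have : (10 ^ 4 * W * T : ℝ) < D := by linarith
    exact_mod_cast this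
  have hlow' : ∀ {D p : ℕ}, (m : ℝ) ≤ 3 * D + 96 * W * T + 3 * W + 3 → D ≤ p →
      (m : ℝ) ≤ (3 + ε) * p := by
    intro D p hD hDp
    have h5 : (D : ℝ) ≤ p := by exact_mod_cast hDp
    have h6 : (m : ℝ) ≤ 3 * p + 100 * (c * m) := by linarith
    have h7 : (m : ℝ) ≤ 4 * p := by linarith
    have h8 : 100 * (c * m) ≤ ε * p := by
      calc 100 * (c * m) ≤ 100 * (c * (4 * p)) := by gcongr
        _ = (400 * c) * p := by ring
        _ ≤ ε * p := by gcongr; linarith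
    linarith
  obtain ⟨f, ν, hf, hfp⟩ := hT₀ T (by omega) B hB (hlow h2') (hup (by linarith))
  obtain ⟨f', ν', hf', hfp'⟩ := hT₀ T (by omega) B' hB' (hlow (by linarith)) (hup h4')
  obtain ⟨x, y, z, hxyz, hx, hy, hz⟩ := htrans T (by omega) f f f' ν ν ν' hf hf hf' (96 * T)
    (by omega) (by omega)
  obtain ⟨x, rfl, -, hx⟩ := hfp x hx
  obtain ⟨y, rfl, -, hy⟩ := hfp y hy
  obtain ⟨z, rfl, -, hz⟩ := hfp' z hz
  have hxyz' : x + y + z = 96 * T := by exact_mod_cast hxyz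
  refine ⟨_, _, _, hx, hy, hz, ?_, hlow' h2' (Nat.le_add_left _ _), hlow' h2' (Nat.le_add_left _ _),
    hlow' (by linarith) (Nat.le_add_left _ _)⟩
  rw [← hsum]
  have : W * (x + y + z) = W * (96 * T) := by rw [hxyz']
  linarith

end

lemma eq_zero_or_mem_or_mem_add_of_mem_closure {G : Set ℕ} {a : ℕ} (ha : a ∈ AddSubmonoid.closure G) : a = 0 ∨
    a ∈ G ∨ a ∈ ((AddSubmonoid.closure G : Set ℕ) \ {0}) +
      ((AddSubmonoid.closure G : Set ℕ) \ {0}) := by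
  induction ha using AddSubmonoid.closure_induction with
  | mem x hx => exact Or.inr (Or.inl hx)
  | zero => exact Or.inl rfl
  | add x y hx hy ihx ihy =>
    rcases eq_or_ne x 0 with rfl | hx0
    · rwa [zero_add]
    rcases eq_or_ne y 0 with rfl | hy0
    · rwa [add_zero]
    exact Or.inr (Or.inr (Set.add_mem_add ⟨hx, hx0⟩ ⟨hy, hy0⟩))

lemma prime_mem_Sx {ε : ℝ} (hε : 0 < ε) {m₀ n : ℕ} (hn : m₀ ≤ nthPrime n)
    (hm₀ : ∀ m ≥ m₀, Odd m → ∃ p q r : ℕ, p.Prime ∧ q.Prime ∧ r.Prime ∧ p + q + r = m ∧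
      (m : ℝ) ≤ (3 + ε) * p ∧ (m : ℝ) ≤ (3 + ε) * q ∧ (m : ℝ) ≤ (3 + ε) * r)
    (hn2 : 2 ≤ nthPrime n) (p : ℕ) (hp : p.Prime) (hnp : nthPrime n ≤ p) : p ∈ Sx n (3 + ε) := by
  induction p using Nat.strong_induction_on with
  | _ p ih =>
    rcases lt_or_ge (p : ℝ) ((3 + ε) * nthPrime n) with hlt | hge
    · exact AddSubmonoid.subset_closure ⟨hp, hnp, hlt⟩
    have hn2' : (2 : ℝ) ≤ nthPrime n := by exact_mod_cast hn2
    have hp2 : p ≠ 2 := by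
      rintro rfl
      push_cast at hge
      nlinarith
    obtain ⟨a, b, c, ha, hb, hc, habc, h1, h2, h3⟩ :=
      hm₀ p (hn.trans hnp) (hp.odd_of_ne_two hp2)
    have hle : ∀ {q : ℕ}, (p : ℝ) ≤ (3 + ε) * q → nthPrime n ≤ q := fun h => by
      exact_mod_cast le_of_mul_le_mul_left (hge.trans h) (by linarith)
    have := ha.pos
    have := hb.pos
    have := hc.pos
    rw [← habc]
    exact add_mem (add_mem (ih a (by omega) ha (hle h1)) (ih b (by omega) hb (hle h2)))
      (ih c (by omega) hc (hle h3))

theorem S_eq_Sx_of_large (ε : ℝ) (hε : 0 < ε) :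
    ∃ n₀ : ℕ, ∀ n ≥ n₀, S n = Sx n (3 + ε) ∧
      ∀ a ∈ atoms n, nthPrime n ≤ a ∧ (a : ℝ) < (3 + ε) * (nthPrime n : ℝ) := by
  obtain ⟨m₀, hm₀⟩ := exists_primes_add_eq hε
  refine ⟨m₀ + 1, fun n hn => ?_⟩
  have hn0 : m₀ ≤ nthPrime n :=
    (show m₀ ≤ n - 1 by omega).trans (Nat.nth_strictMono Nat.infinite_setOfPred_prime).le_apply
  have hn2 : 2 ≤ nthPrime n := (Nat.prime_nth_prime _).two_le
  have hS : S n = Sx n (3 + ε) := by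
    refine le_antisymm ((AddSubmonoid.closure_le).2 fun p hp =>
      prime_mem_Sx hε hn0 hm₀ hn2 p hp.1 hp.2) ?_
    exact AddSubmonoid.closure_mono fun p hp => ⟨hp.1, hp.2.1⟩
  refine ⟨hS, fun a ha => ?_⟩
  obtain ⟨⟨haS, ha0⟩, hadd⟩ := ha
  rw [hS] at haS hadd
  rcases eq_zero_or_mem_or_mem_add_of_mem_closure haS with h | h | h
  · exact absurd h ha0
  · exact h.2
  · exact absurd h hadd
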